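/- Let Q satisfy Assumption (A). There exists a constant C₀ > 0 such that for every R > 0 there exists δ₀(R) ∈ (0, ½|∇φ_Q|_{L²(ℝ³)}] with the following property: every f ∈ E_rad satisfying |f − Q|_E ≤ R and |∇φ_f − ∇φ_Q|_{L²(ℝ³)} ≤ δ₀(R) satisfies J(φ_f) − J(φ_Q) ≥ C₀ |∇φ_f − ∇φ_Q|²_{L²(ℝ³)}. -/

import Mathlib

noncomputable section

open MeasureTheory Real Filter Set Topology
open scoped ENNReal NNReal

abbrev E3 : Type := EuclideanSpace ℝ (Fin 3)
abbrev Phase : Type := E3 × E3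

/-- Spherical symmetry: invariance under all rotations of `ℝ³` acting jointly on `x` and `v`. -/
def SphSym (f : Phase → ℝ) : Prop :=
  ∀ R : E3 ≃ₗᵢ[ℝ] E3, LinearMap.det (R.toLinearEquiv : E3 →ₗ[ℝ] E3) = 1 →
    ∀ z : Phase, f (R z.1, R z.2) = f z

/-- `|x × v|²`, via the Lagrange identity. -/
def ellOf (z : Phase) : ℝ := ‖z.1‖ ^ 2 * ‖z.2‖ ^ 2 - (inner ℝ z.1 z.2 : ℝ) ^ 2

/-- Spatial density. -/
def rhoF (f : Phase → ℝ) (x : E3) : ℝ := ∫ v : E3, f (x, v)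

/-- Poisson field. -/
def phiF (f : Phase → ℝ) (x : E3) : ℝ := - ∫ y : E3, rhoF f y / (4 * π * ‖x - y‖)

/-- Radial representation of the Poisson field. -/
def phiRad (f : Phase → ℝ) (r : ℝ) : ℝ :=
  phiF f (r • (EuclideanSpace.single (0 : Fin 3) (1:ℝ)))

def mass (f : Phase → ℝ) : ℝ := ∫ z : Phase, f z

def kineticE (f : Phase → ℝ) : ℝ := ∫ z : Phase, ‖z.2‖ ^ 2 * f z

def gradPhi (f : Phase → ℝ) (x : E3) : E3 := gradient (phiF f) x

def fieldSq (f : Phase → ℝ) : ℝ := ∫ x : E3, ‖gradPhi f x‖ ^ 2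

/-- `L²` distance between the force fields of `f` and `g`. -/
def fieldDist (f g : Phase → ℝ) : ℝ :=
  Real.sqrt (∫ x : E3, ‖gradPhi f x - gradPhi g x‖ ^ 2)

/-- The Hamiltonian. -/
def Ham (f : Phase → ℝ) : ℝ := kineticE f / 2 - fieldSq f / 2

/-- The norm of the energy space. -/
def eNormE (f : Phase → ℝ) : ℝ≥0∞ :=
  eLpNorm f 1 volume + eLpNorm f ⊤ volume +
    ∫⁻ z : Phase, (‖z.2‖₊ : ℝ≥0∞) ^ 2 * (‖f z‖₊ : ℝ≥0∞)

def memE (f : Phase → ℝ) : Prop := Measurable f ∧ (∀ z, 0 ≤ f z) ∧ eNormE f < ⊤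

def memErad (f : Phase → ℝ) : Prop := memE f ∧ SphSym f

/-- Density of the measure `ν_ℓ`. -/
def nuDens (ℓ : ℝ) (p : ℝ × ℝ) : ℝ≥0∞ :=
  if 0 < p.1 ∧ ℓ < p.1 ^ 2 * p.2 ^ 2 then
    ENNReal.ofReal (4 * π ^ 2 * p.1 * |p.2| / Real.sqrt (p.1 ^ 2 * p.2 ^ 2 - ℓ))
  else 0

def nuMeas (ℓ : ℝ) : Measure (ℝ × ℝ) := volume.withDensity (nuDens ℓ)

/-- Representative phase point with `|x| = r`, `|v| = |u|`, `|x×v|² = ℓ` and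
`x·v = sign u · √(r²u²-ℓ)`. -/
def radPoint (r u ℓ : ℝ) : Phase :=
  (r • (EuclideanSpace.single (0 : Fin 3) (1:ℝ)),
   (Real.sign u * Real.sqrt (r ^ 2 * u ^ 2 - ℓ) / r) • (EuclideanSpace.single (0 : Fin 3) (1:ℝ))
     + (Real.sqrt ℓ / r) • (EuclideanSpace.single (1 : Fin 3) (1:ℝ)))

/-- Distribution function of `f` at kinetic momentum `ℓ`. -/
def muDist (f : Phase → ℝ) (s ℓ : ℝ) : ℝ≥0∞ :=
  nuMeas ℓ {p : ℝ × ℝ | s < f (radPoint p.1 p.2 ℓ)}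

/-- `g ∈ Eq(f)` : `g` is nonnegative, spherically symmetric and equimeasurable to `f`
at (almost) every kinetic momentum `ℓ`. -/
def EqMeas (f g : Phase → ℝ) : Prop :=
  (∀ z, 0 ≤ g z) ∧ SphSym g ∧
    ∀ s : ℝ, 0 < s →
      ∀ᵐ ℓ ∂(volume.restrict (Ioi (0:ℝ))), muDist g s ℓ = muDist f s ℓ

/-- Schwarz symmetrization of `f` at fixed `ℓ`. -/
def schwarz (f : Phase → ℝ) (t ℓ : ℝ) : ℝ :=
  if ENNReal.ofReal t < muDist f 0 ℓ then
    sSup {s : ℝ | 0 ≤ s ∧ ENNReal.ofReal t < muDist f s ℓ}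
  else 0

/-- Effective potential. -/
def psiPot (φ : ℝ → ℝ) (ℓ r : ℝ) : ℝ := φ r + ℓ / (2 * r ^ 2)

def eMinPot (φ : ℝ → ℝ) (ℓ : ℝ) : ℝ := sInf (psiPot φ ℓ '' Ioi 0)

def r1Pot (φ : ℝ → ℝ) (e ℓ : ℝ) : ℝ := sInf {r : ℝ | 0 < r ∧ psiPot φ ℓ r < e}

def r2Pot (φ : ℝ → ℝ) (e ℓ : ℝ) : ℝ := sSup {r : ℝ | 0 < r ∧ psiPot φ ℓ r < e}

/-- The Jacobian `a_φ(e, ℓ)` (meaningful for `e < 0`). -/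
def aPot (φ : ℝ → ℝ) (e ℓ : ℝ) : ℝ :=
  8 * π ^ 2 * Real.sqrt 2 * ∫ r in Ioi (0:ℝ), Real.sqrt (max (e - psiPot φ ℓ r) 0)

/-- Inverse of the bijection `e ↦ a_φ(e,ℓ)` from `(e_{φ,ℓ},0)` onto `(0,∞)`. -/
def aPotInv (φ : ℝ → ℝ) (s ℓ : ℝ) : ℝ :=
  sSup {e : ℝ | eMinPot φ ℓ < e ∧ e < 0 ∧ aPot φ e ℓ < s}

/-- Microscopic energy w.r.t. the Poisson field of `g`. -/
def microE (g : Phase → ℝ) (z : Phase) : ℝ := ‖z.2‖ ^ 2 / 2 + phiF g z.1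

/-- Rearrangement of `f` with respect to the microscopic energy of the field of `g`. -/
def rearr (f g : Phase → ℝ) (z : Phase) : ℝ :=
  if microE g z < 0 then
    schwarz f (aPot (phiRad g) (microE g z) (ellOf z)) (ellOf z)
  else 0

/-- Assumption (A). -/
structure AssumptionA (Q : Phase → ℝ) (F : ℝ → ℝ → ℝ) (e₀ : ℝ) : Prop where
  contQ : Continuous Q
  nonneg : ∀ z, 0 ≤ Q z
  nonzero : Q ≠ 0
  cpt : HasCompactSupport Q
  sph : SphSym Q
  eqF : ∀ z : Phase, Q z = F (microE Q z) (ellOf z)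
  Fnonneg : ∀ e ℓ, 0 ≤ ℓ → 0 ≤ F e ℓ
  Fcont : ContinuousOn (fun p : ℝ × ℝ => F p.1 p.2) {p : ℝ × ℝ | 0 ≤ p.2}
  e₀neg : e₀ < 0
  Fsupp : ∀ e ℓ, 0 ≤ ℓ → 0 < F e ℓ → e < e₀
  FC1 : ContDiffOn ℝ 1 (fun p : ℝ × ℝ => F p.1 p.2) {p : ℝ × ℝ | 0 ≤ p.2 ∧ 0 < F p.1 p.2}
  FeNeg : ∀ e ℓ, 0 ≤ ℓ → 0 < F e ℓ → deriv (fun e' => F e' ℓ) e < 0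

/-- The reduced functional `J_{f^*}(φ_g) = H(f^{*φ_g}) + ½|∇φ_g − ∇φ_{f^{*φ_g}}|²`. -/
def Jred (f g : Phase → ℝ) : ℝ :=
  Ham (rearr f g) + (∫ x : E3, ‖gradPhi g x - gradPhi (rearr f g) x‖ ^ 2) / 2

def distL1 (f g : Phase → ℝ) : ℝ := ∫ z : Phase, |f z - g z|

def distL1v (f g : Phase → ℝ) : ℝ := ∫ z : Phase, ‖z.2‖ ^ 2 * |f z - g z|


section M1

def e1 : E3 := EuclideanSpace.single (0 : Fin 3) (1:ℝ)
def e2 : E3 := EuclideanSpace.single (1 : Fin 3) (1:ℝ)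
def e3 : E3 := EuclideanSpace.single (2 : Fin 3) (1:ℝ)

def pt (r w l : ℝ) : Phase := (r • e1, w • e1 + (Real.sqrt l / r) • e2)

def SphK {α : Type*} (f : Phase → α) : Prop :=
  ∀ R : E3 ≃ₗᵢ[ℝ] E3, LinearMap.det (R.toLinearEquiv : E3 →ₗ[ℝ] E3) = 1 →
    ∀ z : Phase, f (R z.1, R z.2) = f z

lemma planar_lintegral (h : ℝ → ℝ≥0∞) (hh : Measurable h) :
    ∫⁻ p : ℝ × ℝ, h (p.1 ^ 2 + p.2 ^ 2) = ENNReal.ofReal π * ∫⁻ t in Ioi (0:ℝ), h t := by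
  rw [← lintegral_comp_polarCoord_symm, polarCoord_target]
  have e : ∀ p : ℝ × ℝ, (polarCoord.symm p).1 ^ 2 + (polarCoord.symm p).2 ^ 2 = p.1 ^ 2 := by
    intro p
    simp only [polarCoord_symm_apply]
    nlinarith [Real.sin_sq_add_cos_sq p.2]
  simp only [e]
  rw [Measure.volume_eq_prod, ← Measure.prod_restrict, lintegral_prod _ (by fun_prop)]
  simp only [lintegral_const, Measure.restrict_apply MeasurableSet.univ, univ_inter,
    Real.volume_Ioo]
  have himg : (fun x : ℝ => x ^ 2) '' Ioi (0:ℝ) = Ioi 0 := by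
    ext t; constructor
    · rintro ⟨x, hx, rfl⟩; exact pow_pos (mem_Ioi.1 hx) 2
    · intro ht; exact ⟨√t, Real.sqrt_pos.2 ht, Real.sq_sqrt (le_of_lt ht)⟩
  have := lintegral_image_eq_lintegral_abs_deriv_mul (s := Ioi (0:ℝ)) (f := fun x => x ^ 2)
    (f' := fun x => 2 * x) measurableSet_Ioi
    (fun x _ => by simpa using ((hasDerivAt_pow 2 x).hasDerivWithinAt))
    (fun x hx y hy hxy => by
      have : x ^ 2 = y ^ 2 := hxy
      exact (pow_left_inj₀ (le_of_lt hx) (le_of_lt hy) two_ne_zero).1 this) h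
  rw [himg] at this
  rw [this, ← lintegral_const_mul _ (by fun_prop)]
  refine setLIntegral_congr_fun measurableSet_Ioi fun x hx => ?_
  have hx' : 0 < x := hx
  rw [smul_eq_mul, abs_of_pos (by positivity), ← mul_assoc, ← ENNReal.ofReal_mul pi_pos.le,
    mul_right_comm, ← ENNReal.ofReal_mul hx'.le]
  congr 2; ring

lemma axis_lintegral (k : ℝ → ℝ → ℝ≥0∞) (hk : Measurable (Function.uncurry k)) :
    ∫⁻ v : E3, k (v 0) ((v 1) ^ 2 + (v 2) ^ 2)
      = ENNReal.ofReal π * ∫⁻ w, ∫⁻ t in Ioi (0:ℝ), k w t := by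
  have h1 := (PiLp.volume_preserving_ofLp (Fin 3)).lintegral_comp_emb
    (MeasurableEquiv.toLp 2 (Fin 3 → ℝ)).symm.measurableEmbedding
    (fun v : Fin 3 → ℝ => k (v 0) ((v 1) ^ 2 + (v 2) ^ 2))
  have h2 := (volume_preserving_piFinSuccAbove (fun _ : Fin 3 => ℝ) 0).lintegral_comp_emb
    (MeasurableEquiv.measurableEmbedding _)
    (fun p : ℝ × (Fin 2 → ℝ) => k p.1 ((p.2 0) ^ 2 + (p.2 1) ^ 2))
  have h3 : ∀ w, ∫⁻ p : Fin 2 → ℝ, k w ((p 0) ^ 2 + (p 1) ^ 2)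
      = ∫⁻ p : ℝ × ℝ, k w (p.1 ^ 2 + p.2 ^ 2) := fun w =>
    (volume_preserving_finTwoArrow ℝ).lintegral_comp_emb
    (MeasurableEquiv.measurableEmbedding _)
    (fun p : ℝ × ℝ => k w (p.1 ^ 2 + p.2 ^ 2))
  have hm : ∀ (f g : ℝ × (Fin 2 → ℝ) → ℝ), Measurable f → Measurable g →
      Measurable fun x => k (f x) (g x) := fun f g hf hg => hk.comp (hf.prodMk hg)
  calc _ = _ := h1
    _ = _ := h2
    _ = ∫⁻ w, ∫⁻ p : Fin 2 → ℝ, k w ((p 0) ^ 2 + (p 1) ^ 2) := by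
        rw [Measure.volume_eq_prod, lintegral_prod _ (hm _ _ (by fun_prop) (by fun_prop)).aemeasurable]
    _ = ∫⁻ w, ENNReal.ofReal π * ∫⁻ t in Ioi (0:ℝ), k w t := by
        congr 1; ext w; rw [h3, planar_lintegral (k w) (hk.comp measurable_prodMk_left)]
    _ = _ := lintegral_const_mul _ (hk.lintegral_prod_right' )

lemma axis_lintegral' (K : ℝ → ℝ → ℝ≥0∞) (hK : Measurable (Function.uncurry K)) :
    ∫⁻ y : E3, K ‖y‖ (y 0)
      = ∫⁻ s in Ioi (0:ℝ), ∫⁻ w in Ioo (-s) s, ENNReal.ofReal (2 * π * s) * K s w := by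
  have hn : ∀ y : E3, ‖y‖ = √((y 0) ^ 2 + ((y 1) ^ 2 + (y 2) ^ 2)) := by
    intro y; rw [EuclideanSpace.norm_eq]; simp [Fin.sum_univ_three, add_assoc]
  have hc : ∀ (f g : ℝ × ℝ → ℝ), Measurable f → Measurable g →
      Measurable fun x => K (f x) (g x) := fun f g hf hg => hK.comp (hf.prodMk hg)
  have hc1 : ∀ (f g : ℝ → ℝ), Measurable f → Measurable g →
      Measurable fun x => K (f x) (g x) := fun f g hf hg => hK.comp (hf.prodMk hg)
  have h := axis_lintegral (fun w t => K (√(w ^ 2 + t)) w) (hc _ _ (by fun_prop) (by fun_prop))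
  simp only [hn]
  rw [h]
  have h2 : ∀ w : ℝ, ∫⁻ t in Ioi (0:ℝ), K (√(w ^ 2 + t)) w
      = ∫⁻ s in Ioi |w|, ENNReal.ofReal (2 * s) * K s w := by
    intro w
    have himg : (fun x : ℝ => x ^ 2 - w ^ 2) '' Ioi |w| = Ioi 0 := by
      ext t; constructor
      · rintro ⟨x, hx, rfl⟩
        have hx : |w| < x := hx
        have := sq_lt_sq' (by linarith [abs_nonneg w]) hx
        rw [sq_abs] at this
        exact sub_pos.2 this
      · intro ht
        have ht : 0 < t := ht
        refine ⟨√(t + w ^ 2), ?_, ?_⟩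
        · show |w| < _
          rw [← Real.sqrt_sq_eq_abs]; exact Real.sqrt_lt_sqrt (sq_nonneg _) (by linarith)
        · show √(t + w ^ 2) ^ 2 - w ^ 2 = t
          rw [Real.sq_sqrt (by positivity)]; ring
    have := lintegral_image_eq_lintegral_abs_deriv_mul (s := Ioi |w|) (f := fun x => x ^ 2 - w ^ 2)
      (f' := fun x => 2 * x) measurableSet_Ioi
      (fun x _ => by simpa using ((hasDerivAt_pow 2 x).sub_const (w ^ 2)).hasDerivWithinAt)
      (fun x hx y hy hxy => by
        have hxy : x ^ 2 - w ^ 2 = y ^ 2 - w ^ 2 := hxy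
        have hx : |w| < x := hx
        have hy : |w| < y := hy
        exact (pow_left_inj₀ ((abs_nonneg w).trans hx.le) ((abs_nonneg w).trans hy.le)
          two_ne_zero).1 (by linarith)) (fun t => K (√(w ^ 2 + t)) w)
    rw [himg] at this
    rw [this]
    refine setLIntegral_congr_fun measurableSet_Ioi fun x hx => ?_
    have hx : |w| < x := hx
    have hx0 : 0 ≤ x := (abs_nonneg w).trans hx.le
    rw [abs_of_nonneg (by linarith), show w ^ 2 + (x ^ 2 - w ^ 2) = x ^ 2 by ring,
      Real.sqrt_sq hx0]
  simp only [h2]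
  have hS : MeasurableSet {p : ℝ × ℝ | |p.1| < p.2} :=
    measurableSet_lt (by fun_prop) (by fun_prop)
  have h3 : ∀ w : ℝ, ∫⁻ s in Ioi |w|, ENNReal.ofReal (2 * s) * K s w
     = ∫⁻ s, {p : ℝ × ℝ | |p.1| < p.2}.indicator (fun p => ENNReal.ofReal (2 * p.2) * K p.2 p.1) (w, s) := by
    intro w
    rw [← lintegral_indicator measurableSet_Ioi]
    rfl
  simp only [h3]
  rw [lintegral_lintegral_swap]
  · rw [← lintegral_const_mul', ← lintegral_indicator measurableSet_Ioi]
    · congr 1; ext s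
      by_cases hs : 0 < s
      · rw [indicator_of_mem (show s ∈ Ioi 0 from hs), ← lintegral_const_mul',
          ← lintegral_indicator measurableSet_Ioo]
        · congr 1; ext w
          by_cases hw : |w| < s
          · rw [indicator_of_mem (show (w,s) ∈ {p : ℝ × ℝ | |p.1| < p.2} from hw),
              indicator_of_mem (show w ∈ Ioo (-s) s from abs_lt.1 hw), ← mul_assoc,
              ← ENNReal.ofReal_mul pi_pos.le]
            congr 2; ring
          · rw [indicator_of_notMem (show (w,s) ∉ {p : ℝ × ℝ | |p.1| < p.2} from hw),
              indicator_of_notMem (show w ∉ Ioo (-s) s from fun h => hw (abs_lt.2 h)), mul_zero]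
        · simp
      · rw [indicator_of_notMem (show s ∉ Ioi 0 from hs)]
        have : ∀ w : ℝ, (w, s) ∉ {p : ℝ × ℝ | |p.1| < p.2} := fun w h =>
          hs ((abs_nonneg w).trans_lt h)
        simp [indicator_of_notMem, this]
    · simp
  · exact (((by fun_prop : Measurable fun p : ℝ × ℝ => ENNReal.ofReal (2 * p.2)).mul
      (hc _ _ (by fun_prop) (by fun_prop))).indicator hS).aemeasurable

end M1

section M2

lemma inner_e1 (v : E3) : inner ℝ e1 v = v 0 := by
  simp [e1, EuclideanSpace.inner_single_left]
lemma inner_e2 (v : E3) : inner ℝ e2 v = v 1 := by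
  simp [e2, EuclideanSpace.inner_single_left]
lemma norm_e1 : ‖e1‖ = 1 := by simp [e1]
lemma norm_e2 : ‖e2‖ = 1 := by simp [e2]
lemma e1_ne : (e1 : E3) 0 = 1 ∧ (e1 : E3) 1 = 0 ∧ (e1 : E3) 2 = 0 := by
  simp [e1]
lemma e2_ne : (e2 : E3) 0 = 0 ∧ (e2 : E3) 1 = 1 ∧ (e2 : E3) 2 = 0 := by
  simp [e2]

lemma refl_det (K : Submodule ℝ E3) :
    LinearMap.det (K.reflection.toLinearEquiv : E3 →ₗ[ℝ] E3) = 1 ∨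
    LinearMap.det (K.reflection.toLinearEquiv : E3 →ₗ[ℝ] E3) = -1 := by
  have := K.det_reflection
  rw [show (K.reflection.toLinearEquiv : E3 →ₗ[ℝ] E3) = K.reflection.toLinearMap from rfl, this]
  exact neg_one_pow_eq_or ℝ _

lemma exists_rot (x v : E3) : ∃ R : E3 ≃ₗᵢ[ℝ] E3,
    LinearMap.det (R.toLinearEquiv : E3 →ₗ[ℝ] E3) = 1 ∧ R x = ‖x‖ • e1 ∧
    ∃ α β : ℝ, 0 ≤ β ∧ R v = α • e1 + β • e2 := by
  set R1 := (ℝ ∙ (x - ‖x‖ • e1))ᗮ.reflection with hR1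
  have h1 : R1 x = ‖x‖ • e1 := Submodule.reflection_sub (by rw [norm_smul, norm_e1]; simp)
  set α : ℝ := (R1 v) 0
  set u : E3 := R1 v - α • e1 with hu
  have hue : inner ℝ e1 u = 0 := by
    rw [hu, inner_sub_right, inner_smul_right, inner_e1, inner_e1, e1_ne.1]; simp [α]
  set R2 := (ℝ ∙ (u - ‖u‖ • e2))ᗮ.reflection with hR2
  have h2 : R2 u = ‖u‖ • e2 := Submodule.reflection_sub (by rw [norm_smul, norm_e2]; simp)
  have h3 : R2 e1 = e1 := by
    apply Submodule.reflection_mem_subspace_eq_self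
    rw [Submodule.mem_orthogonal_singleton_iff_inner_left, inner_sub_right, inner_smul_right, hue,
      inner_e1, e2_ne.1]; simp
  set R3 := (ℝ ∙ e3)ᗮ.reflection with hR3
  have h4 : R3 e1 = e1 := by
    apply Submodule.reflection_mem_subspace_eq_self
    rw [Submodule.mem_orthogonal_singleton_iff_inner_left, inner_e1]; simp [e3]
  have h5 : R3 e2 = e2 := by
    apply Submodule.reflection_mem_subspace_eq_self
    rw [Submodule.mem_orthogonal_singleton_iff_inner_left, inner_e2]; simp [e3]
  have d3 : LinearMap.det (R3.toLinearEquiv : E3 →ₗ[ℝ] E3) = -1 := by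
    have := ((ℝ ∙ e3)ᗮ).det_reflection
    rw [show (R3.toLinearEquiv : E3 →ₗ[ℝ] E3) = R3.toLinearMap from rfl, this,
      Submodule.orthogonal_orthogonal, finrank_span_singleton (by simp [e3])]
    simp
  have hv : R2 (R1 v) = α • e1 + ‖u‖ • e2 := by
    have : R1 v = α • e1 + u := by rw [hu]; abel
    rw [this, map_add, map_smul, h2, h3]
  have hx : R2 (R1 x) = ‖x‖ • e1 := by rw [h1, map_smul, h3]
  have hd : ∀ A B : E3 ≃ₗᵢ[ℝ] E3, LinearMap.det ((A.trans B).toLinearEquiv : E3 →ₗ[ℝ] E3)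
      = LinearMap.det (B.toLinearEquiv : E3 →ₗ[ℝ] E3) * LinearMap.det (A.toLinearEquiv : E3 →ₗ[ℝ] E3) := by
    intro A B
    rw [← LinearMap.det_comp]; rfl
  have hdd : LinearMap.det ((R1.trans R2).toLinearEquiv : E3 →ₗ[ℝ] E3) = 1 ∨
      LinearMap.det ((R1.trans R2).toLinearEquiv : E3 →ₗ[ℝ] E3) = -1 := by
    rw [hd]
    rcases refl_det (ℝ ∙ (x - ‖x‖ • e1))ᗮ with h | h <;>
    rcases refl_det (ℝ ∙ (u - ‖u‖ • e2))ᗮ with h' | h' <;> rw [← hR1] at h <;> rw [← hR2] at h' <;>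
    rw [h, h'] <;> norm_num
  rcases hdd with h | h
  · exact ⟨R1.trans R2, h, hx, α, ‖u‖, norm_nonneg _, hv⟩
  · refine ⟨(R1.trans R2).trans R3, by rw [hd, h, d3]; norm_num, ?_, α, ‖u‖, norm_nonneg _, ?_⟩
    · show R3 (R2 (R1 x)) = _
      rw [hx, map_smul, h4]
    · show R3 (R2 (R1 v)) = _
      rw [hv, map_add, map_smul, map_smul, h4, h5]

lemma norm_ab (α β : ℝ) : ‖α • e1 + β • e2‖ ^ 2 = α ^ 2 + β ^ 2 := by
  rw [EuclideanSpace.real_norm_sq_eq]; simp [Fin.sum_univ_three, e1, e2]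

lemma sph_pt {A : Type*} {K : Phase → A} (hK : SphK K) (z : Phase) (hx : z.1 ≠ 0) :
    K z = K (pt ‖z.1‖ (inner ℝ z.1 z.2 / ‖z.1‖) (ellOf z)) := by
  obtain ⟨R, hd, hRx, α, β, hβ, hRv⟩ := exists_rot z.1 z.2
  have hr : 0 < ‖z.1‖ := norm_pos_iff.2 hx
  have hin : inner ℝ z.1 z.2 = ‖z.1‖ * α := by
    rw [← R.inner_map_map, hRx, hRv, inner_smul_left, inner_add_right, inner_smul_right,
      inner_smul_right, inner_e1, inner_e1, e1_ne.1, e2_ne.1]; simp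
  have hnv : ‖z.2‖ ^ 2 = α ^ 2 + β ^ 2 := by
    rw [← norm_ab, ← hRv, R.norm_map]
  have hl : ellOf z = (‖z.1‖ * β) ^ 2 := by
    rw [ellOf, hin, hnv]; ring
  rw [← hK R hd z, hRx, hRv, hl, hin, pt, Real.sqrt_sq (by positivity)]
  congr 4 <;> field_simp

lemma norm_pt1 {r : ℝ} (hr : 0 < r) (w l : ℝ) : ‖(pt r w l).1‖ = r := by
  simp [pt, norm_smul, norm_e1, abs_of_pos hr]
lemma norm_pt2 {r : ℝ} (w : ℝ) {l : ℝ} (hl : 0 ≤ l) :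
    ‖(pt r w l).2‖ ^ 2 = w ^ 2 + l / r ^ 2 := by
  simp only [pt]; rw [norm_ab, div_pow, Real.sq_sqrt hl]
lemma inner_pt (r w l : ℝ) : inner ℝ (pt r w l).1 (pt r w l).2 = r * w := by
  simp [pt, inner_smul_left, inner_add_right, inner_smul_right, inner_e1, e2_ne, norm_e1, mul_comm]
lemma ell_pt {r : ℝ} (hr : 0 < r) (w : ℝ) {l : ℝ} (hl : 0 ≤ l) : ellOf (pt r w l) = l := by
  rw [ellOf, norm_pt1 hr, norm_pt2 w hl, inner_pt]; field_simp; ring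
lemma measurable_pt : Measurable (fun p : ℝ × ℝ × ℝ => pt p.1 p.2.1 p.2.2) := by
  unfold pt
  refine Measurable.prodMk ?_ ?_
  · exact measurable_fst.smul_const e1
  · refine Measurable.add ?_ ?_
    · exact (measurable_fst.comp measurable_snd).smul_const e1
    · exact (by fun_prop : Measurable fun p : ℝ × ℝ × ℝ => √p.2.2 / p.1).smul_const e2

lemma measurable_pt' {A : Type*} [MeasurableSpace A] {f g h : A → ℝ} (hf : Measurable f)
    (hg : Measurable g) (hh : Measurable h) : Measurable fun x => pt (f x) (g x) (h x) :=
  measurable_pt.comp (hf.prodMk (hg.prodMk hh))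

lemma radial_lintegral (P : ℝ → ℝ≥0∞) (hP : Measurable P) :
    ∫⁻ x : E3, P ‖x‖ = ∫⁻ r in Ioi (0:ℝ), ENNReal.ofReal (4 * π * r ^ 2) * P r := by
  rw [axis_lintegral' (fun s _ => P s) (hP.comp measurable_fst)]
  refine setLIntegral_congr_fun measurableSet_Ioi fun r hr => ?_
  have hr : 0 < r := hr
  simp only [lintegral_const, Measure.restrict_apply MeasurableSet.univ, univ_inter,
    Real.volume_Ioo]
  rw [mul_right_comm, ← ENNReal.ofReal_mul (by positivity)]
  congr 2; ring

/-- Disintegration. -/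
lemma disint (K : Phase → ℝ≥0∞) (hK : Measurable K) (hS : SphK K) :
    ∫⁻ z, K z = ∫⁻ l in Ioi (0:ℝ), ∫⁻ r in Ioi (0:ℝ), ∫⁻ w : ℝ,
      ENNReal.ofReal (4 * π ^ 2) * K (pt r w l) := by
  have hm : ∀ {f g h : ℝ × ℝ × ℝ → ℝ}, Measurable f → Measurable g → Measurable h →
      Measurable fun x => K (pt (f x) (g x) (h x)) :=
    fun hf hg hh => hK.comp (measurable_pt' hf hg hh)
  rw [Measure.volume_eq_prod, lintegral_prod _ hK.aemeasurable]
  have hPm : Measurable fun r : ℝ => ∫⁻ v : E3, K (r • e1, v) := by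
    apply Measurable.lintegral_prod_right' (f := fun p : ℝ × E3 => K (p.1 • e1, p.2))
    exact hK.comp ((measurable_fst.smul_const e1).prodMk measurable_snd)
  have h1 : ∀ x : E3, ∫⁻ v : E3, K (x, v) = (fun r : ℝ => ∫⁻ v : E3, K (r • e1, v)) ‖x‖ := by
    intro x
    obtain ⟨R, hd, hRx, -⟩ := exists_rot x 0
    have := (R.measurePreserving).lintegral_comp_emb R.toMeasurableEquiv.measurableEmbedding
      (fun v => K (‖x‖ • e1, v))
    simp only
    rw [← this]
    congr 1; ext v
    rw [← hRx]; exact (hS R hd (x, v)).symm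
  rw [lintegral_congr h1, radial_lintegral _ hPm]
  have h2 : ∀ r ∈ Ioi (0:ℝ), ENNReal.ofReal (4 * π * r ^ 2) * ∫⁻ v : E3, K (r • e1, v)
      = ∫⁻ l in Ioi (0:ℝ), ∫⁻ w : ℝ, ENNReal.ofReal (4 * π ^ 2) * K (pt r w l) := by
    intro r hr
    have hr : 0 < r := hr
    have h3 : ∀ v : E3, K (r • e1, v) = K (pt r (v 0) (r ^ 2 * ((v 1) ^ 2 + (v 2) ^ 2))) := by
      intro v
      have hne : r • e1 ≠ 0 := by
        rw [← norm_pos_iff, norm_smul, norm_e1]; simp [hr.ne']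
      rw [sph_pt hS (r • e1, v) hne]
      have ha : ‖r • e1‖ = r := by rw [norm_smul, norm_e1]; simp [hr.le]
      have hb : inner ℝ (r • e1) v = r * v 0 := by rw [inner_smul_left, inner_e1]; simp
      simp only [ellOf, ha, hb]
      congr 2
      · field_simp
      · rw [EuclideanSpace.real_norm_sq_eq]; simp [Fin.sum_univ_three]; ring
    simp only [h3]
    rw [axis_lintegral (fun w t => K (pt r w (r ^ 2 * t)))
      (hK.comp (measurable_pt' measurable_const measurable_fst (by fun_prop)))]
    have h4 : ∀ w : ℝ, ENNReal.ofReal (r ^ 2) * ∫⁻ t in Ioi (0:ℝ), K (pt r w (r ^ 2 * t))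
        = ∫⁻ l in Ioi (0:ℝ), K (pt r w l) := by
      intro w
      have himg : (fun t : ℝ => r ^ 2 * t) '' Ioi (0:ℝ) = Ioi 0 := by
        ext t; constructor
        · rintro ⟨x, hx, rfl⟩; exact mul_pos (by positivity) (mem_Ioi.1 hx)
        · intro ht; exact ⟨t / r ^ 2, div_pos (mem_Ioi.1 ht) (by positivity), by field_simp⟩
      have := lintegral_image_eq_lintegral_abs_deriv_mul (s := Ioi (0:ℝ)) (f := fun t => r ^ 2 * t)
        (f' := fun x => r ^ 2) measurableSet_Ioi
        (fun x _ => by simpa using ((hasDerivAt_id x).const_mul (r ^ 2)).hasDerivWithinAt)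
        (fun x hx y hy hxy => mul_left_cancel₀ (by positivity) hxy) (fun l => K (pt r w l))
      rw [himg] at this
      rw [this, abs_of_nonneg (by positivity), lintegral_const_mul']
      simp
    symm; rw [lintegral_lintegral_swap]; symm
    · rw [← lintegral_const_mul', ← lintegral_const_mul']
      · congr 1; ext w
        rw [lintegral_const_mul', ← h4 w, ← mul_assoc, ← mul_assoc, ← ENNReal.ofReal_mul (by positivity),
          ← ENNReal.ofReal_mul (by positivity)]
        · congr 2; ring
        · exact ENNReal.ofReal_ne_top
      · simp
      · simp
    · exact (measurable_const.mul (hK.comp (measurable_pt' measurable_const measurable_snd measurable_fst))).aemeasurable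
  rw [setLIntegral_congr_fun measurableSet_Ioi h2, lintegral_lintegral_swap]
  refine Measurable.aemeasurable ?_
  apply Measurable.lintegral_prod_right' (f := fun p : (ℝ × ℝ) × ℝ => ENNReal.ofReal (4 * π ^ 2) * K (pt p.1.1 p.2 p.1.2))
  exact measurable_const.mul (hK.comp (measurable_pt' (by fun_prop) measurable_snd (by fun_prop)))

end M2

section M3

lemma slice_u (r l : ℝ) (hr : 0 < r) (hl : 0 < l) (h : ℝ → ℝ≥0∞) :
    ∫⁻ u, nuDens l (r, u) * h (Real.sign u * √(r ^ 2 * u ^ 2 - l) / r)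
      = ENNReal.ofReal (4 * π ^ 2) * ∫⁻ w, h w := by
  set U : Set ℝ := {u | l < r ^ 2 * u ^ 2} with hU
  have hUo : IsOpen U := isOpen_lt continuous_const (by fun_prop)
  set W : ℝ → ℝ := fun u => Real.sign u * √(r ^ 2 * u ^ 2 - l) / r with hW
  have hu0 : ∀ u ∈ U, u ≠ 0 := by
    rintro u hu rfl; simp [hU] at hu; linarith
  have hd : ∀ u ∈ U, HasDerivWithinAt W (r * |u| / √(r ^ 2 * u ^ 2 - l)) U u := by
    intro u hu
    have hpos : 0 < r ^ 2 * u ^ 2 - l := sub_pos.2 hu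
    have hs : HasDerivAt (fun u => √(r ^ 2 * u ^ 2 - l)) ((r ^ 2 * (2 * u)) / (2 * √(r ^ 2 * u ^ 2 - l))) u := by
      refine HasDerivAt.sqrt ?_ hpos.ne'
      simpa using (((hasDerivAt_pow 2 u).const_mul (r ^ 2)).sub_const l)
    have hc : HasDerivAt (fun v => Real.sign u * √(r ^ 2 * v ^ 2 - l) / r)
        (Real.sign u * ((r ^ 2 * (2 * u)) / (2 * √(r ^ 2 * u ^ 2 - l))) / r) u :=
      (hs.const_mul _).div_const r
    have he : W =ᶠ[𝓝 u] fun v => Real.sign u * √(r ^ 2 * v ^ 2 - l) / r := by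
      rcases lt_or_gt_of_ne (hu0 u hu) with h0 | h0
      · filter_upwards [gt_mem_nhds h0] with v hv
        simp only [hW, Real.sign_of_neg hv, Real.sign_of_neg h0]
      · filter_upwards [lt_mem_nhds h0] with v hv
        simp only [hW, Real.sign_of_pos hv, Real.sign_of_pos h0]
    have := (hc.congr_of_eventuallyEq he).hasDerivWithinAt (s := U)
    have hsq : √(r ^ 2 * u ^ 2 - l) ≠ 0 := (Real.sqrt_pos.2 hpos).ne'
    have hv : r * |u| / √(r ^ 2 * u ^ 2 - l)
        = Real.sign u * ((r ^ 2 * (2 * u)) / (2 * √(r ^ 2 * u ^ 2 - l))) / r := by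
      rcases lt_or_gt_of_ne (hu0 u hu) with h0 | h0
      · rw [Real.sign_of_neg h0, abs_of_neg h0]; field_simp
      · rw [Real.sign_of_pos h0, abs_of_pos h0]; field_simp
    rw [hv]; exact this
  have hinj : InjOn W U := by
    intro u hu v hv huv
    have hp : 0 < √(r ^ 2 * u ^ 2 - l) := Real.sqrt_pos.2 (sub_pos.2 hu)
    have hq : 0 < √(r ^ 2 * v ^ 2 - l) := Real.sqrt_pos.2 (sub_pos.2 hv)
    have huv' : Real.sign u * √(r ^ 2 * u ^ 2 - l) = Real.sign v * √(r ^ 2 * v ^ 2 - l) := by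
      simp only [hW] at huv; field_simp at huv; exact huv
    have key : √(r ^ 2 * u ^ 2 - l) = √(r ^ 2 * v ^ 2 - l) → u ^ 2 = v ^ 2 := by
      intro hh
      have := congrArg (fun x => x ^ 2) hh
      simp only [Real.sq_sqrt (sub_pos.2 hu).le, Real.sq_sqrt (sub_pos.2 hv).le] at this
      have hr2 : r ^ 2 ≠ 0 := by positivity
      exact mul_left_cancel₀ hr2 (by linarith)
    rcases lt_or_gt_of_ne (hu0 u hu) with h0 | h0 <;> rcases lt_or_gt_of_ne (hu0 v hv) with h1 | h1
    · rw [Real.sign_of_neg h0, Real.sign_of_neg h1] at huv'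
      nlinarith [key (by linarith)]
    · rw [Real.sign_of_neg h0, Real.sign_of_pos h1] at huv'; linarith
    · rw [Real.sign_of_pos h0, Real.sign_of_neg h1] at huv'; linarith
    · rw [Real.sign_of_pos h0, Real.sign_of_pos h1] at huv'
      nlinarith [key (by linarith)]
  have himg : W '' U = {0}ᶜ := by
    ext w; constructor
    · rintro ⟨u, hu, rfl⟩
      have hp : 0 < √(r ^ 2 * u ^ 2 - l) := Real.sqrt_pos.2 (sub_pos.2 hu)
      simp only [hW, mem_compl_iff, mem_singleton_iff]
      rcases lt_or_gt_of_ne (hu0 u hu) with h0 | h0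
      · rw [Real.sign_of_neg h0]; exact div_ne_zero (by linarith) hr.ne'
      · rw [Real.sign_of_pos h0]; exact div_ne_zero (by linarith) hr.ne'
    · intro hw
      have hw : w ≠ 0 := hw
      have hw2 : 0 < w ^ 2 := by positivity
      have hp : 0 < √(w ^ 2 + l / r ^ 2) := Real.sqrt_pos.2 (by positivity)
      refine ⟨Real.sign w * √(w ^ 2 + l / r ^ 2), ?_, ?_⟩
      · show l < r ^ 2 * _ ^ 2
        rw [mul_pow, Real.sq_sqrt (by positivity)]
        rcases lt_or_gt_of_ne hw with h0 | h0
        · rw [Real.sign_of_neg h0]; field_simp; nlinarith [mul_pos (pow_pos hr 2) hw2]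
        · rw [Real.sign_of_pos h0]; field_simp; nlinarith [mul_pos (pow_pos hr 2) hw2]
      · simp only [hW]
        rw [mul_pow, Real.sq_sqrt (by positivity)]
        rcases lt_or_gt_of_ne hw with h0 | h0
        · rw [Real.sign_of_neg h0, Real.sign_of_neg (by linarith),
            show r ^ 2 * ((-1) ^ 2 * (w ^ 2 + l / r ^ 2)) - l = (r * (-w)) ^ 2 by field_simp; ring,
            Real.sqrt_sq (mul_nonneg hr.le (by linarith))]
          field_simp
        · rw [Real.sign_of_pos h0, Real.sign_of_pos (by linarith),
            show r ^ 2 * (1 ^ 2 * (w ^ 2 + l / r ^ 2)) - l = (r * w) ^ 2 by field_simp; ring,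
            Real.sqrt_sq (mul_nonneg hr.le (by linarith))]
          field_simp
  have hmain := lintegral_image_eq_lintegral_abs_deriv_mul hUo.measurableSet hd hinj h
  have hae : ({0}ᶜ : Set ℝ) =ᵐ[volume] univ := by rw [ae_eq_univ]; simp
  rw [himg, setLIntegral_congr hae, setLIntegral_univ] at hmain
  rw [hmain, ← lintegral_indicator hUo.measurableSet, ← lintegral_const_mul' _ _ ENNReal.ofReal_ne_top]
  congr 1; ext u
  by_cases hu : u ∈ U
  · have hp : 0 < √(r ^ 2 * u ^ 2 - l) := Real.sqrt_pos.2 (sub_pos.2 hu)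
    rw [indicator_of_mem hu, nuDens, if_pos ⟨hr, hu⟩, ← mul_assoc, ← ENNReal.ofReal_mul (by positivity),
      abs_of_nonneg (a := r * |u| / √(r ^ 2 * u ^ 2 - l)) (by positivity)]
    congr 2; ring
  · rw [indicator_of_notMem hu, nuDens, if_neg (fun h => hu h.2)]; simp

lemma measurable_nuDens (l : ℝ) : Measurable (nuDens l) := by
  unfold nuDens
  have h : Measurable fun p : ℝ × ℝ =>
      ENNReal.ofReal (4 * π ^ 2 * p.1 * |p.2| / Real.sqrt (p.1 ^ 2 * p.2 ^ 2 - l)) := by fun_prop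
  refine Measurable.ite ?_ h measurable_const
  have h2 : Measurable fun p : ℝ × ℝ => p.1 ^ 2 * p.2 ^ 2 := by fun_prop
  exact (measurableSet_lt measurable_const measurable_fst).inter
    (measurableSet_lt measurable_const h2)

lemma radPoint_eq (r u l : ℝ) :
    radPoint r u l = pt r (Real.sign u * √(r ^ 2 * u ^ 2 - l) / r) l := rfl

/-- the orbit measure -/
def lam (S : ℝ → ℝ → Prop) : ℝ≥0∞ := by
  classical exact ENNReal.ofReal (4 * π ^ 2) * ∫⁻ r in Ioi (0:ℝ), ∫⁻ w : ℝ, if S r w then 1 else 0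

lemma measurable_sign : Measurable Real.sign := by
  unfold Real.sign
  exact Measurable.ite (measurableSet_lt measurable_id measurable_const) measurable_const
    (Measurable.ite (measurableSet_lt measurable_const measurable_id) measurable_const measurable_const)

lemma muDist_eq (f : Phase → ℝ) (hf : Measurable f) (s l : ℝ) (hl : 0 < l) :
    muDist f s l = lam (fun r w => s < f (pt r w l)) := by
  classical
  rw [muDist, nuMeas, lam]
  have hm : Measurable fun p : ℝ × ℝ => radPoint p.1 p.2 l := by
    simp only [radPoint_eq]
    refine measurable_pt' measurable_fst ?_ measurable_const
    refine Measurable.div (Measurable.mul (measurable_sign.comp measurable_snd) ?_) measurable_fst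
    fun_prop
  have hS : MeasurableSet {p : ℝ × ℝ | s < f (radPoint p.1 p.2 l)} :=
    measurableSet_lt measurable_const (hf.comp hm)
  rw [withDensity_apply _ hS, ← lintegral_indicator hS, Measure.volume_eq_prod,
    lintegral_prod _ ((measurable_nuDens l).indicator hS).aemeasurable,
    ← lintegral_const_mul' _ _ ENNReal.ofReal_ne_top, ← lintegral_indicator measurableSet_Ioi]
  congr 1; ext r
  by_cases hr : 0 < r
  · rw [indicator_of_mem (show r ∈ Ioi 0 from hr), ← slice_u r l hr hl]
    congr 1; ext u
    rw [← radPoint_eq]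
    by_cases hu : s < f (radPoint r u l)
    · rw [indicator_of_mem (show (r,u) ∈ {p : ℝ × ℝ | s < f (radPoint p.1 p.2 l)} from hu)]
      simp [hu]
    · rw [indicator_of_notMem (show (r,u) ∉ {p : ℝ × ℝ | s < f (radPoint p.1 p.2 l)} from hu)]
      simp [hu]
  · rw [indicator_of_notMem (show r ∉ Ioi 0 from hr)]
    rw [lintegral_eq_zero_iff ?_]
    · filter_upwards with u
      rw [indicator_apply]; split_ifs
      · simp [nuDens, hr]
      · rfl
    · exact ((measurable_nuDens l).indicator hS).comp measurable_prodMk_left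

end M3

section M4

lemma lintegral_ftc {g g' : ℝ → ℝ} {a b : ℝ} (hab : a ≤ b) (hc : ContinuousOn g (Icc a b))
    (hd : ∀ x ∈ Ioo a b, HasDerivAt g (g' x) x) (h0 : ∀ x ∈ Ioo a b, 0 ≤ g' x) :
    ∫⁻ x in Ioo a b, ENNReal.ofReal (g' x) = ENNReal.ofReal (g b - g a) := by
  have hi := intervalIntegral.integrableOn_deriv_of_nonneg hc hd h0
  have hii : IntervalIntegrable g' volume a b := (intervalIntegrable_iff_integrableOn_Ioc_of_le hab).2 hi
  rw [← intervalIntegral.integral_eq_sub_of_hasDerivAt_of_le hab hc hd hii,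
    intervalIntegral.integral_of_le hab, integral_Ioc_eq_integral_Ioo,
    ofReal_integral_eq_lintegral_ofReal (hi.mono_set Ioo_subset_Ioc_self)]
  exact (ae_restrict_iff' measurableSet_Ioo).2 (Eventually.of_forall h0)

structure Nice (f : Phase → ℝ) : Prop where
  meas : Measurable f
  nn : ∀ z, 0 ≤ f z
  int : Integrable f
  kin : Integrable (fun z : Phase => ‖z.2‖ ^ 2 * f z)
  bdd : ∃ B : ℝ, 0 ≤ B ∧ ∀ᵐ z : Phase, f z ≤ B
  sph : SphSym f

lemma memErad_nice {f : Phase → ℝ} (hf : memErad f) : Nice f := by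
  obtain ⟨⟨hm, h0, hE⟩, hs⟩ := hf
  unfold eNormE at hE
  have h1 : eLpNorm f 1 volume < ⊤ := lt_of_le_of_lt (le_trans le_self_add le_self_add) hE
  have h2 : eLpNorm f ⊤ volume < ⊤ := lt_of_le_of_lt (le_trans le_add_self le_self_add) hE
  have h3 := lt_of_le_of_lt le_add_self hE
  refine ⟨hm, h0, memLp_one_iff_integrable.1 ⟨hm.aestronglyMeasurable, h1⟩, ?_, ?_, hs⟩
  · refine ⟨(by fun_prop), ?_⟩
    rw [hasFiniteIntegral_iff_enorm]
    convert h3 using 1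
    congr 1; ext z
    rw [enorm_mul, enorm_pow, enorm_norm]; rfl
  · refine ⟨(eLpNorm f ⊤ volume).toReal, ENNReal.toReal_nonneg, ?_⟩
    filter_upwards [ae_le_eLpNormEssSup (f := f) (μ := volume)] with z hz
    rw [eLpNorm_exponent_top]
    rw [eLpNorm_exponent_top] at h2
    rw [← Real.norm_of_nonneg (h0 z), ← toReal_enorm]
    exact ENNReal.toReal_mono h2.ne hz

def chi (f : Phase → ℝ) (a : ℝ) : ℝ := -(∫ z : Phase, f z * min a (1 / ‖z.1‖)) / (4 * π)
def nf (f : Phase → ℝ) (a : ℝ) : ℝ := ∫ z : Phase, f z * (if a < 1 / ‖z.1‖ then 1 else 0)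

lemma newton_int (r s : ℝ) (hr : 0 < r) (hs : 0 < s) :
    ∫⁻ w in Ioo (-s) s, ENNReal.ofReal (1 / √(r ^ 2 - 2 * r * w + s ^ 2))
     = ∫⁻ w in Ioo (-s) s, ENNReal.ofReal (min (1 / r) (1 / s)) := by
  have hp : ∀ w ∈ Ioo (-s) s, 0 < r ^ 2 - 2 * r * w + s ^ 2 := by
    rintro _ ⟨_, h2⟩
    nlinarith [sq_nonneg (r - s), mul_pos hr (sub_pos.2 h2)]
  rw [lintegral_ftc (g := fun w => -(1 / r) * √(r ^ 2 - 2 * r * w + s ^ 2)) (by linarith)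
    (by fun_prop) ?_ (fun w _ => by positivity)]
  · simp only [lintegral_const, Measure.restrict_apply MeasurableSet.univ, univ_inter,
      Real.volume_Ioo]
    rw [← ENNReal.ofReal_mul (by positivity)]
    congr 1
    rw [show r ^ 2 - 2 * r * s + s ^ 2 = (r - s) ^ 2 by ring,
      show r ^ 2 - 2 * r * (-s) + s ^ 2 = (r + s) ^ 2 by ring, Real.sqrt_sq_eq_abs,
      Real.sqrt_sq (by positivity)]
    rcases le_total r s with h | h
    · rw [abs_of_nonpos (by linarith), min_eq_right (one_div_le_one_div_of_le hr h)]
      field_simp; ring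
    · rw [abs_of_nonneg (by linarith), min_eq_left (one_div_le_one_div_of_le hs h)]
      field_simp; ring
  · intro w hw
    have h := ((((hasDerivAt_id w).const_mul (2 * r)).const_sub (r ^ 2)).add_const (s ^ 2)).sqrt (hp w hw).ne'
    have h2 := h.const_mul (-(1 / r))
    simp only [id] at h2
    have : -(1 / r) * (-(2 * r * 1) / (2 * √(r ^ 2 - 2 * r * w + s ^ 2))) =
      1 / √(r ^ 2 - 2 * r * w + s ^ 2) := by field_simp
    rwa [this] at h2

lemma ae_ne_zero1 : ∀ᵐ z : Phase, z.1 ≠ 0 := by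
  have h : ∀ᵐ x : E3, x ≠ 0 := by
    simp [ae_iff]
  exact (Measure.quasiMeasurePreserving_fst (μ := (volume : Measure E3)) (ν := (volume : Measure E3))).ae h

lemma integrable_fmin {f : Phase → ℝ} (hf : Nice f) (a : ℝ) :
    Integrable fun z : Phase => f z * min a (1 / ‖z.1‖) := by
  have hm : Measurable fun z : Phase => min a (1 / ‖z.1‖) := by fun_prop
  refine hf.int.mul_bdd (c := |a|) hm.aestronglyMeasurable ?_
  filter_upwards with z
  rw [Real.norm_eq_abs, abs_le]
  have : 0 ≤ 1 / ‖z.1‖ := by positivity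
  exact ⟨le_min (neg_abs_le a) (by linarith [abs_nonneg a]), (min_le_left _ _).trans (le_abs_self a)⟩

lemma rho_rad {f : Phase → ℝ} (hf : SphSym f) (x : E3) : rhoF f x = rhoF f (‖x‖ • e1) := by
  obtain ⟨R, hd, hRx, -⟩ := exists_rot x 0
  have := (R.measurePreserving).integral_comp R.toMeasurableEquiv.measurableEmbedding
      (fun v => f (‖x‖ • e1, v))
  unfold rhoF
  rw [← this]
  congr 1; ext v
  rw [← hRx]; exact (hf R hd (x, v)).symm

lemma newton {f : Phase → ℝ} (hf : Nice f) (x : E3) (hx : x ≠ 0) :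
    phiF f x = chi f (1 / ‖x‖) := by
  set r := ‖x‖ with hr
  have hr0 : 0 < r := norm_pos_iff.2 hx
  have hρm : Measurable (rhoF f) :=
    (hf.meas.stronglyMeasurable.integral_prod_right').measurable
  have hρ0 : ∀ y, 0 ≤ rhoF f y := fun y => integral_nonneg fun v => hf.nn _
  set P : ℝ → ℝ≥0∞ := fun s => ENNReal.ofReal (rhoF f (s • e1) / (4 * π)) with hP
  have hPm : Measurable P := by
    have h1 : Measurable fun s : ℝ => rhoF f (s • e1) := hρm.comp (measurable_id.smul_const e1)
    exact (h1.div_const _).ennreal_ofReal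
  have key : ∫⁻ y : E3, ENNReal.ofReal (rhoF f y / (4 * π * ‖x - y‖))
      = ∫⁻ y : E3, ENNReal.ofReal (rhoF f y * min (1 / r) (1 / ‖y‖) / (4 * π)) := by
    obtain ⟨R, hd, hRx, -⟩ := exists_rot x 0
    have h1 : ∀ y : E3, ENNReal.ofReal (rhoF f y / (4 * π * ‖x - y‖))
        = (fun y : E3 => P ‖y‖ * ENNReal.ofReal (1 / √(r ^ 2 - 2 * r * (y 0) + ‖y‖ ^ 2))) (R y) := by
      intro y
      have hn : ‖x - y‖ = √(r ^ 2 - 2 * r * ((R y) 0) + ‖R y‖ ^ 2) := by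
        rw [← R.norm_map, map_sub, hRx, ← Real.sqrt_sq (norm_nonneg (_ - _)), norm_sub_sq_real,
          norm_smul, norm_e1, inner_smul_left, inner_e1]
        simp [← hr, mul_assoc]
      simp only [hP]
      rw [← hn, ← ENNReal.ofReal_mul (div_nonneg (hρ0 _) (by positivity)), R.norm_map, ← rho_rad hf.sph]
      congr 1; rw [div_mul_div_comm, mul_one]
    have h2 : ∀ y : E3, ENNReal.ofReal (rhoF f y * min (1 / r) (1 / ‖y‖) / (4 * π))
        = (fun s (_ : ℝ) => P s * ENNReal.ofReal (min (1 / r) (1 / s))) ‖y‖ (y 0) := by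
      intro y
      simp only [hP]
      rw [← ENNReal.ofReal_mul (div_nonneg (hρ0 _) (by positivity)), ← rho_rad hf.sph]
      congr 1; ring
    have h4 := (R.measurePreserving).lintegral_comp_emb R.toMeasurableEquiv.measurableEmbedding
      (fun y : E3 => P ‖y‖ * ENNReal.ofReal (1 / √(r ^ 2 - 2 * r * (y 0) + ‖y‖ ^ 2)))
    rw [lintegral_congr h1, h4, lintegral_congr h2]
    rw [axis_lintegral' (fun s w => P s * ENNReal.ofReal (1 / √(r ^ 2 - 2 * r * w + s ^ 2)))
      ((hPm.comp measurable_fst).mul (by fun_prop)),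
      axis_lintegral' (fun s _ => P s * ENNReal.ofReal (min (1 / r) (1 / s))) ((hPm.comp measurable_fst).mul (by fun_prop))]
    refine setLIntegral_congr_fun measurableSet_Ioi fun s hs => ?_
    have hs : 0 < s := hs
    simp only [← mul_assoc]
    rw [lintegral_const_mul _ (by fun_prop), lintegral_const_mul _ (by fun_prop), newton_int r s hr0 hs]
  have h3 : ∫ y : E3, rhoF f y / (4 * π * ‖x - y‖) = ∫ y : E3, rhoF f y * min (1 / r) (1 / ‖y‖) / (4 * π) := by
    rw [integral_eq_lintegral_of_nonneg_ae, integral_eq_lintegral_of_nonneg_ae, key]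
    · exact Eventually.of_forall fun y => by have := hρ0 y; positivity
    · exact (by fun_prop : Measurable _).aestronglyMeasurable
    · exact Eventually.of_forall fun y => by have := hρ0 y; positivity
    · exact (by fun_prop : Measurable _).aestronglyMeasurable
  rw [phiF, h3, chi, integral_div, neg_div]
  congr 2
  rw [Measure.volume_eq_prod, integral_prod _ (integrable_fmin hf (1 / r))]
  congr 1; ext y
  exact (integral_mul_const _ _).symm

lemma nf_integrable {f : Phase → ℝ} (hf : Nice f) (a : ℝ) :
    Integrable fun z : Phase => f z * (if a < 1 / ‖z.1‖ then 1 else 0) := by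
  have hm : Measurable fun z : Phase => (if a < 1 / ‖z.1‖ then (1:ℝ) else 0) :=
    Measurable.ite (measurableSet_lt measurable_const (by fun_prop)) measurable_const measurable_const
  refine hf.int.mul_bdd (c := 1) hm.aestronglyMeasurable ?_
  filter_upwards with z
  split_ifs <;> simp

lemma chi_hasDerivAt {f : Phase → ℝ} (hf : Nice f) (a : ℝ) :
    HasDerivAt (chi f) (-(nf f a) / (4 * π)) a := by
  refine HasDerivAt.div_const (HasDerivAt.neg ?_) _
  refine (hasDerivAt_integral_of_dominated_loc_of_lip (s := univ) (bound := f) univ_mem ?_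
    (integrable_fmin hf a) (nf_integrable hf a).aestronglyMeasurable ?_ hf.int ?_).2
  · exact Eventually.of_forall fun b => (integrable_fmin hf b).aestronglyMeasurable
  · refine Eventually.of_forall fun z => LipschitzWith.lipschitzOnWith ?_
    refine LipschitzWith.of_dist_le_mul fun x y => ?_
    rw [Real.dist_eq, Real.dist_eq, ← mul_sub, abs_mul, Real.coe_nnabs]
    exact mul_le_mul_of_nonneg_left (by simpa using abs_min_sub_min_le_max x (1 / ‖z.1‖) y (1 / ‖z.1‖)) (abs_nonneg _)
  · have h : ∀ᵐ x : E3, ‖x‖ ≠ 1 / a := by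
      have := Measure.addHaar_sphere (volume : Measure E3) 0 (1 / a)
      rw [ae_iff]; convert this using 2; ext x; simp
    filter_upwards [(Measure.quasiMeasurePreserving_fst (μ := (volume : Measure E3)) (ν := (volume : Measure E3))).ae h] with z hz
    refine HasDerivAt.const_mul _ ?_
    rcases lt_trichotomy a (1 / ‖z.1‖) with h | h | h
    · rw [if_pos h]
      refine (hasDerivAt_id a).congr_of_eventuallyEq ?_
      filter_upwards [gt_mem_nhds h] with b hb
      exact min_eq_left hb.le
    · exact absurd (by rw [h]; simp) hz
    · rw [if_neg (not_lt.2 h.le)]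
      refine (hasDerivAt_const a (1 / ‖z.1‖)).congr_of_eventuallyEq ?_
      filter_upwards [lt_mem_nhds h] with b hb
      exact min_eq_right hb.le

end M4

section M5

lemma nf_nonneg {f : Phase → ℝ} (hf : Nice f) (a : ℝ) : 0 ≤ nf f a :=
  integral_nonneg fun z => mul_nonneg (hf.nn z) (by split_ifs <;> norm_num)

lemma nf_anti {f : Phase → ℝ} (hf : Nice f) : Antitone (nf f) := by
  intro a b hab
  refine integral_mono (nf_integrable hf b) (nf_integrable hf a) fun z => ?_
  refine mul_le_mul_of_nonneg_left ?_ (hf.nn z)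
  dsimp only
  by_cases h1 : b < 1 / ‖z.1‖
  · rw [if_pos h1, if_pos (hab.trans_lt h1)]
  · rw [if_neg h1]; split_ifs <;> norm_num

lemma chi_zero (f : Phase → ℝ) : chi f 0 = 0 := by
  unfold chi
  have : ∀ z : Phase, f z * min 0 (1 / ‖z.1‖) = 0 := fun z => by
    rw [min_eq_left (by positivity), mul_zero]
  simp [this]

lemma chi_cont {f : Phase → ℝ} (hf : Nice f) : Continuous (chi f) :=
  continuous_iff_continuousAt.2 fun a => (chi_hasDerivAt hf a).continuousAt

lemma mass_nonneg {f : Phase → ℝ} (hf : Nice f) : 0 ≤ mass f := integral_nonneg hf.nn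

lemma chi_ge {f : Phase → ℝ} (hf : Nice f) (a : ℝ) : -(a * mass f) / (4 * π) ≤ chi f a := by
  unfold chi mass
  gcongr
  rw [← integral_const_mul]
  refine integral_mono (integrable_fmin hf a) (hf.int.const_mul a) fun z => ?_
  simp only
  rw [mul_comm a]
  exact mul_le_mul_of_nonneg_left (min_le_left _ _) (hf.nn z)

lemma integrable_inv {f : Phase → ℝ} (hf : Nice f) :
    Integrable fun z : Phase => f z * (1 / ‖z.1‖) := by
  obtain ⟨B, hB0, hB⟩ := hf.bdd
  have hm : Measurable fun z : Phase => f z * (1 / ‖z.1‖) := hf.meas.mul (by fun_prop)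
  set S : Set Phase := {z | ‖z.1‖ < 1 ∧ ‖z.2‖ ^ 2 * ‖z.1‖ < 1} with hS
  have hSm : MeasurableSet S :=
    (measurableSet_lt (by fun_prop : Measurable fun z : Phase => ‖z.1‖) measurable_const).inter
      (measurableSet_lt (by fun_prop : Measurable fun z : Phase => ‖z.2‖ ^ 2 * ‖z.1‖) measurable_const)
  have hint : Integrable (S.indicator fun z : Phase => B * (1 / ‖z.1‖)) := by
    refine ⟨((by fun_prop : Measurable fun z : Phase => B * (1 / ‖z.1‖)).indicator hSm).aestronglyMeasurable, ?_⟩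
    rw [hasFiniteIntegral_iff_enorm, Measure.volume_eq_prod,
      lintegral_prod _ ((by fun_prop : Measurable fun z : Phase => B * (1 / ‖z.1‖)).indicator hSm).enorm.aemeasurable]
    have h1 : ∀ x : E3, x ≠ 0 → ∫⁻ v : E3, ‖S.indicator (fun z : Phase => B * (1 / ‖z.1‖)) (x, v)‖ₑ
        ≤ (fun r => (Iio (1:ℝ)).indicator (fun r => ENNReal.ofReal (B * (1 / r) * ((√(1 / r)) ^ 3 * (π * 4 / 3)))) r) ‖x‖ := by
      intro x hx
      have hx0 : 0 < ‖x‖ := norm_pos_iff.2 hx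
      by_cases h : ‖x‖ < 1
      · simp only
        rw [indicator_of_mem (show ‖x‖ ∈ Iio 1 from h), ENNReal.ofReal_mul (p := B * (1 / ‖x‖)) (by positivity),
          ENNReal.ofReal_mul (p := √(1 / ‖x‖) ^ 3) (by positivity), ENNReal.ofReal_pow (by positivity),
          ← EuclideanSpace.volume_ball_fin_three 0, ← setLIntegral_const, ← lintegral_indicator measurableSet_ball]
        refine lintegral_mono fun v => ?_
        by_cases hv : (x, v) ∈ S
        · rw [indicator_of_mem hv, indicator_of_mem, Real.enorm_of_nonneg (by positivity)]
          rw [mem_ball_zero_iff]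
          apply Real.lt_sqrt_of_sq_lt
          rw [lt_div_iff₀ hx0]; exact hv.2
        · rw [indicator_of_notMem hv]; simp
      · have : ∀ v, (x, v) ∉ S := fun v hv => h hv.1
        simp [this]
    refine lt_of_le_of_lt (lintegral_mono_ae ((by simp [ae_iff] : ∀ᵐ x : E3, x ≠ 0).mono h1)) ?_
    rw [radial_lintegral _ (by
      refine Measurable.indicator ?_ measurableSet_Iio
      fun_prop)]
    have h2 : ∀ r ∈ Ioi (0:ℝ), ENNReal.ofReal (4 * π * r ^ 2) * (Iio (1:ℝ)).indicator (fun r => ENNReal.ofReal (B * (1 / r) * ((√(1 / r)) ^ 3 * (π * 4 / 3)))) r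
        = (Ioo (0:ℝ) 1).indicator (fun r => ENNReal.ofReal (B * (4 * π) * (π * 4 / 3) * 2 * (1 / (2 * √r)))) r := by
      intro r hr
      have hr : 0 < r := hr
      by_cases h : r < 1
      · rw [indicator_of_mem (show r ∈ Iio 1 from h), indicator_of_mem (show r ∈ Ioo 0 1 from ⟨hr, h⟩),
          ← ENNReal.ofReal_mul (by positivity)]
        congr 1
        have hs : √r ≠ 0 := (Real.sqrt_pos.2 hr).ne'
        obtain ⟨q, hq⟩ : ∃ q, q = √r := ⟨_, rfl⟩
        have hrq : r = q ^ 2 := by rw [hq, Real.sq_sqrt hr.le]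
        rw [one_div, Real.sqrt_inv, ← hq]
        rw [← hq] at hs
        rw [hrq]; field_simp
      · rw [indicator_of_notMem (show r ∉ Iio 1 from h), indicator_of_notMem (fun h' : r ∈ Ioo 0 1 => h h'.2), mul_zero]
    rw [setLIntegral_congr_fun measurableSet_Ioi h2]
    refine lt_of_le_of_lt (setLIntegral_le_lintegral _ _) ?_
    rw [lintegral_indicator measurableSet_Ioo]
    rw [lintegral_ftc (g := fun r => B * (4 * π) * (π * 4 / 3) * 2 * √r) zero_le_one (by fun_prop)
      (fun x hx => (Real.hasDerivAt_sqrt hx.1.ne').const_mul _) (fun x _ => by positivity)]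
    exact ENNReal.ofReal_lt_top
  refine ((hf.kin.add hf.int).add hint).mono' hm.aestronglyMeasurable ?_
  filter_upwards [hB, ae_ne_zero1] with z hz hz0
  have hx0 : 0 < ‖z.1‖ := norm_pos_iff.2 hz0
  have hfz := hf.nn z
  rw [Real.norm_of_nonneg (by positivity)]
  simp only [Pi.add_apply]
  by_cases h : z ∈ S
  · rw [indicator_of_mem h]
    have h3 : f z * (1 / ‖z.1‖) ≤ B * (1 / ‖z.1‖) := by gcongr
    have h4 : 0 ≤ ‖z.2‖ ^ 2 * f z := by positivity
    linarith
  · rw [indicator_of_notMem h]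
    simp only [hS, mem_ofPred_eq, not_and_or, not_lt] at h
    have h4 : 0 ≤ ‖z.2‖ ^ 2 * f z := by positivity
    rcases h with h | h
    · have : 1 / ‖z.1‖ ≤ 1 := by rw [div_le_one hx0]; exact h
      nlinarith
    · have : 1 / ‖z.1‖ ≤ ‖z.2‖ ^ 2 := by rw [div_le_iff₀ hx0]; exact h
      nlinarith

lemma chi_bdd {f : Phase → ℝ} (hf : Nice f) : ∃ Φ : ℝ, 0 ≤ Φ ∧ ∀ a, -Φ ≤ chi f a := by
  refine ⟨(∫ z : Phase, f z * (1 / ‖z.1‖)) / (4 * π), ?_, fun a => ?_⟩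
  · exact div_nonneg (integral_nonneg fun z => mul_nonneg (hf.nn z) (by positivity)) (by positivity)
  · unfold chi
    rw [← neg_div]
    refine div_le_div_of_nonneg_right (neg_le_neg ?_) (by positivity)
    refine integral_mono (integrable_fmin hf a) (integrable_inv hf) fun z => ?_
    exact mul_le_mul_of_nonneg_left (min_le_right _ _) (hf.nn z)

lemma grad_eq {f : Phase → ℝ} (hf : Nice f) (x : E3) (hx : x ≠ 0) :
    gradPhi f x = (nf f (1 / ‖x‖) / (4 * π * ‖x‖ ^ 3)) • x := by
  have hr0 : 0 < ‖x‖ := norm_pos_iff.2 hx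
  have h1 : HasFDerivAt (fun y : E3 => ‖y‖ ^ 2) (2 • (innerSL ℝ) x) x :=
    (hasStrictFDerivAt_norm_sq x).hasFDerivAt
  have hs : √(‖x‖ ^ 2) = ‖x‖ := Real.sqrt_sq hr0.le
  have h2 : HasDerivAt (fun t : ℝ => (√t)⁻¹) (-(1 / (2 * √(‖x‖ ^ 2))) / √(‖x‖ ^ 2) ^ 2) (‖x‖ ^ 2) :=
    (Real.hasDerivAt_sqrt (by positivity)).inv (by rw [hs]; positivity)
  have h3 : HasDerivAt (fun t : ℝ => chi f ((√t)⁻¹)) _ (‖x‖ ^ 2) :=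
    (chi_hasDerivAt hf ((√(‖x‖ ^ 2))⁻¹)).comp_of_eq (h₂ := chi f) (‖x‖ ^ 2) h2 rfl
  have h4 := h3.comp_hasFDerivAt x h1
  have h5 : HasGradientAt (phiF f) ((nf f (1 / ‖x‖) / (4 * π * ‖x‖ ^ 3)) • x) x := by
    rw [hasGradientAt_iff_hasFDerivAt]
    have he : phiF f =ᶠ[𝓝 x] ((fun t : ℝ => chi f ((√t)⁻¹)) ∘ fun y : E3 => ‖y‖ ^ 2) := by
      filter_upwards [isOpen_ne.mem_nhds hx] with y hy
      simp only [Function.comp]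
      rw [newton hf y hy, Real.sqrt_sq (norm_nonneg _), one_div]
    refine (h4.congr_of_eventuallyEq he).congr_fderiv ?_
    ext y
    simp only [hs, ContinuousLinearMap.smul_apply, InnerProductSpace.toDual_apply_apply, inner_smul_left]
    simp [innerSL_apply_apply]
    field_simp
  exact h5.gradient

lemma grad_sub_sq {f g : Phase → ℝ} (hf : Nice f) (hg : Nice g) (x : E3) (hx : x ≠ 0) :
    ‖gradPhi f x - gradPhi g x‖ ^ 2
      = (fun r : ℝ => ((nf f (1 / r) - nf g (1 / r)) / (4 * π * r ^ 2)) ^ 2) ‖x‖ := by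
  have hr0 : 0 < ‖x‖ := norm_pos_iff.2 hx
  rw [grad_eq hf x hx, grad_eq hg x hx, ← sub_smul, norm_smul, mul_pow, Real.norm_eq_abs, sq_abs]
  simp only; field_simp

lemma radial_inv (h : ℝ → ℝ) :
    ∫ x : E3, (fun r : ℝ => (h (1 / r) / (4 * π * r ^ 2)) ^ 2) ‖x‖
     = (∫ a in Ioi (0:ℝ), (h a) ^ 2) / (4 * π) := by
  rw [integral_fun_norm_addHaar volume (fun r : ℝ => (h (1 / r) / (4 * π * r ^ 2)) ^ 2)]
  have := integral_comp_rpow_Ioi (fun a => (h a) ^ 2) (p := -1) (by norm_num)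
  rw [← this]
  simp only [finrank_euclideanSpace, Fintype.card_fin, Measure.real, EuclideanSpace.volume_ball_fin_three,
    nsmul_eq_mul, smul_eq_mul]
  rw [← integral_const_mul, ← integral_const_mul, ← integral_div]
  refine setIntegral_congr_fun measurableSet_Ioi fun r hr => ?_
  have hr : 0 < r := hr
  have e1 : r ^ (-1 - 1 : ℝ) = (r ^ 2)⁻¹ := by
    rw [show (-1 - 1 : ℝ) = -((2:ℕ):ℝ) by norm_num, Real.rpow_neg hr.le, Real.rpow_natCast]
  simp only [Real.rpow_neg_one, e1]
  simp [ENNReal.toReal_ofReal, show 0 ≤ π * 4 / 3 by positivity]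
  field_simp

lemma field_int {f g : Phase → ℝ} (hf : Nice f) (hg : Nice g) :
    ∫ x : E3, ‖gradPhi f x - gradPhi g x‖ ^ 2 = (∫ a in Ioi (0:ℝ), (nf f a - nf g a) ^ 2) / (4 * π) := by
  rw [← radial_inv (fun a => nf f a - nf g a)]
  refine integral_congr_ae ?_
  filter_upwards [(by simp [ae_iff] : ∀ᵐ x : E3, x ≠ 0)] with x hx
  exact grad_sub_sq hf hg x hx

lemma fieldSq_eq {f : Phase → ℝ} (hf : Nice f) :
    fieldSq f = (∫ a in Ioi (0:ℝ), (nf f a) ^ 2) / (4 * π) := by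
  rw [← radial_inv (fun a => nf f a), fieldSq]
  refine integral_congr_ae ?_
  filter_upwards [(by simp [ae_iff] : ∀ᵐ x : E3, x ≠ 0)] with x hx
  have hr0 : 0 < ‖x‖ := norm_pos_iff.2 hx
  rw [grad_eq hf x hx, norm_smul, mul_pow, Real.norm_eq_abs, sq_abs]
  field_simp

end M5

section M6

lemma nf_meas {f : Phase → ℝ} (hf : Nice f) : Measurable (nf f) := (nf_anti hf).measurable

lemma dual_lint {f g : Phase → ℝ} (hf : Nice f) (hg : Nice g) :
    ∫⁻ a in Ioi (0:ℝ), ENNReal.ofReal (nf f a * nf g a)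
      = ∫⁻ z, ENNReal.ofReal (g z * (-(4 * π) * chi f (1 / ‖z.1‖))) := by
  have h1 : ∀ a, ENNReal.ofReal (nf f a * nf g a)
      = ∫⁻ z : Phase, ENNReal.ofReal (nf f a) * ENNReal.ofReal (g z * (if a < 1 / ‖z.1‖ then 1 else 0)) := by
    intro a
    rw [lintegral_const_mul' _ _ ENNReal.ofReal_ne_top, ENNReal.ofReal_mul (nf_nonneg hf a)]
    congr 1
    exact ofReal_integral_eq_lintegral_ofReal (nf_integrable hg a)
      (ae_of_all _ fun z => mul_nonneg (hg.nn z) (by split_ifs <;> norm_num))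
  simp_rw [h1]
  rw [lintegral_lintegral_swap]
  · refine lintegral_congr_ae ?_
    filter_upwards [ae_ne_zero1] with z hz
    have hx : 0 < 1 / ‖z.1‖ := by have := norm_pos_iff.2 hz; positivity
    have h2 : ∀ a ∈ Ioi (0:ℝ), ENNReal.ofReal (nf f a) * ENNReal.ofReal (g z * (if a < 1 / ‖z.1‖ then 1 else 0))
        = (Ioo (0:ℝ) (1 / ‖z.1‖)).indicator (fun a => ENNReal.ofReal (g z) * ENNReal.ofReal (nf f a)) a := by
      intro a ha
      by_cases h : a < 1 / ‖z.1‖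
      · rw [indicator_of_mem (show a ∈ Ioo 0 (1 / ‖z.1‖) from ⟨ha, h⟩), if_pos h, mul_one, mul_comm]
      · rw [indicator_of_notMem (fun h' : a ∈ Ioo 0 (1 / ‖z.1‖) => h h'.2), if_neg h]; simp
    rw [setLIntegral_congr_fun measurableSet_Ioi h2, lintegral_indicator measurableSet_Ioo,
      Measure.restrict_restrict measurableSet_Ioo,
      inter_eq_left.2 (Ioo_subset_Ioi_self : Ioo (0:ℝ) (1 / ‖z.1‖) ⊆ Ioi 0),
      lintegral_const_mul' _ _ ENNReal.ofReal_ne_top,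
      lintegral_ftc (g := fun a => -(4 * π) * chi f a) hx.le
        ((continuous_const.mul (chi_cont hf)).continuousOn)
        (fun a _ => by
          have := (chi_hasDerivAt hf a).const_mul (-(4 * π))
          rwa [show -(4 * π) * (-(nf f a) / (4 * π)) = nf f a by field_simp] at this)
        (fun a _ => nf_nonneg hf a), chi_zero, mul_zero, sub_zero, ENNReal.ofReal_mul (hg.nn z)]
  · refine Measurable.aemeasurable ?_
    refine ((nf_meas hf).comp measurable_fst).ennreal_ofReal.mul ?_
    refine Measurable.ennreal_ofReal ?_
    refine (hg.meas.comp measurable_snd).mul ?_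
    exact Measurable.ite (measurableSet_lt measurable_fst (by fun_prop)) measurable_const measurable_const

lemma chi_nonpos {f : Phase → ℝ} (hf : Nice f) {a : ℝ} (ha : 0 ≤ a) : chi f a ≤ 0 := by
  unfold chi
  rw [neg_div]
  exact neg_nonpos.2 (div_nonneg (integral_nonneg fun z => mul_nonneg (hf.nn z) (by positivity)) (by positivity))

lemma chi_meas {f : Phase → ℝ} (hf : Nice f) : Measurable fun z : Phase => chi f (1 / ‖z.1‖) :=
  (chi_cont hf).measurable.comp (by fun_prop)

lemma gchi_int {f g : Phase → ℝ} (hf : Nice f) (hg : Nice g) :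
    Integrable fun z : Phase => g z * chi f (1 / ‖z.1‖) := by
  obtain ⟨Φ, h0, h⟩ := chi_bdd hf
  refine hg.int.mul_bdd (c := Φ) (chi_meas hf).aestronglyMeasurable (ae_of_all _ fun z => ?_)
  rw [Real.norm_eq_abs, abs_le]
  exact ⟨h _, (chi_nonpos hf (by positivity)).trans h0⟩

lemma dual_int {f g : Phase → ℝ} (hf : Nice f) (hg : Nice g) :
    IntegrableOn (fun a => nf f a * nf g a) (Ioi 0) ∧
    ∫ a in Ioi (0:ℝ), nf f a * nf g a = -(4 * π) * ∫ z, g z * chi f (1 / ‖z.1‖) := by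
  have hi : Integrable fun z : Phase => g z * (-(4 * π) * chi f (1 / ‖z.1‖)) := by
    refine ((gchi_int hf hg).const_mul (-(4 * π))).congr (ae_of_all _ fun z => ?_)
    simp only; ring
  have hp : ∀ z : Phase, 0 ≤ g z * (-(4 * π) * chi f (1 / ‖z.1‖)) := fun z =>
    mul_nonneg (hg.nn z) (mul_nonneg_of_nonpos_of_nonpos (by linarith [Real.pi_pos]) (chi_nonpos hf (by positivity)))
  have hm : AEStronglyMeasurable (fun a => nf f a * nf g a) (volume.restrict (Ioi 0)) :=
    ((nf_meas hf).mul (nf_meas hg)).aestronglyMeasurable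
  have hnn : ∀ a, 0 ≤ nf f a * nf g a := fun a => mul_nonneg (nf_nonneg hf a) (nf_nonneg hg a)
  constructor
  · refine ⟨hm, ?_⟩
    rw [hasFiniteIntegral_iff_ofReal (ae_of_all _ hnn), dual_lint hf hg,
      ← ofReal_integral_eq_lintegral_ofReal hi (ae_of_all _ hp)]
    exact ENNReal.ofReal_lt_top
  · rw [integral_eq_lintegral_of_nonneg_ae (ae_of_all _ hnn) hm, dual_lint hf hg,
      ← integral_eq_lintegral_of_nonneg_ae (ae_of_all _ hp) hi.aestronglyMeasurable, ← integral_const_mul]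
    refine integral_congr_ae (ae_of_all _ fun z => ?_)
    simp only; ring

def En (f : Phase → ℝ) (z : Phase) : ℝ := ‖z.2‖ ^ 2 / 2 + chi f (1 / ‖z.1‖)

lemma En_eq {f : Phase → ℝ} (hf : Nice f) (z : Phase) (hz : z.1 ≠ 0) : microE f z = En f z := by
  rw [microE, En, newton hf z.1 hz]

lemma En_meas {f : Phase → ℝ} (hf : Nice f) : Measurable (En f) :=
  Measurable.add (by fun_prop) (chi_meas hf)

lemma En_int {f g : Phase → ℝ} (hf : Nice f) (hg : Nice g) :
    Integrable (fun z => En f z * g z) ∧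
    ∫ z, En f z * g z = kineticE g / 2 + ∫ z, g z * chi f (1 / ‖z.1‖) := by
  have e : (fun z => En f z * g z) = fun z => (‖z.2‖ ^ 2 * g z) / 2 + g z * chi f (1 / ‖z.1‖) := by
    funext z; rw [En]; ring
  rw [e]
  exact ⟨(hg.kin.div_const 2).add (gchi_int hf hg), by
    rw [integral_add (hg.kin.div_const 2) (gchi_int hf hg), integral_div]; rfl⟩

lemma sq_sub_int {f g : Phase → ℝ} (hf : Nice f) (hg : Nice g) :
    IntegrableOn (fun a => (nf f a - nf g a) ^ 2) (Ioi 0) ∧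
    ∫ a in Ioi (0:ℝ), (nf f a - nf g a) ^ 2 = (∫ a in Ioi (0:ℝ), nf f a ^ 2)
      - 2 * (∫ a in Ioi (0:ℝ), nf f a * nf g a) + ∫ a in Ioi (0:ℝ), nf g a ^ 2 := by
  have e : (fun a => (nf f a - nf g a) ^ 2) = fun a => nf f a * nf f a - 2 * (nf f a * nf g a) + nf g a * nf g a := by
    funext a; ring
  have h1 := (dual_int hf hf).1
  have h2 := ((dual_int hf hg).1).const_mul 2
  have h3 := (dual_int hg hg).1
  simp only [e]
  refine ⟨(h1.sub h2).add h3, ?_⟩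
  have h12 : Integrable (fun a => nf f a * nf f a - 2 * (nf f a * nf g a)) (volume.restrict (Ioi 0)) := h1.sub h2
  rw [integral_add h12 h3, integral_sub h1 h2, integral_const_mul]
  simp only [pow_two]

lemma J_formula {Q f : Phase → ℝ} (hf : Nice f) (hg : Nice (rearr Q f)) :
    Jred Q f = (∫ z, En f z * rearr Q f z) + (∫ a in Ioi (0:ℝ), nf f a ^ 2) / (8 * π) := by
  rw [Jred, Ham, fieldSq_eq hg, field_int hf hg, (sq_sub_int hf hg).2, (En_int hf hg).2, (dual_int hf hg).2]
  field_simp; ring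

lemma J_id {Q f : Phase → ℝ} (hf : Nice f) (hQ : Nice Q) (hg : Nice (rearr Q f)) (hQQ : Nice (rearr Q Q))
    (hae : rearr Q Q =ᵐ[volume] Q) :
    Jred Q f - Jred Q Q = (∫ z, En f z * rearr Q f z) - (∫ z, En f z * Q z)
      + (∫ a in Ioi (0:ℝ), (nf f a - nf Q a) ^ 2) / (8 * π) := by
  have e : ∫ z, En Q z * rearr Q Q z = ∫ z, En Q z * Q z :=
    integral_congr_ae (hae.mono fun z hz => by simp only; rw [hz])
  have h4 := (dual_int hQ hQ).2
  simp only [← pow_two] at h4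
  rw [J_formula hf hg, J_formula hQ hQQ, e, (sq_sub_int hf hQ).2, (En_int hf hQ).2, (En_int hQ hQ).2,
    (dual_int hf hQ).2, h4]
  field_simp; ring

lemma fieldDist_sq {f g : Phase → ℝ} (hf : Nice f) (hg : Nice g) :
    fieldDist f g ^ 2 = (∫ a in Ioi (0:ℝ), (nf f a - nf g a) ^ 2) / (4 * π) := by
  rw [fieldDist, Real.sq_sqrt (integral_nonneg fun x => by positivity), field_int hf hg]

end M6

section M7

def LM : Measure (ℝ × ℝ) := ENNReal.ofReal (4 * π ^ 2) • ((volume.restrict (Ioi (0:ℝ))).prod volume)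

lemma lam_LM {S : ℝ → ℝ → Prop} (hS : MeasurableSet {p : ℝ × ℝ | S p.1 p.2}) :
    lam S = LM {p : ℝ × ℝ | S p.1 p.2} := by
  classical
  rw [lam, LM, Measure.smul_apply, smul_eq_mul, Measure.prod_apply hS]
  congr 1
  refine lintegral_congr fun r => ?_
  have h : MeasurableSet {w : ℝ | S r w} := measurable_prodMk_left hS
  have e : ∀ w, (if S r w then (1:ℝ≥0∞) else 0) = {w : ℝ | S r w}.indicator 1 w := fun w => by
    simp [indicator_apply]
  rw [lintegral_congr e, lintegral_indicator_one h]
  rfl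

lemma En_pt {f : Phase → ℝ} {r : ℝ} (hr : 0 < r) (w : ℝ) {l : ℝ} (hl : 0 ≤ l) :
    En f (pt r w l) = w ^ 2 / 2 + (l / (2 * r ^ 2) + chi f (1 / r)) := by
  rw [En, norm_pt1 hr, norm_pt2 w hl]; field_simp; ring

lemma slice_lt (y : ℝ) : volume {w : ℝ | w ^ 2 / 2 < y} = ENNReal.ofReal (2 * √2 * √(max y 0)) := by
  rcases le_or_gt y 0 with h | h
  · have : {w : ℝ | w ^ 2 / 2 < y} = ∅ := by
      ext w; simp only [mem_ofPred_eq, mem_empty_iff_false, iff_false, not_lt]; nlinarith [sq_nonneg w]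
    rw [this, max_eq_right h]; simp
  · have : {w : ℝ | w ^ 2 / 2 < y} = Ioo (-√(2 * y)) (√(2 * y)) := by
      ext w; rw [mem_ofPred_eq, mem_Ioo, ← abs_lt, Real.lt_sqrt (abs_nonneg w), sq_abs]
      constructor <;> intro h <;> linarith
    rw [this, Real.volume_Ioo, max_eq_left h.le, Real.sqrt_mul (by norm_num)]; congr 1; ring

lemma slice_le (y : ℝ) : volume {w : ℝ | w ^ 2 / 2 ≤ y} = ENNReal.ofReal (2 * √2 * √(max y 0)) := by
  rcases lt_or_ge y 0 with h | h
  · have : {w : ℝ | w ^ 2 / 2 ≤ y} = ∅ := by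
      ext w; simp only [mem_ofPred_eq, mem_empty_iff_false, iff_false, not_le]; nlinarith [sq_nonneg w]
    rw [this, max_eq_right h.le]; simp
  · have : {w : ℝ | w ^ 2 / 2 ≤ y} = Icc (-√(2 * y)) (√(2 * y)) := by
      ext w; rw [mem_ofPred_eq, mem_Icc, ← abs_le, Real.le_sqrt (abs_nonneg w), sq_abs]
      constructor <;> intro h <;> linarith
      linarith
    rw [this, Real.volume_Icc, max_eq_left h, Real.sqrt_mul (by norm_num)]; congr 1; ring

lemma phiRad_eq {f : Phase → ℝ} (hf : Nice f) {r : ℝ} (hr : 0 < r) : phiRad f r = chi f (1 / r) := by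
  have h : r • (EuclideanSpace.single (0 : Fin 3) (1:ℝ)) ≠ 0 := by
    intro h
    have := congrArg norm h
    rw [norm_smul] at this
    simp at this; linarith
  rw [phiRad, newton hf _ h, norm_smul]
  simp [abs_of_pos hr]

lemma psi_int {f : Phase → ℝ} (hf : Nice f) {e l : ℝ} (he : e < 0) (hl : 0 < l) :
    IntegrableOn (fun r => √(max (e - (l / (2 * r ^ 2) + chi f (1 / r))) 0)) (Ioi 0) := by
  obtain ⟨Φ, h0, hΦ⟩ := chi_bdd hf
  set M := mass f / (4 * π * (-e)) with hM
  have hi : IntegrableOn (fun r => (Ioo (0:ℝ) M).indicator (fun _ => √Φ) r) (Ioi 0) := by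
    apply Integrable.integrableOn
    rw [integrable_indicator_iff measurableSet_Ioo]
    exact integrableOn_const (by simp) (by simp)
  refine Integrable.mono' hi ?_ ?_
  · have := (chi_cont hf).measurable.comp (by fun_prop : Measurable fun r : ℝ => 1 / r)
    have h2 : Measurable fun r : ℝ => e - (l / (2 * r ^ 2) + chi f (1 / r)) :=
      measurable_const.sub (Measurable.add (by fun_prop) this)
    exact (h2.max measurable_const).sqrt.aestronglyMeasurable
  · filter_upwards [ae_restrict_mem measurableSet_Ioi] with r hr
    have hr : 0 < r := hr
    have hl' : 0 < l / (2 * r ^ 2) := by positivity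
    rw [Real.norm_of_nonneg (Real.sqrt_nonneg _)]
    by_cases h : r < M
    · rw [indicator_of_mem (show r ∈ Ioo 0 M from ⟨hr, h⟩)]
      apply Real.sqrt_le_sqrt
      apply max_le _ h0
      linarith [hΦ (1 / r)]
    · rw [indicator_of_notMem (fun h' : r ∈ Ioo 0 M => h h'.2)]
      have h3 := chi_ge hf (1 / r)
      have h4 : -(1 / r * mass f) / (4 * π) ≥ e := by
        push Not at h
        rw [hM, div_le_iff₀ (by have := Real.pi_pos; nlinarith)] at h
        rw [ge_iff_le, le_div_iff₀ (by positivity), le_neg, one_div, inv_mul_le_iff₀ hr]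
        linarith
      rw [max_eq_right (by linarith)]; simp

lemma pt_meas_rw (l : ℝ) : Measurable fun p : ℝ × ℝ => pt p.1 p.2 l :=
  measurable_pt' measurable_fst measurable_snd measurable_const

lemma aPot_aux {f : Phase → ℝ} (hf : Nice f) {e l : ℝ} (he : e < 0) (hl : 0 < l) :
    ENNReal.ofReal (4 * π ^ 2) * ∫⁻ r in Ioi (0:ℝ), ENNReal.ofReal (2 * √2 * √(max (e - (l / (2 * r ^ 2) + chi f (1 / r))) 0))
     = ENNReal.ofReal (aPot (phiRad f) e l) := by
  rw [← ofReal_integral_eq_lintegral_ofReal ((psi_int hf he hl).const_mul _) (ae_of_all _ fun r => by positivity),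
    ← ENNReal.ofReal_mul (by positivity), aPot, integral_const_mul]
  congr 1
  have : ∫ r in Ioi (0:ℝ), √(max (e - psiPot (phiRad f) l r) 0)
      = ∫ r in Ioi (0:ℝ), √(max (e - (l / (2 * r ^ 2) + chi f (1 / r))) 0) := by
    refine setIntegral_congr_fun measurableSet_Ioi fun r hr => ?_
    simp only [psiPot]; rw [phiRad_eq hf hr, add_comm]
  rw [this]; ring

lemma lam_lt {f : Phase → ℝ} (hf : Nice f) {e l : ℝ} (he : e < 0) (hl : 0 < l) :
    LM {p : ℝ × ℝ | En f (pt p.1 p.2 l) < e} = ENNReal.ofReal (aPot (phiRad f) e l) := by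
  rw [← aPot_aux hf he hl, LM, Measure.smul_apply, smul_eq_mul,
    Measure.prod_apply (measurableSet_lt ((En_meas hf).comp (pt_meas_rw l)) measurable_const : MeasurableSet {p : ℝ × ℝ | En f (pt p.1 p.2 l) < e})]
  congr 1
  refine setLIntegral_congr_fun measurableSet_Ioi fun r hr => ?_
  rw [← slice_lt]
  congr 1; ext w
  simp only [mem_preimage, mem_ofPred_eq]
  rw [En_pt hr w hl.le]
  constructor <;> intro h <;> linarith

lemma lam_le {f : Phase → ℝ} (hf : Nice f) {e l : ℝ} (he : e < 0) (hl : 0 < l) :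
    LM {p : ℝ × ℝ | En f (pt p.1 p.2 l) ≤ e} = ENNReal.ofReal (aPot (phiRad f) e l) := by
  rw [← aPot_aux hf he hl, LM, Measure.smul_apply, smul_eq_mul,
    Measure.prod_apply (measurableSet_le ((En_meas hf).comp (pt_meas_rw l)) measurable_const : MeasurableSet {p : ℝ × ℝ | En f (pt p.1 p.2 l) ≤ e})]
  congr 1
  refine setLIntegral_congr_fun measurableSet_Ioi fun r hr => ?_
  rw [← slice_le]
  congr 1; ext w
  simp only [mem_preimage, mem_ofPred_eq]
  rw [En_pt hr w hl.le]
  constructor <;> intro h <;> linarith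

end M7

section M8

section schw
variable {Q : Phase → ℝ} {B : ℝ}

lemma mu_zero (hB : ∀ z, Q z ≤ B) {s : ℝ} (hs : B ≤ s) (l : ℝ) : muDist Q s l = 0 := by
  have : {p : ℝ × ℝ | s < Q (radPoint p.1 p.2 l)} = ∅ := by
    ext p; simp only [mem_ofPred_eq, mem_empty_iff_false, iff_false, not_lt]; exact (hB _).trans hs
  rw [muDist, this, measure_empty]

lemma mu_anti {s s' : ℝ} (h : s ≤ s') (l : ℝ) : muDist Q s' l ≤ muDist Q s l :=
  measure_mono fun _ hp => lt_of_le_of_lt h hp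

lemma schwarz_bdd (hB : ∀ z, Q z ≤ B) (t l : ℝ) :
    ∀ s ∈ {s : ℝ | 0 ≤ s ∧ ENNReal.ofReal t < muDist Q s l}, s ≤ B := by
  rintro s ⟨_, hs⟩
  by_contra h
  rw [mu_zero hB (le_of_not_ge h)] at hs
  exact absurd hs (by simp)

lemma schwarz_gt (hB : ∀ z, Q z ≤ B) {s : ℝ} (hs : 0 ≤ s) (t l : ℝ) :
    s < schwarz Q t l ↔ ∃ s' : ℝ, s < s' ∧ ENNReal.ofReal t < muDist Q s' l := by
  unfold schwarz
  constructor
  · intro h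
    split_ifs at h with hc
    · obtain ⟨s', h1, h2⟩ := exists_lt_of_lt_csSup (⟨0, le_rfl, hc⟩ : ({s : ℝ | 0 ≤ s ∧ ENNReal.ofReal t < muDist Q s l}).Nonempty) h
      exact ⟨s', h2, h1.2⟩
    · linarith
  · rintro ⟨s', h1, h2⟩
    rw [if_pos (h2.trans_le (mu_anti (hs.trans h1.le) l))]
    exact h1.trans_le (le_csSup ⟨B, schwarz_bdd hB t l⟩ ⟨hs.trans h1.le, h2⟩)

lemma schwarz_gt_rat (hB : ∀ z, Q z ≤ B) {s : ℝ} (hs : 0 ≤ s) (t l : ℝ) :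
    s < schwarz Q t l ↔ ∃ s' : ℚ, s < s' ∧ ENNReal.ofReal t < muDist Q s' l := by
  rw [schwarz_gt hB hs]
  constructor
  · rintro ⟨s', h1, h2⟩
    obtain ⟨q, hq1, hq2⟩ := exists_rat_btwn h1
    exact ⟨q, hq1, h2.trans_le (mu_anti hq2.le l)⟩
  · rintro ⟨q, h⟩; exact ⟨q, h⟩

lemma schwarz_nonneg (t l : ℝ) : 0 ≤ schwarz Q t l := by
  unfold schwarz; split_ifs
  · exact Real.sSup_nonneg fun s hs => hs.1
  · exact le_rfl

lemma schwarz_le (hB0 : 0 ≤ B) (hB : ∀ z, Q z ≤ B) (t l : ℝ) : schwarz Q t l ≤ B := by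
  unfold schwarz; split_ifs
  · exact Real.sSup_le (schwarz_bdd hB t l) hB0
  · exact hB0

lemma mu_meas (hQ : Measurable Q) (s : ℝ) : Measurable fun l => muDist Q s l := by
  have hm : Measurable fun p : ℝ × (ℝ × ℝ) => radPoint p.2.1 p.2.2 p.1 := by
    simp only [radPoint_eq]
    refine measurable_pt' (by fun_prop) ?_ (by fun_prop)
    refine Measurable.div (Measurable.mul (measurable_sign.comp (by fun_prop)) ?_) (by fun_prop)
    fun_prop
  have hn : Measurable fun p : ℝ × (ℝ × ℝ) => nuDens p.1 p.2 := by
    unfold nuDens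
    have h : Measurable fun p : ℝ × (ℝ × ℝ) =>
      ENNReal.ofReal (4 * π ^ 2 * p.2.1 * |p.2.2| / Real.sqrt (p.2.1 ^ 2 * p.2.2 ^ 2 - p.1)) := by fun_prop
    refine Measurable.ite ?_ h measurable_const
    exact (measurableSet_lt measurable_const (by fun_prop : Measurable fun p : ℝ × (ℝ × ℝ) => p.2.1)).inter
      (measurableSet_lt measurable_fst (by fun_prop : Measurable fun p : ℝ × (ℝ × ℝ) => p.2.1 ^ 2 * p.2.2 ^ 2))
  have hS : MeasurableSet {p : ℝ × (ℝ × ℝ) | s < Q (radPoint p.2.1 p.2.2 p.1)} :=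
    measurableSet_lt measurable_const (hQ.comp hm)
  have e : ∀ l, muDist Q s l = ∫⁻ p : ℝ × ℝ,
      {p : ℝ × (ℝ × ℝ) | s < Q (radPoint p.2.1 p.2.2 p.1)}.indicator (fun p => nuDens p.1 p.2) (l, p) := by
    intro l
    have hSl : MeasurableSet {p : ℝ × ℝ | s < Q (radPoint p.1 p.2 l)} := measurable_prodMk_left hS
    rw [muDist, nuMeas, withDensity_apply _ hSl, ← lintegral_indicator hSl]
    rfl
  simp_rw [e]
  exact (hn.indicator hS).lintegral_prod_right'

lemma aPot_meas {f : Phase → ℝ} (hf : Nice f) : Measurable fun p : ℝ × ℝ => aPot (phiRad f) p.1 p.2 := by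
  have e : ∀ p : ℝ × ℝ, aPot (phiRad f) p.1 p.2 = 8 * π ^ 2 * Real.sqrt 2 *
      ∫ r in Ioi (0:ℝ), √(max (p.1 - (p.2 / (2 * r ^ 2) + chi f (1 / r))) 0) := by
    intro p
    rw [aPot]
    congr 1
    refine setIntegral_congr_fun measurableSet_Ioi fun r hr => ?_
    simp only [psiPot]; rw [phiRad_eq hf hr, add_comm]
  simp_rw [e]
  refine measurable_const.mul ?_
  have h : Measurable fun q : (ℝ × ℝ) × ℝ => √(max (q.1.1 - (q.1.2 / (2 * q.2 ^ 2) + chi f (1 / q.2))) 0) := by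
    have := (chi_cont hf).measurable.comp (by fun_prop : Measurable fun q : (ℝ × ℝ) × ℝ => 1 / q.2)
    have h2 : Measurable fun q : (ℝ × ℝ) × ℝ => q.1.1 - (q.1.2 / (2 * q.2 ^ 2) + chi f (1 / q.2)) :=
      Measurable.sub (by fun_prop) (Measurable.add (by fun_prop) this)
    exact (h2.max measurable_const).sqrt
  exact (StronglyMeasurable.integral_prod_right' (ν := volume.restrict (Ioi (0:ℝ))) h.stronglyMeasurable).measurable

lemma microE_meas {f : Phase → ℝ} (hf : Nice f) : Measurable (microE f) := by
  have e : phiF f = fun x => if x = 0 then phiF f 0 else chi f (1 / ‖x‖) := by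
    funext x; split_ifs with h
    · rw [h]
    · exact newton hf x h
  have h : Measurable (phiF f) := by
    rw [e]
    exact Measurable.ite (measurableSet_singleton 0) measurable_const
      ((chi_cont hf).measurable.comp (by fun_prop))
  unfold microE
  exact Measurable.add (by fun_prop) (h.comp measurable_fst)

lemma ell_meas : Measurable ellOf := by
  unfold ellOf
  fun_prop

lemma microE_sph {f : Phase → ℝ} (hf : Nice f) : SphK (microE f) := by
  intro R _ z
  unfold microE
  simp only [LinearIsometryEquiv.norm_map]
  congr 1
  by_cases h : z.1 = 0
  · rw [h, map_zero]
  · rw [newton hf _ h, newton hf _ (by simpa using h)]; simp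

lemma ell_sph : SphK ellOf := by
  intro R _ z
  simp [ellOf, LinearIsometryEquiv.inner_map_map]

lemma ell_nonneg (z : Phase) : 0 ≤ ellOf z := by
  unfold ellOf
  have h := abs_real_inner_le_norm z.1 z.2
  have := sq_abs (inner ℝ z.1 z.2 : ℝ)
  have h1 := pow_le_pow_left₀ (abs_nonneg _) h 2
  rw [sq_abs, mul_pow] at h1; linarith

lemma rearr_gt {f : Phase → ℝ} {s : ℝ} (hs : 0 ≤ s) (z : Phase) :
    s < rearr Q f z ↔ microE f z < 0 ∧ s < schwarz Q (aPot (phiRad f) (microE f z) (ellOf z)) (ellOf z) := by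
  unfold rearr
  split_ifs with h
  · simp [h]
  · simp [h, hs]

lemma rearr_nonneg {f : Phase → ℝ} (z : Phase) : 0 ≤ rearr Q f z := by
  unfold rearr; split_ifs
  · exact schwarz_nonneg _ _
  · exact le_rfl

lemma rearr_le {f : Phase → ℝ} (hB0 : 0 ≤ B) (hB : ∀ z, Q z ≤ B) (z : Phase) : rearr Q f z ≤ B := by
  unfold rearr; split_ifs
  · exact schwarz_le hB0 hB _ _
  · exact hB0

lemma rearr_meas {f : Phase → ℝ} (hf : Nice f) (hQ : Measurable Q) (hB : ∀ z, Q z ≤ B) : Measurable (rearr Q f) := by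
  refine measurable_of_Ioi fun s => ?_
  rcases lt_or_ge s 0 with hs | hs
  · have : rearr Q f ⁻¹' Ioi s = univ := by
      ext z; simp only [mem_preimage, mem_Ioi, mem_univ, iff_true]; exact hs.trans_le (rearr_nonneg z)
    rw [this]; exact MeasurableSet.univ
  · have : rearr Q f ⁻¹' Ioi s = {z | microE f z < 0} ∩ ⋃ q : ℚ, ⋃ (_ : s < q),
        {z | ENNReal.ofReal (aPot (phiRad f) (microE f z) (ellOf z)) < muDist Q q (ellOf z)} := by
      ext z
      simp only [mem_preimage, mem_Ioi, mem_inter_iff, mem_ofPred_eq, mem_iUnion, exists_prop]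
      rw [rearr_gt hs, schwarz_gt_rat hB hs]
    rw [this]
    refine (measurableSet_lt (microE_meas hf) measurable_const).inter ?_
    refine MeasurableSet.iUnion fun q => MeasurableSet.iUnion fun _ => ?_
    exact measurableSet_lt ((aPot_meas hf).comp ((microE_meas hf).prodMk ell_meas)).ennreal_ofReal
      ((mu_meas hQ q).comp ell_meas)

lemma rearr_sph {f : Phase → ℝ} (hf : Nice f) : SphSym (rearr Q f) := by
  intro R hR z
  unfold rearr
  rw [microE_sph hf R hR z, ell_sph R hR z]

/-- the level sets of the rearrangement are at most as large as those of `Q` -/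
lemma lam_rearr {f : Phase → ℝ} (hf : Nice f) (hQ : Measurable Q) (hB : ∀ z, Q z ≤ B) {s l : ℝ} (hs : 0 ≤ s) (hl : 0 < l) :
    lam (fun r w => s < rearr Q f (pt r w l)) ≤ lam (fun r w => s < Q (pt r w l)) := by
  rw [← muDist_eq Q hQ s l hl, lam_LM (S := fun r w => s < rearr Q f (pt r w l)) (measurableSet_lt measurable_const ((rearr_meas hf hQ hB).comp (pt_meas_rw l)))]
  set T : Set ℝ := {e | e < 0 ∧ ENNReal.ofReal (aPot (phiRad f) e l) < muDist Q s l} with hT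
  have hsub : LM {p : ℝ × ℝ | s < rearr Q f (pt p.1 p.2 l)} ≤ LM {p : ℝ × ℝ | En f (pt p.1 p.2 l) ∈ T} := by
    have h0 : LM {p : ℝ × ℝ | p.1 ≤ 0} = 0 := by
      have : {p : ℝ × ℝ | p.1 ≤ 0} = Iic 0 ×ˢ univ := by ext p; simp
      rw [this, LM, Measure.smul_apply, Measure.prod_prod, Measure.restrict_apply measurableSet_Iic,
        (by ext x; simp : Iic (0:ℝ) ∩ Ioi 0 = ∅)]
      simp
    refine (measure_mono (t := {p : ℝ × ℝ | En f (pt p.1 p.2 l) ∈ T} ∪ {p : ℝ × ℝ | p.1 ≤ 0}) ?_).trans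
      ((measure_union_le _ _).trans (by rw [h0, add_zero]))
    intro p hp
    rcases le_or_gt p.1 0 with h | h
    · exact Or.inr h
    · left
      have hne : (pt p.1 p.2 l).1 ≠ 0 := by rw [← norm_pos_iff, norm_pt1 h]; exact h
      have hp := (rearr_gt hs _).1 hp
      rw [schwarz_gt hB hs, ell_pt h _ hl.le, En_eq hf _ hne] at hp
      obtain ⟨h1, s', h2, h3⟩ := hp
      exact ⟨h1, h3.trans_le (mu_anti h2.le l)⟩
  refine hsub.trans ?_
  by_cases hmax : ∃ e ∈ T, ∀ e' ∈ T, e' ≤ e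
  · obtain ⟨e, he, hm⟩ := hmax
    refine (measure_mono (t := {p : ℝ × ℝ | En f (pt p.1 p.2 l) ≤ e}) fun p hp => hm _ hp).trans ?_
    rw [lam_le hf he.1 hl]; exact he.2.le
  · push Not at hmax
    have hdown : ∀ e ∈ T, ∀ e' < e, e' ∈ T := by
      intro e he e' h
      refine ⟨h.trans he.1, lt_of_le_of_lt ?_ he.2⟩
      rw [← lam_le hf he.1 hl, ← lam_le hf (h.trans he.1) hl]
      exact measure_mono fun p hp => le_trans (show En f (pt p.1 p.2 l) ≤ e' from hp) h.le
    have hU : {p : ℝ × ℝ | En f (pt p.1 p.2 l) ∈ T} ⊆ ⋃ q ∈ {q : ℚ | (q:ℝ) ∈ T}, {p : ℝ × ℝ | En f (pt p.1 p.2 l) ≤ q} := by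
      intro p hp
      obtain ⟨e', he', h⟩ := hmax _ hp
      obtain ⟨q, hq1, hq2⟩ := exists_rat_btwn h
      simp only [mem_iUnion, exists_prop]
      exact ⟨q, hdown _ he' _ hq2, hq1.le⟩
    refine (measure_mono hU).trans ?_
    rw [measure_biUnion_eq_iSup (to_countable _)]
    · refine iSup₂_le fun q hq => ?_
      rw [lam_le hf hq.1 hl]; exact hq.2.le
    · have hmo : ∀ a b : ℚ, a ≤ b → {p : ℝ × ℝ | En f (pt p.1 p.2 l) ≤ a} ⊆ {p : ℝ × ℝ | En f (pt p.1 p.2 l) ≤ b} := by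
        intro a b hab p hp
        exact le_trans (show En f (pt p.1 p.2 l) ≤ a from hp) (by exact_mod_cast hab)
      intro a ha b hb
      rcases le_total a b with h | h
      · exact ⟨b, hb, hmo _ _ h, subset_rfl⟩
      · exact ⟨a, ha, subset_rfl, hmo _ _ h⟩

lemma vol_lam {g : Phase → ℝ} (hg : Measurable g) (hs : SphSym g) (s : ℝ) :
    volume {z | s < g z} = ∫⁻ l in Ioi (0:ℝ), lam (fun r w => s < g (pt r w l)) := by
  classical
  have hS : MeasurableSet {z | s < g z} := measurableSet_lt measurable_const hg
  rw [← lintegral_indicator_one hS, disint _ (measurable_one.indicator hS)]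
  · refine lintegral_congr fun l => ?_
    rw [lam, ← lintegral_const_mul' _ _ ENNReal.ofReal_ne_top]
    refine lintegral_congr fun r => ?_
    rw [← lintegral_const_mul' _ _ ENNReal.ofReal_ne_top]
    refine lintegral_congr fun w => ?_
    simp [indicator_apply]
  · intro R hR z
    simp only [indicator_apply, mem_ofPred_eq, hs R hR z, Pi.one_apply]

lemma rearr_nice {f : Phase → ℝ} (hf : Nice f) (hQ : Nice Q) (hB0 : 0 ≤ B) (hB : ∀ z, Q z ≤ B) : Nice (rearr Q f) := by
  have hm := rearr_meas hf hQ.meas hB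
  have hsp : SphSym (rearr Q f) := rearr_sph hf
  have hi : Integrable (rearr Q f) := by
    refine ⟨hm.aestronglyMeasurable, ?_⟩
    rw [hasFiniteIntegral_iff_ofReal (ae_of_all _ rearr_nonneg)]
    have hQf := hQ.int.2
    rw [hasFiniteIntegral_iff_ofReal (ae_of_all _ hQ.nn)] at hQf
    refine lt_of_le_of_lt ?_ hQf
    rw [lintegral_eq_lintegral_meas_lt _ (ae_of_all _ rearr_nonneg) hm.aemeasurable,
      lintegral_eq_lintegral_meas_lt _ (ae_of_all _ hQ.nn) hQ.meas.aemeasurable]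
    refine setLIntegral_mono' measurableSet_Ioi fun s hs => ?_
    rw [vol_lam hm hsp, vol_lam hQ.meas hQ.sph]
    exact setLIntegral_mono' measurableSet_Ioi fun l hl => lam_rearr hf hQ.meas hB (le_of_lt hs) hl
  refine ⟨hm, rearr_nonneg, hi, ?_, ⟨B, hB0, ae_of_all _ (rearr_le hB0 hB)⟩, hsp⟩
  obtain ⟨Φ, h0, hΦ⟩ := chi_bdd hf
  refine (hi.const_mul (2 * Φ)).mono' (Measurable.mul (by fun_prop) hm).aestronglyMeasurable ?_
  filter_upwards [ae_ne_zero1] with z hz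
  have hg := rearr_nonneg (Q := Q) (f := f) z
  rw [Real.norm_of_nonneg (by positivity)]
  by_cases h : microE f z < 0
  · refine mul_le_mul_of_nonneg_right ?_ hg
    rw [En_eq hf z hz, En] at h
    linarith [hΦ (1 / ‖z.1‖)]
  · rw [rearr, if_neg h]; simp

end schw

end M8

section M9

section assA
variable {Q : Phase → ℝ} {F : ℝ → ℝ → ℝ} {e₀ : ℝ}

lemma A_bdd (hQ : AssumptionA Q F e₀) : ∃ B : ℝ, 0 ≤ B ∧ ∀ z, Q z ≤ B := by
  obtain ⟨B, hB⟩ := hQ.cpt.exists_bound_of_continuous hQ.contQ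
  exact ⟨B, (norm_nonneg _).trans (hB 0), fun z => (le_abs_self _).trans (hB z)⟩

lemma A_nice (hQ : AssumptionA Q F e₀) : Nice Q := by
  obtain ⟨B, hB0, hB⟩ := A_bdd hQ
  refine ⟨hQ.contQ.measurable, hQ.nonneg, hQ.contQ.integrable_of_hasCompactSupport hQ.cpt, ?_,
    ⟨B, hB0, ae_of_all _ hB⟩, hQ.sph⟩
  have hc : Continuous fun z : Phase => ‖z.2‖ ^ 2 := by fun_prop
  exact (hc.mul hQ.contQ).integrable_of_hasCompactSupport hQ.cpt.mul_left

lemma F_cont (hQ : AssumptionA Q F e₀) {l : ℝ} (hl : 0 ≤ l) : Continuous fun e => F e l := by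
  rw [← continuousOn_univ]
  exact hQ.Fcont.comp (f := fun e : ℝ => (e, l)) (by fun_prop) (fun e _ => hl)

lemma F_anti (hQ : AssumptionA Q F e₀) {l : ℝ} (hl : 0 ≤ l) : Antitone fun e => F e l := by
  intro e e' hee
  by_contra hlt
  simp only [not_le] at hlt
  obtain ⟨x, hx, hmax⟩ := isCompact_Icc.exists_isMaxOn (nonempty_Icc.2 hee) (F_cont hQ hl).continuousOn
  have hxe' : F e' l ≤ F x l := hmax (right_mem_Icc.2 hee)
  have hpos : 0 < F x l := lt_of_le_of_lt (hQ.Fnonneg e l hl) (hlt.trans_le hxe')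
  have hex : e < x := lt_of_le_of_ne hx.1 (by rintro rfl; linarith)
  have hd := hQ.FeNeg x l hl hpos
  have hda : HasDerivAt (fun e' => F e' l) (deriv (fun e' => F e' l) x) x :=
    (differentiableAt_of_deriv_ne_zero hd.ne).hasDerivAt
  have h1 := (hasDerivAt_iff_tendsto_slope.1 hda).eventually (eventually_lt_nhds hd)
  have h2 : ∀ᶠ y in 𝓝[<] x, slope (fun e' => F e' l) x y < 0 :=
    h1.filter_mono (nhdsWithin_mono x fun y hy => ne_of_lt hy)
  have h3 : ∀ᶠ y in 𝓝[<] x, y ∈ Ioo e x := Ioo_mem_nhdsLT hex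
  obtain ⟨y, hy1, hy2⟩ := (h2.and h3).exists
  have h4 : F y l ≤ F x l := hmax ⟨hy2.1.le, hy2.2.le.trans hx.2⟩
  rw [slope_def_field] at hy1
  have : 0 ≤ (F y l - F x l) / (y - x) := div_nonneg_of_nonpos (by linarith) (by linarith [hy2.2])
  linarith

lemma Q_pt (hQ : AssumptionA Q F e₀) {r : ℝ} (hr : 0 < r) (w : ℝ) {l : ℝ} (hl : 0 ≤ l) :
    Q (pt r w l) = F (w ^ 2 / 2 + (l / (2 * r ^ 2) + chi Q (1 / r))) l := by
  have hne : (pt r w l).1 ≠ 0 := by rw [← norm_pos_iff, norm_pt1 hr]; exact hr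
  rw [hQ.eqF, ell_pt hr _ hl, En_eq (A_nice hQ) _ hne, En_pt hr w hl]

lemma exists_c0 (hQ : AssumptionA Q F e₀) {s l : ℝ} (hs : 0 ≤ s) (hl : 0 ≤ l) (h : ∃ e, s < F e l) :
    ∃ c ≤ e₀, ∀ e, s < F e l ↔ e < c := by
  set T := {e | s < F e l} with hT
  have hb : ∀ e ∈ T, e ≤ e₀ := fun e he => (hQ.Fsupp e l hl (hs.trans_lt he)).le
  have hbd : BddAbove T := ⟨e₀, hb⟩
  refine ⟨sSup T, csSup_le h hb, fun e => ⟨fun he => ?_, fun he => ?_⟩⟩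
  · have ho : IsOpen T := isOpen_lt continuous_const (F_cont hQ hl)
    obtain ⟨ε, hε, hball⟩ := Metric.isOpen_iff.1 ho e he
    have : e + ε / 2 ∈ T := hball (by
      rw [Metric.mem_ball, Real.dist_eq, show e + ε / 2 - e = ε / 2 by ring, abs_of_pos (by positivity)]; linarith)
    linarith [le_csSup hbd this]
  · obtain ⟨e', he', hlt⟩ := exists_lt_of_lt_csSup h he
    exact lt_of_lt_of_le (show s < F e' l from he') (F_anti hQ hl hlt.le)

lemma ae_ell : ∀ᵐ z : Phase, 0 < ellOf z := by
  have hS : MeasurableSet {z : Phase | ¬ 0 < ellOf z} := (measurableSet_lt measurable_const ell_meas).compl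
  rw [ae_iff, ← lintegral_indicator_one hS, disint _ (measurable_one.indicator hS)]
  · refine (setLIntegral_congr_fun measurableSet_Ioi (g := fun _ => 0) fun l hl => ?_).trans (by simp)
    refine (setLIntegral_congr_fun measurableSet_Ioi (g := fun _ => 0) fun r hr => ?_).trans (by simp)
    refine (lintegral_congr (g := fun _ => 0) fun w => ?_).trans (by simp)
    have hl : 0 < l := hl
    rw [indicator_of_notMem, mul_zero]
    simp only [mem_ofPred_eq, ell_pt hr w hl.le, not_not]
    exact hl
  · intro R hR z
    simp only [indicator_apply, mem_ofPred_eq, ell_sph R hR z, Pi.one_apply]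

lemma rearr_self (hQ : AssumptionA Q F e₀) : rearr Q Q =ᵐ[volume] Q := by
  obtain ⟨B, hB0, hB⟩ := A_bdd hQ
  have hN := A_nice hQ
  filter_upwards [ae_ell, ae_ne_zero1] with z hl hz
  set l := ellOf z with hldef
  set e := microE Q z with he
  have hQz : Q z = F e l := hQ.eqF z
  rw [hQz, rearr, ← he, ← hldef]
  have hF0 := hQ.Fnonneg e l hl.le
  split_ifs with hneg
  swap
  · by_contra hne
    have := hQ.Fsupp e l hl.le (lt_of_le_of_ne hF0 hne)
    linarith [hQ.e₀neg]
  have hms : ∀ s, MeasurableSet {p : ℝ × ℝ | s < Q (pt p.1 p.2 l)} := fun s =>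
    measurableSet_lt measurable_const (hN.meas.comp (pt_meas_rw l))
  have hposr : ∀ᵐ p ∂LM, 0 < p.1 := by
    rw [ae_iff]
    have : {p : ℝ × ℝ | ¬ 0 < p.1} = Iic 0 ×ˢ univ := by ext p; simp
    rw [this, LM, Measure.smul_apply, Measure.prod_prod, Measure.restrict_apply measurableSet_Iic,
      (by ext x; simp : Iic (0:ℝ) ∩ Ioi 0 = ∅)]
    simp
  have hmu : ∀ s, muDist Q s l = LM {p : ℝ × ℝ | s < Q (pt p.1 p.2 l)} := fun s => by
    rw [muDist_eq Q hN.meas s l hl, lam_LM (S := fun r w => s < Q (pt r w l)) (hms s)]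
  have hQp : ∀ p : ℝ × ℝ, 0 < p.1 → Q (pt p.1 p.2 l) = F (En Q (pt p.1 p.2 l)) l := fun p hp => by
    rw [Q_pt hQ hp _ hl.le, En_pt hp _ hl.le]
  -- claim A
  have hA : ∀ s, s < F e l → ENNReal.ofReal (aPot (phiRad Q) e l) < muDist Q s l := by
    intro s hs
    rw [hmu, ← lam_le hN hneg hl]
    obtain ⟨ε, hε, hball⟩ := Metric.isOpen_iff.1 (isOpen_lt continuous_const (F_cont hQ hl.le)) e hs
    set V := {p : ℝ × ℝ | 0 < p.1 ∧ En Q (pt p.1 p.2 l) ∈ Ioo e (e + ε)} with hV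
    have hVm : MeasurableSet V := (measurableSet_lt measurable_const measurable_fst).inter
      (((En_meas hN).comp (pt_meas_rw l)) measurableSet_Ioo)
    have hdis : Disjoint {p : ℝ × ℝ | En Q (pt p.1 p.2 l) ≤ e} V := by
      rw [Set.disjoint_left]; intro p h1 h2; exact absurd h2.2.1 (not_lt.2 h1)
    have hpos : 0 < LM V := by
      have hVo : IsOpen V := by
        have : V = {p : ℝ × ℝ | 0 < p.1} ∩ (fun p : ℝ × ℝ => p.2 ^ 2 / 2 + (l / (2 * p.1 ^ 2) + chi Q (1 / p.1))) ⁻¹' Ioo e (e + ε) := by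
          ext p
          simp only [hV, mem_ofPred_eq, mem_inter_iff, mem_preimage]
          refine and_congr_right fun hp => ?_
          rw [En_pt hp _ hl.le]
        rw [this]
        refine ContinuousOn.isOpen_inter_preimage ?_ (isOpen_lt continuous_const continuous_fst) isOpen_Ioo
        refine ContinuousOn.add (by fun_prop) (ContinuousOn.add ?_ ?_)
        · refine ContinuousOn.div (by fun_prop) (by fun_prop) fun p hp => ?_
          have : 0 < p.1 := hp
          positivity
        · refine (chi_cont hN).comp_continuousOn ?_
          exact ContinuousOn.div (by fun_prop) (by fun_prop) fun p hp => ne_of_gt hp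
      have hVne : V.Nonempty := by
        have hr : 0 < ‖z.1‖ := norm_pos_iff.2 hz
        set w := inner ℝ z.1 z.2 / ‖z.1‖
        have h1 : e = En Q (pt ‖z.1‖ w l) := by
          have hne : (pt ‖z.1‖ w l).1 ≠ 0 := by rw [← norm_pos_iff, norm_pt1 hr]; exact hr
          rw [he, sph_pt (microE_sph hN) z hz, En_eq hN _ hne]
        rw [En_pt hr _ hl.le] at h1
        refine ⟨(‖z.1‖, √(w ^ 2 + ε)), hr, ?_⟩
        simp only
        rw [En_pt hr _ hl.le, Real.sq_sqrt (by positivity)]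
        constructor <;> linarith
      rw [pos_iff_ne_zero, LM, Measure.smul_apply, smul_eq_mul]
      refine mul_ne_zero (by simp [Real.pi_ne_zero]) ?_
      have hres : ((volume.restrict (Ioi (0:ℝ))).prod (volume : Measure ℝ)) V = volume V := by
        have : (volume.restrict (Ioi (0:ℝ))).prod (volume : Measure ℝ) = (volume : Measure (ℝ × ℝ)).restrict (Ioi 0 ×ˢ univ) := by
          rw [Measure.volume_eq_prod, ← Measure.prod_restrict, Measure.restrict_univ]
        rw [this, Measure.restrict_apply hVm, inter_eq_left.2]
        intro p hp; exact ⟨hp.1, mem_univ _⟩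
      rw [hres]
      exact (hVo.measure_pos volume hVne).ne'
    have hfin : LM {p : ℝ × ℝ | En Q (pt p.1 p.2 l) ≤ e} ≠ ⊤ := by rw [lam_le hN hneg hl]; exact ENNReal.ofReal_ne_top
    refine lt_of_lt_of_le (ENNReal.lt_add_right hfin hpos.ne') ?_
    rw [← measure_union hdis hVm]
    refine measure_mono_ae ?_
    filter_upwards [hposr] with p hp
    rintro (h | h)
    · show s < Q (pt p.1 p.2 l)
      rw [hQp p hp]
      exact hs.trans_le (F_anti hQ hl.le h)
    · show s < Q (pt p.1 p.2 l)
      rw [hQp p hp]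
      refine hball ?_
      rw [Metric.mem_ball, Real.dist_eq, abs_lt]
      have := h.2
      constructor <;> linarith [this.1, this.2]
  have hBc : ∀ s, F e l ≤ s → muDist Q s l ≤ ENNReal.ofReal (aPot (phiRad Q) e l) := by
    intro s hs
    rw [hmu, ← lam_lt hN hneg hl]
    refine measure_mono_ae ?_
    filter_upwards [hposr] with p hp
    intro h
    have h : s < Q (pt p.1 p.2 l) := h
    rw [hQp p hp] at h
    show En Q (pt p.1 p.2 l) < e
    by_contra hc
    have := F_anti hQ hl.le (not_lt.1 hc)
    simp only at this
    linarith
  refine le_antisymm ?_ ?_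
  · by_contra hc
    rw [not_le, schwarz_gt hB hF0] at hc
    obtain ⟨s', h1, h2⟩ := hc
    exact absurd h2 (not_lt.2 (hBc s' h1.le))
  · refine le_of_forall_lt fun s hs => ?_
    rcases lt_or_ge s 0 with h | h
    · exact h.trans_le (schwarz_nonneg _ _)
    · rw [schwarz_gt hB h]
      obtain ⟨s', h1, h2⟩ := exists_between hs
      exact ⟨s', h1, hA s' h2⟩

lemma J_id' (hQ : AssumptionA Q F e₀) {f : Phase → ℝ} (hf : Nice f) :
    Jred Q f - Jred Q Q = (∫ z, En f z * rearr Q f z) - (∫ z, En f z * Q z)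
      + (∫ a in Ioi (0:ℝ), (nf f a - nf Q a) ^ 2) / (8 * π) := by
  obtain ⟨B, hB0, hB⟩ := A_bdd hQ
  have hN := A_nice hQ
  exact J_id hf hN (rearr_nice hf hN hB0 hB) (rearr_nice hN hN hB0 hB) (rearr_self hQ)

end assA

end M9

section M10

def Vf (y k : ℝ) : ℝ := (4 * √2 / 3) * (√(max (y - k) 0) ^ 3 - √(max y 0) ^ 3) + 2 * √2 * k * √(max y 0)

lemma quad_int (q t : ℝ) (hq : 0 ≤ q) :
    Integrable (fun w : ℝ => (Ioo (-(√2 * q)) (√2 * q)).indicator (fun w => t - w ^ 2 / 2) w) ∧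
    ∫ w, (Ioo (-(√2 * q)) (√2 * q)).indicator (fun w => t - w ^ 2 / 2) w = 2 * √2 * q * t - (2 * √2 / 3) * q ^ 3 := by
  have h2 : √2 ^ 2 = (2:ℝ) := Real.sq_sqrt (by norm_num)
  have h3 : √2 ^ 3 = 2 * √2 := by rw [pow_succ, h2]
  have hc : Continuous fun w : ℝ => t - w ^ 2 / 2 := by fun_prop
  constructor
  · rw [integrable_indicator_iff measurableSet_Ioo]
    exact (hc.integrableOn_Icc).mono_set Ioo_subset_Icc_self
  · have hle : -(√2 * q) ≤ √2 * q := by have := Real.sqrt_nonneg 2; nlinarith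
    rw [integral_indicator measurableSet_Ioo, ← integral_Ioc_eq_integral_Ioo, ← intervalIntegral.integral_of_le hle]
    rw [intervalIntegral.integral_sub (by simp) (by apply Continuous.intervalIntegrable; fun_prop)]
    simp only [intervalIntegral.integral_const, intervalIntegral.integral_div, integral_pow]
    norm_num
    ring_nf
    rw [h3]; ring

lemma pos_ind (t w : ℝ) : max (t - w ^ 2 / 2) 0
    = (Ioo (-(√2 * √(max t 0))) (√2 * √(max t 0))).indicator (fun w => t - w ^ 2 / 2) w := by
  have hmem : w ∈ Ioo (-(√2 * √(max t 0))) (√2 * √(max t 0)) ↔ w ^ 2 / 2 < max t 0 := by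
    rw [mem_Ioo, ← abs_lt, ← Real.sqrt_mul (by norm_num), Real.lt_sqrt (abs_nonneg w), sq_abs]
    constructor <;> intro h <;> linarith
  by_cases h : w ^ 2 / 2 < max t 0
  · rw [indicator_of_mem (hmem.2 h)]
    rcases lt_max_iff.1 h with h | h
    · exact max_eq_left (by linarith)
    · nlinarith [sq_nonneg w]
  · rw [indicator_of_notMem (fun h' => h (hmem.1 h'))]
    rw [lt_max_iff, not_or] at h
    exact max_eq_right (by linarith)

lemma ite_ind (y t w : ℝ) : (if w ^ 2 / 2 < y then t - w ^ 2 / 2 else 0)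
    = (Ioo (-(√2 * √(max y 0))) (√2 * √(max y 0))).indicator (fun w => t - w ^ 2 / 2) w := by
  have hmem : w ∈ Ioo (-(√2 * √(max y 0))) (√2 * √(max y 0)) ↔ w ^ 2 / 2 < max y 0 := by
    rw [mem_Ioo, ← abs_lt, ← Real.sqrt_mul (by norm_num), Real.lt_sqrt (abs_nonneg w), sq_abs]
    constructor <;> intro h <;> linarith
  have h2 : w ^ 2 / 2 < max y 0 ↔ w ^ 2 / 2 < y := by
    rw [lt_max_iff]; constructor
    · rintro (h | h)
      · exact h
      · nlinarith [sq_nonneg w]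
    · exact Or.inl
  rw [indicator_apply]
  simp only [hmem, h2]

def Dd (y t w : ℝ) : ℝ := max (t - w ^ 2 / 2) 0 - if w ^ 2 / 2 < y then t - w ^ 2 / 2 else 0

lemma Dd_nonneg (y t w : ℝ) : 0 ≤ Dd y t w := by
  unfold Dd
  split_ifs
  · linarith [le_max_left (t - w ^ 2 / 2) 0]
  · linarith [le_max_right (t - w ^ 2 / 2) 0]

lemma Dd_int (y k : ℝ) : ∫⁻ w, ENNReal.ofReal (Dd y (y - k) w) = ENNReal.ofReal (Vf y k) := by
  have e : Dd y (y - k) = fun w => (Ioo (-(√2 * √(max (y - k) 0))) (√2 * √(max (y - k) 0))).indicator (fun w => (y - k) - w ^ 2 / 2) w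
     - (Ioo (-(√2 * √(max y 0))) (√2 * √(max y 0))).indicator (fun w => (y - k) - w ^ 2 / 2) w := by
    funext w; rw [Dd, pos_ind, ite_ind]
  have h1 := quad_int (√(max (y - k) 0)) (y - k) (by positivity)
  have h2 := quad_int (√(max y 0)) (y - k) (by positivity)
  rw [← ofReal_integral_eq_lintegral_ofReal (by rw [e]; exact h1.1.sub h2.1) (ae_of_all _ (Dd_nonneg _ _)), e,
    integral_sub h1.1 h2.1, h1.2, h2.2, Vf]
  congr 1
  have h3 : √(max (y - k) 0) * (y - k) = √(max (y - k) 0) ^ 3 := by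
    rcases le_total (y - k) 0 with h | h
    · rw [max_eq_right h]; simp
    · rw [max_eq_left h, pow_succ, Real.sq_sqrt h]; ring
  have h4 : √(max y 0) * y = √(max y 0) ^ 3 := by
    rcases le_total y 0 with h | h
    · rw [max_eq_right h]; simp
    · rw [max_eq_left h, pow_succ, Real.sq_sqrt h]; ring
  linear_combination (2 * √2) * h3 - (2 * √2) * h4

lemma inv_lint (G : ℝ → ℝ≥0∞) :
    ∫⁻ r in Ioi (0:ℝ), G r = ∫⁻ a in Ioi (0:ℝ), ENNReal.ofReal (1 / a ^ 2) * G (1 / a) := by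
  have himg : (fun a : ℝ => 1 / a) '' Ioi (0:ℝ) = Ioi 0 := by
    ext x; simp only [mem_image, mem_Ioi]
    constructor
    · rintro ⟨a, ha, rfl⟩; positivity
    · intro hx; exact ⟨1 / x, by positivity, by simp⟩
  conv_lhs => rw [← himg]
  rw [lintegral_image_eq_lintegral_abs_deriv_mul (f' := fun a => -(1 / a ^ 2)) measurableSet_Ioi]
  · refine setLIntegral_congr_fun measurableSet_Ioi fun a ha => ?_
    rw [abs_neg, abs_of_nonneg (by positivity)]
  · intro a ha
    have := (hasDerivAt_inv (ne_of_gt (show (0:ℝ) < a from ha))).hasDerivWithinAt (s := Ioi (0:ℝ))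
    simpa [one_div] using this
  · intro a _ b _ h; simpa using h

lemma LM_lint (g : ℝ × ℝ → ℝ≥0∞) (hg : Measurable g) :
    ∫⁻ p, g p ∂LM = ENNReal.ofReal (4 * π ^ 2) * ∫⁻ r in Ioi (0:ℝ), ∫⁻ w, g (r, w) := by
  rw [LM, lintegral_smul_measure, lintegral_prod _ hg.aemeasurable, smul_eq_mul]

def SL : Measure (ℝ × ℝ) := (volume.restrict (Ioi (0:ℝ))).prod (volume.restrict (Ioi (0:ℝ)))

instance : SFinite SL := by unfold SL; infer_instance
instance : SFinite LM := by unfold LM; infer_instance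

lemma pt_meas3 : Measurable fun x : (ℝ × ℝ) × (ℝ × ℝ) => pt x.2.1 x.2.2 x.1.2 :=
  measurable_pt' (by fun_prop) (by fun_prop) (by fun_prop)

lemma ind_meas {φ h : Phase → ℝ} (hφ : Measurable φ) (hh : Measurable h) :
    Measurable fun x : (ℝ × ℝ) × (ℝ × ℝ) => ENNReal.ofReal (φ (pt x.2.1 x.2.2 x.1.2)) * if x.1.1 < h (pt x.2.1 x.2.2 x.1.2) then 1 else 0 := by
  refine (hφ.comp pt_meas3).ennreal_ofReal.mul ?_
  exact Measurable.ite (measurableSet_lt (by fun_prop) (hh.comp pt_meas3)) measurable_const measurable_const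

lemma layer {φ h : Phase → ℝ} (hφ : Measurable φ) (hφs : SphK φ) (hh : Measurable h) (hhs : SphSym h) :
    ∫⁻ z, ENNReal.ofReal (φ z) * ENNReal.ofReal (h z)
     = ∫⁻ q, (∫⁻ p, ENNReal.ofReal (φ (pt p.1 p.2 q.2)) * (if q.1 < h (pt p.1 p.2 q.2) then 1 else 0) ∂LM) ∂SL := by
  rw [SL, lintegral_prod _ ((ind_meas hφ hh).lintegral_prod_right' (ν := LM)).aemeasurable]
  have h1 : ∀ s : ℝ, ∫⁻ l in Ioi (0:ℝ), (∫⁻ p, ENNReal.ofReal (φ (pt p.1 p.2 l)) * (if s < h (pt p.1 p.2 l) then 1 else 0) ∂LM)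
      = ∫⁻ z, ENNReal.ofReal (φ z) * (if s < h z then 1 else 0) := by
    intro s
    rw [disint (fun z => ENNReal.ofReal (φ z) * (if s < h z then 1 else 0))]
    · refine lintegral_congr fun l => ?_
      rw [LM_lint (fun p => ENNReal.ofReal (φ (pt p.1 p.2 l)) * if s < h (pt p.1 p.2 l) then 1 else 0) ((ind_meas hφ hh).comp (measurable_prodMk_left (x := (s, l)))),
        ← lintegral_const_mul' _ _ ENNReal.ofReal_ne_top]
      refine lintegral_congr fun r => ?_
      rw [← lintegral_const_mul' _ _ ENNReal.ofReal_ne_top]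
    · exact hφ.ennreal_ofReal.mul (Measurable.ite (measurableSet_lt measurable_const hh) measurable_const measurable_const)
    · intro R hR z
      simp only [hφs R hR z, hhs R hR z]
  simp_rw [h1]
  rw [lintegral_lintegral_swap]
  · refine lintegral_congr fun z => ?_
    rw [lintegral_const_mul' _ _ ENNReal.ofReal_ne_top]
    congr 1
    have e : ∀ s ∈ Ioi (0:ℝ), (if s < h z then (1:ℝ≥0∞) else 0) = (Iio (h z)).indicator 1 s := fun s _ => by
      simp [indicator_apply]
    rw [setLIntegral_congr_fun measurableSet_Ioi e, lintegral_indicator_one measurableSet_Iio,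
      Measure.restrict_apply measurableSet_Iio, inter_comm, Ioi_inter_Iio, Real.volume_Ioo, sub_zero]
  · refine Measurable.aemeasurable ?_
    exact ((hφ.comp measurable_snd).ennreal_ofReal).mul
      (Measurable.ite (measurableSet_lt measurable_fst (hh.comp measurable_snd)) measurable_const measurable_const)

end M10

section M11

variable {Q : Phase → ℝ} {F : ℝ → ℝ → ℝ} {e₀ : ℝ}

lemma SL_eq : SL = volume.restrict (Ioi (0:ℝ) ×ˢ Ioi (0:ℝ)) := by
  rw [SL, Measure.prod_restrict]; rfl

lemma LM_pos : ∀ᵐ p ∂LM, (0:ℝ) < p.1 := by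
  rw [LM]
  refine Measure.ae_smul_measure ?_ _
  exact Measure.quasiMeasurePreserving_fst.ae (ae_restrict_mem (measurableSet_Ioi (a := (0:ℝ))))

lemma bath_pt {e' Φ b t : ℝ} (hb : 0 ≤ b) (hΦ : 0 ≤ Φ) (he : 0 ≤ e') (h : e' - Φ + b = -t) (PA PB : Prop) [Decidable PA] [Decidable PB] :
    ENNReal.ofReal e' * (if PB then 1 else 0) + ENNReal.ofReal Φ * (if PA then 1 else 0) + ENNReal.ofReal b * (if PB then 1 else 0)
    ≤ ENNReal.ofReal e' * (if PA then 1 else 0) + ENNReal.ofReal Φ * (if PB then 1 else 0) + ENNReal.ofReal b * (if PA then 1 else 0)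
      + ENNReal.ofReal (max t 0 - if PB then t else 0) := by
  have hi : ∀ (x : ℝ) (P : Prop) [Decidable P], ENNReal.ofReal x * (if P then 1 else 0) = ENNReal.ofReal (if P then x else 0) := by
    intro x P _; split_ifs <;> simp
  have h0 : ∀ {x : ℝ} (P : Prop) [Decidable P], 0 ≤ x → 0 ≤ (if P then x else 0) := by
    intro x P _ hx; split_ifs <;> simp [hx]
  have h1 := le_max_left t 0
  have h2 := le_max_right t 0
  have hD : 0 ≤ max t 0 - if PB then t else 0 := by split_ifs <;> linarith
  simp only [hi]
  rw [← ENNReal.ofReal_add (h0 _ he) (h0 _ hΦ), ← ENNReal.ofReal_add (add_nonneg (h0 _ he) (h0 _ hΦ)) (h0 _ hb),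
    ← ENNReal.ofReal_add (h0 _ he) (h0 _ hΦ), ← ENNReal.ofReal_add (add_nonneg (h0 _ he) (h0 _ hΦ)) (h0 _ hb),
    ← ENNReal.ofReal_add (add_nonneg (add_nonneg (h0 _ he) (h0 _ hΦ)) (h0 _ hb)) hD]
  apply ENNReal.ofReal_le_ofReal
  split_ifs <;> linarith

lemma orbit_ineq (hQ : AssumptionA Q F e₀) {f : Phase → ℝ} (hf : Nice f) {Φ : ℝ} (hΦ : 0 ≤ Φ) (hΦf : ∀ a, -Φ ≤ chi f a)
    {s l : ℝ} (hs : 0 < s) (hl : 0 < l) (G : ℝ≥0∞)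
    (h : ∀ c0, (∀ e, s < F e l ↔ e < c0) → c0 ≤ e₀ → (∃ a > 0, 0 < c0 - chi Q a - l * a ^ 2 / 2) →
      ∃ η, c0 + η ≤ 0 ∧ ENNReal.ofReal (4 * π ^ 2) * ∫⁻ a in Ioi (0:ℝ), ENNReal.ofReal (1 / a ^ 2) *
        ENNReal.ofReal (Vf (c0 - chi Q a - l * a ^ 2 / 2) (chi f a - chi Q a - η)) ≤ G) :
    (∫⁻ p, ENNReal.ofReal (En f (pt p.1 p.2 l) + Φ) * (if s < Q (pt p.1 p.2 l) then 1 else 0) ∂LM)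
      + (∫⁻ p, ENNReal.ofReal Φ * (if s < rearr Q f (pt p.1 p.2 l) then 1 else 0) ∂LM)
    ≤ (∫⁻ p, ENNReal.ofReal (En f (pt p.1 p.2 l) + Φ) * (if s < rearr Q f (pt p.1 p.2 l) then 1 else 0) ∂LM)
      + (∫⁻ p, ENNReal.ofReal Φ * (if s < Q (pt p.1 p.2 l) then 1 else 0) ∂LM) + G := by
  obtain ⟨B, hB0, hB⟩ := A_bdd hQ
  have hN := A_nice hQ
  have hgm := (rearr_meas hf hN.meas hB).comp (pt_meas_rw l)
  have hqm := hN.meas.comp (pt_meas_rw l)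
  have hSA : MeasurableSet {p : ℝ × ℝ | s < rearr Q f (pt p.1 p.2 l)} := measurableSet_lt measurable_const hgm
  have hSB : MeasurableSet {p : ℝ × ℝ | s < Q (pt p.1 p.2 l)} := measurableSet_lt measurable_const hqm
  have hAB : LM {p : ℝ × ℝ | s < rearr Q f (pt p.1 p.2 l)} ≤ LM {p : ℝ × ℝ | s < Q (pt p.1 p.2 l)} := by
    have := lam_rearr hf hN.meas hB hs.le hl
    rwa [lam_LM (S := fun r w => s < rearr Q f (pt r w l)) hSA, lam_LM (S := fun r w => s < Q (pt r w l)) hSB] at this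
  have hone : ∀ (c : ℝ≥0∞) (S : ℝ × ℝ → Prop) [DecidablePred S], MeasurableSet {p | S p} → ∫⁻ p, c * (if S p then 1 else 0) ∂LM = c * LM {p | S p} := by
    intro c S _ hS
    have : (fun p => c * (if S p then (1:ℝ≥0∞) else 0)) = {p | S p}.indicator (fun _ => c) := by
      funext p; simp [indicator_apply]
    rw [this, lintegral_indicator_const hS]
  rw [hone _ (fun p => s < rearr Q f (pt p.1 p.2 l)) hSA, hone _ (fun p => s < Q (pt p.1 p.2 l)) hSB]
  by_cases hz : LM {p : ℝ × ℝ | s < Q (pt p.1 p.2 l)} = 0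
  · have h1 : LM {p : ℝ × ℝ | s < rearr Q f (pt p.1 p.2 l)} = 0 := le_antisymm (hAB.trans hz.le) bot_le
    have h2 : ∫⁻ p, ENNReal.ofReal (En f (pt p.1 p.2 l) + Φ) * (if s < Q (pt p.1 p.2 l) then 1 else 0) ∂LM = 0 := by
      refine (lintegral_congr_ae (g := fun _ => 0) ?_).trans lintegral_zero
      have : ∀ᵐ p ∂LM, ¬ s < Q (pt p.1 p.2 l) := by rw [ae_iff]; simpa using hz
      filter_upwards [this] with p hp
      rw [if_neg hp, mul_zero]
    rw [h1, h2]; simp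
  have hex : ∃ p : ℝ × ℝ, 0 < p.1 ∧ s < Q (pt p.1 p.2 l) := by
    by_contra hcon
    push Not at hcon
    apply hz
    have : ∀ᵐ p ∂LM, ¬ s < Q (pt p.1 p.2 l) := by
      filter_upwards [LM_pos] with p hp using not_lt.2 (hcon p hp)
    rw [ae_iff] at this; simpa using this
  obtain ⟨⟨r0, w0⟩, hr0, hq0⟩ := hex
  simp only at hr0 hq0
  rw [Q_pt hQ hr0 w0 hl.le] at hq0
  obtain ⟨c0, hc0, hc⟩ := exists_c0 hQ hs.le hl.le ⟨_, hq0⟩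
  have hy : ∃ a > 0, 0 < c0 - chi Q a - l * a ^ 2 / 2 := by
    refine ⟨1 / r0, by positivity, ?_⟩
    have := (hc _).1 hq0
    have e : l * (1 / r0) ^ 2 / 2 = l / (2 * r0 ^ 2) := by field_simp
    rw [e]; nlinarith [sq_nonneg w0]
  obtain ⟨η, hη, hG⟩ := h c0 hc hc0 hy
  set b := -(c0 + η) with hb
  have hb0 : 0 ≤ b := by linarith
  have hBfin : LM {p : ℝ × ℝ | s < Q (pt p.1 p.2 l)} ≠ ⊤ := by
    have : LM {p : ℝ × ℝ | s < Q (pt p.1 p.2 l)} ≤ LM {p : ℝ × ℝ | En Q (pt p.1 p.2 l) < e₀} := by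
      refine measure_mono_ae ?_
      filter_upwards [LM_pos] with p hp hp2
      have h2 : s < Q (pt p.1 p.2 l) := hp2
      rw [Q_pt hQ hp _ hl.le] at h2
      show En Q (pt p.1 p.2 l) < e₀
      rw [En_pt hp _ hl.le]
      exact hQ.Fsupp _ _ hl.le (hs.trans h2)
    rw [lam_lt hN hQ.e₀neg hl] at this
    exact ne_top_of_le_ne_top ENNReal.ofReal_ne_top this
  set D : ℝ × ℝ → ℝ := fun p => Dd (c0 - chi Q (1 / p.1) - l * (1 / p.1) ^ 2 / 2) (c0 - chi Q (1 / p.1) - l * (1 / p.1) ^ 2 / 2 - (chi f (1 / p.1) - chi Q (1 / p.1) - η)) p.2 with hD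
  have hDm : Measurable D := by
    have m1 : Measurable fun p : ℝ × ℝ => chi Q (1 / p.1) := (chi_cont hN).measurable.comp (by fun_prop)
    have m2 : Measurable fun p : ℝ × ℝ => chi f (1 / p.1) := (chi_cont hf).measurable.comp (by fun_prop)
    unfold D Dd
    refine Measurable.sub (by fun_prop) (Measurable.ite (measurableSet_lt (by fun_prop) (by fun_prop)) (by fun_prop) measurable_const)
  have hDint : ∫⁻ p, ENNReal.ofReal (D p) ∂LM ≤ G := by
    refine le_trans (le_of_eq ?_) hG
    rw [LM_lint _ hDm.ennreal_ofReal, inv_lint]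
    congr 1
    refine setLIntegral_congr_fun measurableSet_Ioi fun a ha => ?_
    have ha' : a ≠ 0 := ne_of_gt ha
    show ENNReal.ofReal (1 / a ^ 2) * (∫⁻ w, ENNReal.ofReal (Dd _ _ w)) = _
    simp only [one_div_one_div]
    rw [Dd_int]
  have hE : Measurable fun p : ℝ × ℝ => ENNReal.ofReal (En f (pt p.1 p.2 l) + Φ) :=
    (((En_meas hf).comp (pt_meas_rw l)).add measurable_const).ennreal_ofReal
  have hiA : Measurable fun p : ℝ × ℝ => (if s < rearr Q f (pt p.1 p.2 l) then (1:ℝ≥0∞) else 0) := Measurable.ite hSA measurable_const measurable_const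
  have hiB : Measurable fun p : ℝ × ℝ => (if s < Q (pt p.1 p.2 l) then (1:ℝ≥0∞) else 0) := Measurable.ite hSB measurable_const measurable_const
  have main : (∫⁻ p, ENNReal.ofReal (En f (pt p.1 p.2 l) + Φ) * (if s < Q (pt p.1 p.2 l) then 1 else 0) ∂LM)
      + ENNReal.ofReal Φ * LM {p : ℝ × ℝ | s < rearr Q f (pt p.1 p.2 l)} + ENNReal.ofReal b * LM {p : ℝ × ℝ | s < Q (pt p.1 p.2 l)}
    ≤ (∫⁻ p, ENNReal.ofReal (En f (pt p.1 p.2 l) + Φ) * (if s < rearr Q f (pt p.1 p.2 l) then 1 else 0) ∂LM)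
      + ENNReal.ofReal Φ * LM {p : ℝ × ℝ | s < Q (pt p.1 p.2 l)} + ENNReal.ofReal b * LM {p : ℝ × ℝ | s < rearr Q f (pt p.1 p.2 l)}
      + ∫⁻ p, ENNReal.ofReal (D p) ∂LM := by
    rw [← hone _ (fun p => s < rearr Q f (pt p.1 p.2 l)) hSA, ← hone _ (fun p => s < Q (pt p.1 p.2 l)) hSB,
      ← hone _ (fun p => s < rearr Q f (pt p.1 p.2 l)) hSA, ← hone _ (fun p => s < Q (pt p.1 p.2 l)) hSB]
    have k1 : Measurable fun p : ℝ × ℝ => ENNReal.ofReal (En f (pt p.1 p.2 l) + Φ) * (if s < Q (pt p.1 p.2 l) then (1:ℝ≥0∞) else 0) := hE.mul hiB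
    have k2 : Measurable fun p : ℝ × ℝ => ENNReal.ofReal (En f (pt p.1 p.2 l) + Φ) * (if s < rearr Q f (pt p.1 p.2 l) then (1:ℝ≥0∞) else 0) := hE.mul hiA
    rw [← lintegral_add_left k1, ← lintegral_add_right _ (hiB.const_mul _),
      ← lintegral_add_left k2, ← lintegral_add_right _ (hiA.const_mul _), ← lintegral_add_right _ hDm.ennreal_ofReal]
    refine lintegral_mono_ae ?_
    filter_upwards [LM_pos] with p hp
    have e : l * (1 / p.1) ^ 2 / 2 = l / (2 * p.1 ^ 2) := by field_simp
    have hEp := En_pt (f := f) hp p.2 hl.le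
    have h0 : 0 ≤ En f (pt p.1 p.2 l) + Φ := by
      rw [hEp]; have := hΦf (1 / p.1); have : 0 ≤ l / (2 * p.1 ^ 2) := by positivity
      nlinarith [sq_nonneg p.2]
    have hiff : (s < Q (pt p.1 p.2 l)) ↔ p.2 ^ 2 / 2 < c0 - chi Q (1 / p.1) - l * (1 / p.1) ^ 2 / 2 := by
      rw [Q_pt hQ hp _ hl.le, hc, e]; constructor <;> intro <;> linarith
    have := bath_pt hb0 hΦ h0 (t := c0 - chi Q (1 / p.1) - l * (1 / p.1) ^ 2 / 2 - (chi f (1 / p.1) - chi Q (1 / p.1) - η) - p.2 ^ 2 / 2)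
      (by rw [hEp, e, hb]; ring) (s < rearr Q f (pt p.1 p.2 l)) (s < Q (pt p.1 p.2 l))
    refine this.trans (le_of_eq ?_)
    congr 2
    simp only [hD, Dd, hiff]
  have hbB : ENNReal.ofReal b * LM {p : ℝ × ℝ | s < Q (pt p.1 p.2 l)} ≠ ⊤ := ENNReal.mul_ne_top ENNReal.ofReal_ne_top hBfin
  refine (ENNReal.add_le_add_iff_right hbB).1 (main.trans ?_)
  calc _ ≤ _ := add_le_add (add_le_add le_rfl (mul_le_mul_right hAB _)) hDint
    _ = _ := by ring

theorem bathtub (hQ : AssumptionA Q F e₀) {f : Phase → ℝ} (hf : Nice f) (G : ℝ × ℝ → ℝ≥0∞) (hGm : Measurable G) (hGfin : ∫⁻ q, G q ∂SL ≠ ⊤)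
    (h : ∀ s l, 0 < s → 0 < l → ∀ c0, (∀ e, s < F e l ↔ e < c0) → c0 ≤ e₀ → (∃ a > 0, 0 < c0 - chi Q a - l * a ^ 2 / 2) →
      ∃ η, c0 + η ≤ 0 ∧ ENNReal.ofReal (4 * π ^ 2) * ∫⁻ a in Ioi (0:ℝ), ENNReal.ofReal (1 / a ^ 2) *
        ENNReal.ofReal (Vf (c0 - chi Q a - l * a ^ 2 / 2) (chi f a - chi Q a - η)) ≤ G (s, l)) :
    (∫ z, En f z * Q z) - (∫ z, En f z * rearr Q f z) ≤ (∫⁻ q, G q ∂SL).toReal := by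
  obtain ⟨B, hB0, hB⟩ := A_bdd hQ
  have hN := A_nice hQ
  have hg := rearr_nice hf hN hB0 hB
  obtain ⟨Φ, hΦ, hΦf⟩ := chi_bdd hf
  have hE0 : ∀ z, 0 ≤ En f z + Φ := fun z => by
    have := hΦf (1 / ‖z.1‖); rw [En]; nlinarith [sq_nonneg ‖z.2‖]
  have hEm : Measurable fun z => En f z + Φ := (En_meas hf).add measurable_const
  have hEs : SphK fun z => En f z + Φ := by
    intro R hR z; simp only [En, LinearIsometryEquiv.norm_map]
  have hcs : SphK fun _ : Phase => Φ := fun _ _ _ => rfl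
  have key : (∫⁻ z, ENNReal.ofReal (En f z + Φ) * ENNReal.ofReal (Q z)) + (∫⁻ z, ENNReal.ofReal Φ * ENNReal.ofReal (rearr Q f z))
      ≤ (∫⁻ z, ENNReal.ofReal (En f z + Φ) * ENNReal.ofReal (rearr Q f z)) + (∫⁻ z, ENNReal.ofReal Φ * ENNReal.ofReal (Q z)) + ∫⁻ q, G q ∂SL := by
    rw [layer hEm hEs hN.meas hN.sph, layer (φ := fun _ => Φ) measurable_const hcs hg.meas hg.sph,
      layer hEm hEs hg.meas hg.sph, layer (φ := fun _ => Φ) measurable_const hcs hN.meas hN.sph]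
    rw [← lintegral_add_left ((ind_meas hEm hN.meas).lintegral_prod_right' (ν := LM)),
      ← lintegral_add_left ((ind_meas hEm hg.meas).lintegral_prod_right' (ν := LM)), ← lintegral_add_right _ hGm]
    rw [SL_eq]
    refine setLIntegral_mono_ae' (measurableSet_Ioi.prod measurableSet_Ioi) (ae_of_all _ fun q hq => ?_)
    exact orbit_ineq hQ hf hΦ hΦf hq.1 hq.2 _ (h q.1 q.2 hq.1 hq.2)
  have conv : ∀ {h : Phase → ℝ}, Nice h → Integrable (fun z => (En f z + Φ) * h z) ∧ ∫ z, (En f z + Φ) * h z = (∫ z, En f z * h z) + Φ * ∫ z, h z := by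
    intro h hh
    have e : (fun z => (En f z + Φ) * h z) = fun z => En f z * h z + Φ * h z := by funext z; ring
    have i1 := (En_int hf hh).1
    have i2 := hh.int.const_mul Φ
    rw [e]; exact ⟨i1.add i2, by rw [integral_add i1 i2, integral_const_mul]⟩
  have c1 : ∀ {h : Phase → ℝ}, Nice h → ∫⁻ z, ENNReal.ofReal (En f z + Φ) * ENNReal.ofReal (h z) = ENNReal.ofReal ((∫ z, En f z * h z) + Φ * ∫ z, h z) := by
    intro h hh
    rw [← (conv hh).2, ofReal_integral_eq_lintegral_ofReal (conv hh).1 (ae_of_all _ fun z => mul_nonneg (hE0 z) (hh.nn z))]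
    exact lintegral_congr fun z => (ENNReal.ofReal_mul (hE0 z)).symm
  have c1' : ∀ {h : Phase → ℝ}, Nice h → 0 ≤ (∫ z, En f z * h z) + Φ * ∫ z, h z := by
    intro h hh; rw [← (conv hh).2]; exact integral_nonneg fun z => mul_nonneg (hE0 z) (hh.nn z)
  have c2 : ∀ {h : Phase → ℝ}, Nice h → ∫⁻ z, ENNReal.ofReal Φ * ENNReal.ofReal (h z) = ENNReal.ofReal (Φ * ∫ z, h z) := by
    intro h hh
    rw [lintegral_const_mul' _ _ ENNReal.ofReal_ne_top, ENNReal.ofReal_mul hΦ, ofReal_integral_eq_lintegral_ofReal hh.int (ae_of_all _ hh.nn)]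
  have c2' : ∀ {h : Phase → ℝ}, Nice h → 0 ≤ Φ * ∫ z, h z := fun {h} hh => mul_nonneg hΦ (integral_nonneg hh.nn)
  rw [c1 hN, c1 hg, c2 hN, c2 hg, ← ENNReal.ofReal_toReal hGfin, ← ENNReal.ofReal_add (c1' hN) (c2' hg),
    ← ENNReal.ofReal_add (c1' hg) (c2' hN), ← ENNReal.ofReal_add (add_nonneg (c1' hg) (c2' hN)) ENNReal.toReal_nonneg,
    ENNReal.ofReal_le_ofReal_iff (add_nonneg (add_nonneg (c1' hg) (c2' hN)) ENNReal.toReal_nonneg)] at key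
  linarith

end M11

section M12

def Uw (x : ℝ) : ℝ := 1 / (√x * √√x)

lemma Uw_nonneg (x : ℝ) : 0 ≤ Uw x := by unfold Uw; positivity

lemma Uw_meas : Measurable Uw := by unfold Uw; fun_prop

lemma Uw_int_left {a1 a2 : ℝ} (h : a1 < a2) :
    ∫⁻ a in Ioo a1 a2, ENNReal.ofReal (Uw (a - a1)) = ENNReal.ofReal (4 * √√(a2 - a1)) := by
  rw [lintegral_ftc (g := fun a => 4 * √√(a - a1)) h.le (by fun_prop) ?_ (fun _ _ => Uw_nonneg _)]
  · simp
  · intro a ha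
    have h0 : a - a1 ≠ 0 := (sub_pos.2 ha.1).ne'
    have hs : √(a - a1) ≠ 0 := (Real.sqrt_pos.2 (sub_pos.2 ha.1)).ne'
    refine (((((hasDerivAt_id a).sub_const a1).sqrt h0).sqrt hs).const_mul 4).congr_deriv ?_
    simp only [Uw, id]
    have : √√(a - a1) ≠ 0 := (Real.sqrt_pos.2 (Real.sqrt_pos.2 (sub_pos.2 ha.1))).ne'
    field_simp; norm_num

lemma Uw_int_right {a1 a2 : ℝ} (h : a1 < a2) :
    ∫⁻ a in Ioo a1 a2, ENNReal.ofReal (Uw (a2 - a)) = ENNReal.ofReal (4 * √√(a2 - a1)) := by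
  rw [lintegral_ftc (g := fun a => -(4 * √√(a2 - a))) h.le (by fun_prop) ?_ (fun _ _ => Uw_nonneg _)]
  · simp
  · intro a ha
    have h0 : a2 - a ≠ 0 := (sub_pos.2 ha.2).ne'
    have hs : √(a2 - a) ≠ 0 := (Real.sqrt_pos.2 (sub_pos.2 ha.2)).ne'
    refine (((((hasDerivAt_id a).const_sub a2).sqrt h0).sqrt hs).const_mul 4).neg.congr_deriv ?_
    simp only [Uw, id]
    have : √√(a2 - a) ≠ 0 := (Real.sqrt_pos.2 (Real.sqrt_pos.2 (sub_pos.2 ha.2))).ne'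
    field_simp; norm_num

lemma Vf_pos {y k : ℝ} (hy : 0 < y) (hk : k ≤ y) :
    Vf y k = (2 * √2 / 3) * ((√(y - k) - √y) ^ 2 * (2 * √(y - k) + √y)) := by
  have h1 := Real.sq_sqrt hy.le
  have h2 := Real.sq_sqrt (sub_nonneg.2 hk)
  have hk' : k = √y ^ 2 - √(y - k) ^ 2 := by rw [h1, h2]; ring
  rw [Vf, max_eq_left (sub_nonneg.2 hk), max_eq_left hy.le]
  linear_combination (2 * √2 * √y) * hk'

lemma Vf_big {y k : ℝ} (hy : 0 < y) (hk : y ≤ k) :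
    Vf y k = -(4 * √2 / 3) * √y ^ 3 + 2 * √2 * k * √y := by
  rw [Vf, max_eq_right (sub_nonpos.2 hk), max_eq_left hy.le]; simp

lemma Vf_neg {y k : ℝ} (hy : y ≤ 0) : Vf y k = (4 * √2 / 3) * √(max (y - k) 0) ^ 3 := by
  rw [Vf, max_eq_right hy]; simp

lemma Vf_le1 {y k : ℝ} (hy : 0 < y) : Vf y k ≤ √2 * (k ^ 2 / √y) := by
  have hq := Real.sqrt_pos.2 hy
  have h1 := Real.sq_sqrt hy.le
  have s2 : 0 < √2 := by positivity
  rw [← mul_div_assoc, le_div_iff₀ hq]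
  rcases le_total k y with hk | hk
  · have h2 := Real.sq_sqrt (sub_nonneg.2 hk)
    have hk' : k = √y ^ 2 - √(y - k) ^ 2 := by rw [h1, h2]; ring
    rw [Vf_pos hy hk]
    have hp := Real.sqrt_nonneg (y - k)
    set p := √(y - k)
    set q := √y
    rw [hk', show (2 * √2 / 3) * ((p - q) ^ 2 * (2 * p + q)) * q = √2 * ((2 / 3) * ((p - q) ^ 2 * (2 * p + q) * q)) by ring]
    refine mul_le_mul_of_nonneg_left ?_ s2.le
    have : 0 ≤ (p - q) ^ 2 * (p ^ 2 + (2 / 3) * p * q + q ^ 2 / 3) := by positivity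
    nlinarith
  · rw [Vf_big hy hk]
    have : (-(4 * √2 / 3) * √y ^ 3 + 2 * √2 * k * √y) * √y = √2 * (-(4 / 3) * (√y ^ 2) ^ 2 + 2 * k * √y ^ 2) := by ring
    rw [this, h1]
    refine mul_le_mul_of_nonneg_left ?_ s2.le
    nlinarith [sq_nonneg (k - y), sq_nonneg y]

lemma Vf_le2 {y k : ℝ} (hk : 0 ≤ k) : Vf y k ≤ 2 * √2 * (k * √k) := by
  have s2 : 0 < √2 := by positivity
  rcases le_or_gt y 0 with hy | hy
  · rw [Vf_neg hy, max_eq_right (by linarith)]; simp; positivity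
  · rcases le_total k y with hky | hky
    · refine (Vf_le1 hy).trans ?_
      have hq := Real.sqrt_pos.2 hy
      have : k ^ 2 / √y ≤ k * √k := by
        rw [div_le_iff₀ hq, pow_two, mul_assoc]
        refine mul_le_mul_of_nonneg_left ?_ hk
        calc k = √k * √k := (Real.mul_self_sqrt hk).symm
          _ ≤ √k * √y := by gcongr
      have h3 : 0 ≤ k * √k := by positivity
      nlinarith
    · rw [Vf_big hy hky]
      have : √y ≤ √k := Real.sqrt_le_sqrt hky
      have h3 : k * √y ≤ k * √k := by gcongr
      have h4 : 0 ≤ √2 * √y ^ 3 := by positivity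
      nlinarith

lemma Vf_sharp {y k : ℝ} (hy : 0 < y) : Vf y k ≤ (√2 / 2) * (k ^ 2 / √y) + 2 * √2 * (k ^ 2 * √√|k| * Uw y) := by
  have hq := Real.sqrt_pos.2 hy
  have hr := Real.sqrt_pos.2 hq
  have h1 := Real.sq_sqrt hy.le
  have s2 : 0 < √2 := by positivity
  have hU : Uw y = 1 / (√y * √√y) := rfl
  have hr2 := Real.sq_sqrt hq.le
  rcases le_total y k with hk | hk
  · have hk0 : 0 < k := hy.trans_le hk
    rw [Vf_big hy hk, abs_of_pos hk0]
    have e1 : k * √y ≤ k ^ 2 * √√k * Uw y := by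
      rw [hU, mul_one_div, le_div_iff₀ (by positivity)]
      have e2 : √√y ≤ √√k := Real.sqrt_le_sqrt (Real.sqrt_le_sqrt hk)
      calc k * √y * (√y * √√y) = k * (√y ^ 2 * √√y) := by ring
        _ ≤ k * (k * √√k) := by rw [h1]; gcongr
        _ = _ := by ring
    have : 0 ≤ √2 * √y ^ 3 := by positivity
    have : 0 ≤ (√2 / 2) * (k ^ 2 / √y) := by positivity
    nlinarith
  · have h2 := Real.sq_sqrt (sub_nonneg.2 hk)
    have hk' : k = √y ^ 2 - √(y - k) ^ 2 := by rw [h1, h2]; ring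
    have hE : Vf y k - (√2 / 2) * (k ^ 2 / √y) = (√2 / 6) * ((√y - √(y - k)) ^ 3 * (√y + 3 * √(y - k)) / √y) := by
      rw [Vf_pos hy hk]
      have : k ^ 2 = (√y ^ 2 - √(y - k) ^ 2) ^ 2 := by rw [← hk']
      rw [this]; field_simp; ring
    have hR : 0 ≤ k ^ 2 * √√|k| * Uw y := by have := Uw_nonneg y; positivity
    suffices h : (√2 / 6) * ((√y - √(y - k)) ^ 3 * (√y + 3 * √(y - k)) / √y) ≤ 2 * √2 * (k ^ 2 * √√|k| * Uw y) by linarith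
    have hp := Real.sqrt_nonneg (y - k)
    rcases le_total (√y) (√(y - k)) with hpq | hpq
    · have : (√y - √(y - k)) ^ 3 * (√y + 3 * √(y - k)) / √y ≤ 0 := by
        refine div_nonpos_of_nonpos_of_nonneg (mul_nonpos_of_nonpos_of_nonneg ?_ (by positivity)) hq.le
        exact (Odd.pow_nonpos_iff (by decide)).2 (by linarith)
      nlinarith
    · have hk0 : 0 ≤ k := by rw [hk']; nlinarith
      rw [abs_of_nonneg hk0]
      set p := √(y - k)
      set q := √y
      have ht : 0 ≤ q - p := by linarith
      have e1 : (q - p) ^ 3 * (q + 3 * p) / q ≤ 4 * (q - p) ^ 3 := by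
        rw [div_le_iff₀ hq]
        have : 0 ≤ (q - p) ^ 3 := by positivity
        nlinarith
      have e2 : (q - p) ^ 3 ≤ k ^ 2 * √√k * Uw y := by
        rw [hU, mul_one_div, le_div_iff₀ (by positivity)]
        have hv := Real.sq_sqrt ht
        have hv0 := Real.sqrt_nonneg (q - p)
        have hvr : √(q - p) ≤ √q := Real.sqrt_le_sqrt (by linarith)
        have hkt : (q - p) * q ≤ k := by rw [hk']; nlinarith
        have hm : √(q - p) ≤ √√k := by
          refine Real.sqrt_le_sqrt (Real.le_sqrt_of_sq_le ?_)
          nlinarith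
        calc (q - p) ^ 3 * (q * √q) = (q - p) ^ 2 * q * ((q - p) * √q) := by ring
          _ ≤ (q - p) ^ 2 * q * (q * √(q - p)) := by
              refine mul_le_mul_of_nonneg_left ?_ (by positivity)
              set v := √(q - p)
              set r := √q
              rw [← hv, ← hr2]
              have : 0 ≤ v * r * (r - v) := mul_nonneg (by positivity) (by linarith)
              nlinarith
          _ = ((q - p) * q) ^ 2 * √(q - p) := by ring
          _ ≤ k ^ 2 * √√k := by gcongr
      calc _ ≤ √2 / 6 * (4 * (k ^ 2 * √√k * Uw y)) := by
            refine mul_le_mul_of_nonneg_left ?_ (by positivity); linarith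
        _ ≤ _ := by have : 0 ≤ k ^ 2 * √√k * Uw y := by have := Uw_nonneg y; positivity
                    nlinarith

end M12

section M13

structure Orb (y : ℝ → ℝ) (l a1 a2 : ℝ) : Prop where
  l0 : 0 < l
  p1 : 0 < a1
  lt : a1 < a2
  cont : Continuous y
  lo : ∀ a ∈ Icc a1 a2, l / 2 * ((a - a1) * (a2 - a)) ≤ y a
  hi : ∀ a, a ≤ a1 ∨ a2 ≤ a → y a ≤ l / 2 * ((a - a1) * (a2 - a))

lemma Uw_mul {u v : ℝ} (hu : 0 ≤ u) : Uw (u * v) = Uw u * Uw v := by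
  unfold Uw
  rw [Real.sqrt_mul hu, Real.sqrt_mul (Real.sqrt_nonneg u)]
  rw [div_mul_div_comm]; congr 1 <;> ring

lemma Uw_anti {u v : ℝ} (hu : 0 < u) (h : u ≤ v) : Uw v ≤ Uw u := by
  unfold Uw
  have h1 := Real.sqrt_pos.2 hu
  have h2 := Real.sqrt_pos.2 h1
  have := Real.sqrt_le_sqrt h
  exact one_div_le_one_div_of_le (by positivity) (mul_le_mul this (Real.sqrt_le_sqrt this) h2.le (by positivity))

lemma root_ineq {x z : ℝ} (hx : 0 < x) (hz : 0 < z) :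
    1 / (√x * √z) ≤ 1 / √√(x + z) * (Uw x + Uw z) := by
  have hX := Real.sqrt_pos.2 (Real.sqrt_pos.2 hx)
  have hZ := Real.sqrt_pos.2 (Real.sqrt_pos.2 hz)
  have hW := Real.sqrt_pos.2 (Real.sqrt_pos.2 (add_pos hx hz))
  have eX := Real.sq_sqrt (Real.sqrt_nonneg x)
  have eZ := Real.sq_sqrt (Real.sqrt_nonneg z)
  have eX' := Real.sq_sqrt hx.le
  have eZ' := Real.sq_sqrt hz.le
  unfold Uw
  have hWle : √√(x + z) ≤ √√x + √√z := by
    rw [Real.sqrt_le_left (by positivity), Real.sqrt_le_left (by positivity)]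
    have fX : x = (√√x ^ 2) ^ 2 := by rw [eX, eX']
    have fZ : z = (√√z ^ 2) ^ 2 := by rw [eZ, eZ']
    set X := √√x
    set Z := √√z
    have : 0 ≤ X * Z := by positivity
    have : 0 ≤ X ^ 2 * Z ^ 2 := by positivity
    have : 0 ≤ X ^ 3 * Z := by positivity
    have : 0 ≤ X * Z ^ 3 := by positivity
    rw [fX, fZ]
    nlinarith
  set X := √√x
  set Z := √√z
  rw [← eX, ← eZ]
  set W := √√(x + z)
  rw [one_div_mul_eq_div, le_div_iff₀ hW, div_add_div _ _ (by positivity) (by positivity), one_div_mul_eq_div,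
    div_le_div_iff₀ (by positivity) (by positivity)]
  have h1 : W * (X * Z) ≤ X ^ 3 + Z ^ 3 := by
    have : W * (X * Z) ≤ (X + Z) * (X * Z) := by gcongr
    have : 0 ≤ (X + Z) * (X - Z) ^ 2 := by positivity
    nlinarith
  have h2 : 0 ≤ X ^ 2 * Z ^ 2 := by positivity
  nlinarith

lemma Uw_sum_int {a1 a2 c : ℝ} (h : a1 < a2) (hc : 0 ≤ c) :
    ∫⁻ a in Ioo a1 a2, ENNReal.ofReal (c * (Uw (a - a1) + Uw (a2 - a))) = ENNReal.ofReal (c * (8 * √√(a2 - a1))) := by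
  have e : ∀ a, ENNReal.ofReal (c * (Uw (a - a1) + Uw (a2 - a))) = ENNReal.ofReal c * (ENNReal.ofReal (Uw (a - a1)) + ENNReal.ofReal (Uw (a2 - a))) := fun a => by
    rw [ENNReal.ofReal_mul hc, ENNReal.ofReal_add (Uw_nonneg _) (Uw_nonneg _)]
  simp_rw [e]
  rw [lintegral_const_mul' _ _ ENNReal.ofReal_ne_top, lintegral_add_left (f := fun a => ENNReal.ofReal (Uw (a - a1))) (Uw_meas.comp (measurable_id.sub_const a1)).ennreal_ofReal,
    Uw_int_left h, Uw_int_right h, ← ENNReal.ofReal_add (by positivity) (by positivity), ← ENNReal.ofReal_mul hc]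
  congr 1; ring

lemma inv_sq_int {a1 a2 c : ℝ} (h1 : 0 < a1) (h : a1 < a2) (hc : 0 ≤ c) :
    ∫⁻ a in Ioo a1 a2, ENNReal.ofReal (c * (1 / a ^ 2)) = ENNReal.ofReal (c * (1 / a1 - 1 / a2)) := by
  rw [lintegral_ftc (g := fun a => -(c * a⁻¹)) h.le ?_ ?_ (fun a _ => by positivity)]
  · congr 1; simp only [one_div]; ring
  · refine ContinuousOn.neg (ContinuousOn.mul continuousOn_const (continuousOn_inv₀.mono fun a ha => ?_))
    exact (h1.trans_le ha.1).ne'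
  · intro a ha
    refine (((hasDerivAt_inv (h1.trans ha.1).ne').const_mul c).neg).congr_deriv ?_
    simp

namespace Orb
variable {y : ℝ → ℝ} {l a1 a2 : ℝ}

lemma sqrt_lo (o : Orb y l a1 a2) {a : ℝ} (ha : a ∈ Ioo a1 a2) :
    0 < y a ∧ 1 / √(y a) ≤ (√2 / √l) * (1 / (√(a - a1) * √(a2 - a))) := by
  have hx := sub_pos.2 ha.1
  have hz := sub_pos.2 ha.2
  have h := o.lo a ⟨ha.1.le, ha.2.le⟩
  have hl := o.l0
  have hpos : 0 < l / 2 * ((a - a1) * (a2 - a)) := by positivity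
  refine ⟨hpos.trans_le h, ?_⟩
  have h2 := Real.sqrt_le_sqrt h
  rw [Real.sqrt_mul (by positivity), Real.sqrt_mul hx.le, Real.sqrt_div hl.le] at h2
  have : (√2 / √l) * (1 / (√(a - a1) * √(a2 - a))) = 1 / (√l / √2 * (√(a - a1) * √(a2 - a))) := by
    field_simp
  rw [this]
  have := Real.sqrt_pos.2 hx
  have := Real.sqrt_pos.2 hz
  have := Real.sqrt_pos.2 hl
  exact one_div_le_one_div_of_le (by positivity) h2

lemma bad_w (o : Orb y l a1 a2) {A0 : ℝ} (hA : 0 < A0) (h1 : A0 ≤ a1) {a : ℝ} (ha : a ∈ Ioo a1 a2) :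
    1 / a ^ 2 * (a2 / √(y a)) ≤ (√2 / √l * ((1 + 1 / A0) / A0) * (1 / √√(a2 - a1) + √(a2 - a1))) * (Uw (a - a1) + Uw (a2 - a)) := by
  have hx := sub_pos.2 ha.1
  have hz := sub_pos.2 ha.2
  have hap : 0 < a := o.p1.trans ha.1
  have haA : A0 ≤ a := h1.trans ha.1.le
  have h2 := (o.sqrt_lo ha).2
  have hsx := Real.sqrt_pos.2 hx
  have hsz := Real.sqrt_pos.2 hz
  have hssx := Real.sqrt_pos.2 hsx
  have hD : (a - a1) + (a2 - a) = a2 - a1 := by ring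
  have hr := root_ineq hx hz
  rw [hD] at hr
  have hUx := Uw_nonneg (a - a1)
  have hUz := Uw_nonneg (a2 - a)
  have ha2 : 0 < a2 := hap.trans ha.2
  have step : a2 / a ^ 2 * (1 / (√(a - a1) * √(a2 - a))) ≤ ((1 + 1 / A0) / A0) * ((1 / √√(a2 - a1) + √(a2 - a1)) * (Uw (a - a1) + Uw (a2 - a))) := by
    have e1 : a2 / a ^ 2 * (1 / (√(a - a1) * √(a2 - a))) = 1 / a * (1 / (√(a - a1) * √(a2 - a))) + √(a2 - a) / √(a - a1) * (1 / a ^ 2) := by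
      have : √(a2 - a) ^ 2 = a2 - a := Real.sq_sqrt hz.le
      field_simp
      rw [this]; ring
    have c1 : 1 / a ≤ (1 + 1 / A0) / A0 := by
      calc 1 / a ≤ 1 / A0 := one_div_le_one_div_of_le hA haA
        _ ≤ _ := by gcongr; have : 0 ≤ 1 / A0 := by positivity
                    linarith
    have c2 : 1 / a ^ 2 ≤ ((1 + 1 / A0) / A0) * (1 / √√(a - a1)) := by
      rw [mul_one_div, div_le_div_iff₀ (by positivity) hssx, one_mul]
      have hX4 : √√(a - a1) ^ 4 = a - a1 := by
        rw [show √√(a - a1) ^ 4 = (√√(a - a1) ^ 2) ^ 2 by ring, Real.sq_sqrt hsx.le, Real.sq_sqrt hx.le]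
      have hX : √√(a - a1) ≤ 1 + √√(a - a1) ^ 4 := by nlinarith [sq_nonneg (√√(a - a1) ^ 2 - 1 / 2), sq_nonneg (√√(a - a1) - 1 / 2)]
      rw [hX4] at hX
      have g1 : 1 ≤ a / A0 := by rw [le_div_iff₀ hA]; linarith
      calc √√(a - a1) ≤ a / A0 + a := by linarith [o.p1]
        _ = (a / A0 + a) * 1 := by ring
        _ ≤ (a / A0 + a) * (a / A0) := by gcongr
        _ = _ := by field_simp; ring
    have c3 : √(a2 - a) / √(a - a1) * (1 / a ^ 2) ≤ ((1 + 1 / A0) / A0) * (√(a2 - a1) * Uw (a - a1)) := by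
      calc _ ≤ √(a2 - a1) / √(a - a1) * (((1 + 1 / A0) / A0) * (1 / √√(a - a1))) := by
            gcongr; linarith [ha.1]
        _ = _ := by unfold Uw; field_simp
    rw [e1]
    calc _ ≤ ((1 + 1 / A0) / A0) * (1 / √√(a2 - a1) * (Uw (a - a1) + Uw (a2 - a))) + ((1 + 1 / A0) / A0) * (√(a2 - a1) * Uw (a - a1)) := by
          refine add_le_add (mul_le_mul c1 hr (by positivity) (by positivity)) c3
      _ ≤ _ := by
          have : 0 ≤ ((1 + 1 / A0) / A0) * (√(a2 - a1) * Uw (a2 - a)) := by positivity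
          nlinarith
  calc 1 / a ^ 2 * (a2 / √(y a)) = a2 / a ^ 2 * (1 / √(y a)) := by ring
    _ ≤ a2 / a ^ 2 * ((√2 / √l) * (1 / (√(a - a1) * √(a2 - a)))) := by gcongr
    _ = (√2 / √l) * (a2 / a ^ 2 * (1 / (√(a - a1) * √(a2 - a)))) := by ring
    _ ≤ (√2 / √l) * (((1 + 1 / A0) / A0) * ((1 / √√(a2 - a1) + √(a2 - a1)) * (Uw (a - a1) + Uw (a2 - a)))) := by gcongr
    _ = _ := by ring

theorem bad_cost (o : Orb y l a1 a2) {A0 d : ℝ} (hA : 0 < A0) (h1 : A0 ≤ a1) (hd : 0 ≤ d) {H : ℝ → ℝ}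
    (hH0 : ∀ a, 0 < a → |H a| ≤ d * √a) (hH : ∀ a b, 0 < a → 0 < b → |H a - H b| ≤ d * √|a - b|) :
    ∃ η ≤ 0, ∫⁻ a in Ioi (0:ℝ), ENNReal.ofReal (1 / a ^ 2) * ENNReal.ofReal (Vf (y a) (H a - η))
      ≤ ENNReal.ofReal (256 * ((1 + 1 / A0) / A0) * d ^ 2 * (1 / √l) * (1 + √(a2 - a1) * √√(a2 - a1))) := by
  have hl := o.l0
  have hsl := Real.sqrt_pos.2 hl
  have ha2 : 0 < a2 := o.p1.trans o.lt
  have hD : 0 < a2 - a1 := sub_pos.2 o.lt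
  have hsD := Real.sqrt_pos.2 (Real.sqrt_pos.2 hD)
  obtain ⟨t, ht0, ht⟩ : ∃ t : ℝ, 0 ≤ t ∧ t ^ 3 = 2 * d / l :=
    ⟨(2 * d / l) ^ ((1:ℝ) / 3), by positivity, by rw [← Real.rpow_natCast, ← Real.rpow_mul (by positivity)]; norm_num⟩
  have hκ0 : 0 ≤ d * t := by positivity
  refine ⟨-(d * √a2 + d * t), by have : 0 ≤ d * √a2 := by positivity
                                 linarith, ?_⟩
  set η := -(d * √a2 + d * t) with hη
  -- outside
  have hout : ∀ a, 0 < a → a ∉ Ioo a1 a2 → Vf (y a) (H a - η) ≤ 0 := by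
    intro a ha hna
    have hor : a ≤ a1 ∨ a2 ≤ a := by
      by_contra hcon; push Not at hcon; exact hna ⟨hcon.1, hcon.2⟩
    have hy := o.hi a hor
    have hprod : (a - a1) * (a2 - a) ≤ 0 := by
      rcases hor with h | h
      · exact mul_nonpos_of_nonpos_of_nonneg (by linarith) (by linarith [o.lt])
      · exact mul_nonpos_of_nonneg_of_nonpos (by linarith [o.lt]) (by linarith)
    have hy0 : y a ≤ 0 := hy.trans (mul_nonpos_of_nonneg_of_nonpos (by positivity) hprod)
    rw [Vf_neg hy0]
    have : y a - (H a - η) ≤ 0 := by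
      rcases hor with h | h
      · have := (abs_le.1 (hH0 a ha)).1
        have h3 : d * √a ≤ d * √a2 := by gcongr; linarith [o.lt]
        linarith
      · have e1 := (abs_le.1 (hH a a2 ha ha2)).1
        have e2 := (abs_le.1 (hH0 a2 ha2)).1
        rw [abs_of_nonneg (by linarith)] at e1
        have hx := Real.sqrt_nonneg (a - a2)
        have hx2 := Real.sq_sqrt (sub_nonneg.2 h)
        set v := √(a - a2)
        have hq : l / 2 * ((a - a1) * (a2 - a)) ≤ -(l / 2 * v ^ 4) := by
          have : v ^ 4 ≤ (a - a1) * (a - a2) := by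
            rw [show v ^ 4 = v ^ 2 * v ^ 2 by ring, hx2]
            exact mul_le_mul_of_nonneg_right (by linarith [o.lt]) (by linarith)
          nlinarith
        rcases le_total v t with hv | hv
        · have : d * v ≤ d * t := by gcongr
          have : 0 ≤ l / 2 * v ^ 4 := by positivity
          linarith
        · have h3 : 2 * d / l ≤ v ^ 3 := by rw [← ht]; gcongr
          rw [div_le_iff₀ hl] at h3
          have : d * v ≤ l / 2 * v ^ 4 := by nlinarith
          linarith
    rw [max_eq_right this]; simp
  have hk : ∀ a ∈ Ioo a1 a2, 0 ≤ H a - η ∧ H a - η ≤ 2 * (d * √a2) + d * t := by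
    intro a ha
    have := abs_le.1 (hH0 a (o.p1.trans ha.1))
    have h3 : d * √a ≤ d * √a2 := by gcongr; exact ha.2.le
    constructor <;> linarith [this.1, this.2]
  have hred : ∀ Z : ℝ → ℝ, (∀ a ∈ Ioo a1 a2, 1 / a ^ 2 * Vf (y a) (H a - η) ≤ Z a) →
      ∫⁻ a in Ioi (0:ℝ), ENNReal.ofReal (1 / a ^ 2) * ENNReal.ofReal (Vf (y a) (H a - η)) ≤ ∫⁻ a in Ioo a1 a2, ENNReal.ofReal (Z a) := by
    intro Z hZ
    rw [← lintegral_indicator measurableSet_Ioo]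
    refine le_trans (setLIntegral_mono' (g := (Ioo a1 a2).indicator fun a => ENNReal.ofReal (Z a)) measurableSet_Ioi fun a ha => ?_) (setLIntegral_le_lintegral _ _)
    by_cases h : a ∈ Ioo a1 a2
    · rw [indicator_of_mem h, ← ENNReal.ofReal_mul (by positivity)]
      exact ENNReal.ofReal_le_ofReal (hZ a h)
    · rw [ENNReal.ofReal_of_nonpos (hout a ha h)]; simp
  rcases le_total (d * t) (2 * (d * √a2)) with hc | hc
  · refine (hred (fun a => (16 * √2 * d ^ 2 * (√2 / √l * ((1 + 1 / A0) / A0) * (1 / √√(a2 - a1) + √(a2 - a1)))) * (Uw (a - a1) + Uw (a2 - a))) fun a ha => ?_).trans ?_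
    · have hy := (o.sqrt_lo ha).1
      have hsy := Real.sqrt_pos.2 hy
      have hw := o.bad_w hA h1 ha
      have ha0 : 0 < a := o.p1.trans ha.1
      obtain ⟨k0, k1⟩ := hk a ha
      calc 1 / a ^ 2 * Vf (y a) (H a - η) ≤ 1 / a ^ 2 * (√2 * ((H a - η) ^ 2 / √(y a))) := by gcongr; exact Vf_le1 hy
        _ ≤ 1 / a ^ 2 * (√2 * ((4 * (d * √a2)) ^ 2 / √(y a))) := by gcongr; linarith
        _ = 16 * √2 * d ^ 2 * (1 / a ^ 2 * (a2 / √(y a))) := by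
            rw [show (4 * (d * √a2)) ^ 2 = 16 * d ^ 2 * √a2 ^ 2 by ring, Real.sq_sqrt ha2.le]; ring
        _ ≤ 16 * √2 * d ^ 2 * ((√2 / √l * ((1 + 1 / A0) / A0) * (1 / √√(a2 - a1) + √(a2 - a1))) * (Uw (a - a1) + Uw (a2 - a))) := by gcongr
        _ = _ := by ring
    · rw [Uw_sum_int o.lt (by positivity)]
      apply ENNReal.ofReal_le_ofReal
      apply le_of_eq
      have h22 : √2 * √2 = 2 := Real.mul_self_sqrt (by norm_num)
      have : (1 / √√(a2 - a1) + √(a2 - a1)) * √√(a2 - a1) = 1 + √(a2 - a1) * √√(a2 - a1) := by field_simp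
      rw [← this]
      linear_combination (128 * d ^ 2 * (1 / √l) * ((1 + 1 / A0) / A0) * ((1 / √√(a2 - a1) + √(a2 - a1)) * √√(a2 - a1))) * h22
  · refine (hred (fun a => (8 * √2 * d ^ 2 / √l) * (1 / a ^ 2)) fun a ha => ?_).trans ?_
    · obtain ⟨k0, k1⟩ := hk a ha
      have ha0 : 0 < a := o.p1.trans ha.1
      have hkk : H a - η ≤ 2 * (d * t) := by linarith
      have : Vf (y a) (H a - η) ≤ 8 * √2 * d ^ 2 / √l := by
        refine (Vf_le2 k0).trans ?_
        have e1 : (H a - η) * √(H a - η) ≤ (2 * (d * t)) * √(2 * (d * t)) := by gcongr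
        have e2 : (2 * (d * t)) * √(2 * (d * t)) = 4 * (d ^ 2 / √l) := by
          have : 0 ≤ (2 * (d * t)) * √(2 * (d * t)) := by positivity
          rw [← Real.sqrt_sq this, mul_pow, Real.sq_sqrt (by positivity)]
          rw [show (2 * (d * t)) ^ 2 * (2 * (d * t)) = 8 * d ^ 3 * t ^ 3 by ring, ht]
          rw [show 8 * d ^ 3 * (2 * d / l) = (4 * d ^ 2) ^ 2 / l by ring, Real.sqrt_div (by positivity), Real.sqrt_sq (by positivity)]
          ring
        rw [e2] at e1
        calc _ ≤ 2 * √2 * (4 * (d ^ 2 / √l)) := by gcongr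
          _ = _ := by ring
      calc _ ≤ 1 / a ^ 2 * (8 * √2 * d ^ 2 / √l) := by gcongr
        _ = _ := by ring
    · rw [inv_sq_int o.p1 o.lt (by positivity)]
      apply ENNReal.ofReal_le_ofReal
      have g1 : 1 / a1 - 1 / a2 ≤ (1 + 1 / A0) / A0 := by
        have : 0 ≤ 1 / a2 := by positivity
        have : 1 / a1 ≤ 1 / A0 := one_div_le_one_div_of_le hA h1
        have : 1 / A0 ≤ (1 + 1 / A0) / A0 := by
          gcongr; have : 0 ≤ 1 / A0 := by positivity
          linarith
        linarith
      have g2 : √2 ≤ 2 := by rw [Real.sqrt_le_left (by norm_num)]; norm_num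
      have g3 : 1 ≤ 1 + √(a2 - a1) * √√(a2 - a1) := by have : 0 ≤ √(a2 - a1) * √√(a2 - a1) := by positivity
                                                       linarith
      calc (8 * √2 * d ^ 2 / √l) * (1 / a1 - 1 / a2) ≤ (8 * 2 * d ^ 2 / √l) * ((1 + 1 / A0) / A0) := by
            refine mul_le_mul (by gcongr) g1 ?_ (by positivity)
            exact sub_nonneg.2 (one_div_le_one_div_of_le o.p1 o.lt.le)
        _ = 16 * ((1 + 1 / A0) / A0) * d ^ 2 * (1 / √l) * 1 := by ring
        _ ≤ _ := by gcongr; norm_num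

end Orb

end M13

section M14

set_option maxHeartbeats 1600000 in
theorem good_cost {A0 A2 β : ℝ} (hA : 0 < A0) (hA2 : A0 ≤ A2) (hβ : 0 < β) :
    ∃ C, 0 ≤ C ∧ ∀ (y H : ℝ → ℝ) (l a1 a2 d η : ℝ), Orb y l a1 a2 → A0 ≤ a1 → a2 ≤ A2 → β ≤ l → β ≤ a2 - a1 →
      0 ≤ d → d ≤ 1 → 2 * d / (β * √β) ≤ A0 / 2 →
      (∀ a ∈ Icc a1 a2, |H a - η| ≤ d * √(a2 - a1)) →
      (∀ a, a2 ≤ a → |H a - η| ≤ d * √(a - a1)) → (∀ a, 0 < a → a ≤ a1 → |H a - η| ≤ d * √(a2 - a)) →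
      ∫⁻ a in Ioi (0:ℝ), ENNReal.ofReal (1 / a ^ 2) * ENNReal.ofReal (Vf (y a) (H a - η))
      ≤ (∫⁻ a in Ioo a1 a2, ENNReal.ofReal (√2 / 2 * ((H a - η) ^ 2 / (a ^ 2 * √(y a)))))
        + ENNReal.ofReal (C * (d ^ 2 * √√d)) := by
  set K := √A2 with hK
  have hK0 : 0 ≤ K := Real.sqrt_nonneg _
  set c1 := 1 / A0 ^ 2 * (2 * √2 * (K ^ 2 * √√K * (Uw (β / 2) * Uw (β / 2)))) with hc1
  have hUb := Uw_nonneg (β / 2)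
  have hc10 : 0 ≤ c1 := by positivity
  set M := √(√(2 * A2)) ^ 3 with hM
  have hM0 : 0 ≤ M := by positivity
  set c2 := 4 / A0 ^ 2 * ((4 * √2 / 3) * M) with hc2
  have hc20 : 0 ≤ c2 := by positivity
  have hsβ := Real.sqrt_pos.2 hβ
  refine ⟨c1 * (8 * √√A2) + c2 * (2 * (2 / (β * √β))), by positivity, ?_⟩
  intro y H l a1 a2 d η o h1 h2 hl hD hd hd1 hw hin hout2 hout1
  set w := 2 * d / (β * √β) with hwdef
  have hw0 : 0 ≤ w := by positivity
  have ha2 : 0 < a2 := o.p1.trans o.lt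
  set S : Set ℝ := Icc (a1 - w) a1 ∪ Icc a2 (a2 + w) with hS
  have hSm : MeasurableSet S := measurableSet_Icc.union measurableSet_Icc
  have hsd := Real.sqrt_nonneg d
  -- outside bound
  have hO : ∀ a, 0 < a → a ∉ Ioo a1 a2 → 1 / a ^ 2 * Vf (y a) (H a - η) ≤ S.indicator (fun _ => c2 * (d * √d)) a := by
    intro a ha hna
    have hor : a ≤ a1 ∨ a2 ≤ a := by
      by_contra hcon; push Not at hcon; exact hna ⟨hcon.1, hcon.2⟩
    have hy := o.hi a hor
    -- X = larger distance, Z = smaller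
    obtain ⟨X, Z, hXD, hZ0, hXZ, hprod, hk, hmem⟩ : ∃ X Z : ℝ, X = (a2 - a1) + Z ∧ 0 ≤ Z ∧ β ≤ X ∧ (a - a1) * (a2 - a) = -(X * Z) ∧ |H a - η| ≤ d * √X ∧
        (Z ≤ w → a ∈ S ∧ A0 / 2 ≤ a) := by
      rcases hor with h | h
      · refine ⟨a2 - a, a1 - a, by ring, by linarith, by linarith, by ring, hout1 a ha h, fun hz => ⟨Or.inl ⟨by linarith, h⟩, by linarith⟩⟩
      · refine ⟨a - a1, a - a2, by ring, by linarith, by linarith, by ring, hout2 a h, fun hz => ⟨Or.inr ⟨h, by linarith⟩, by linarith [o.lt]⟩⟩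
    have hX0 : 0 < X := hβ.trans_le hXZ
    have hsX := Real.sqrt_pos.2 hX0
    rw [hprod] at hy
    have hXZ0 : 0 ≤ X * Z := by positivity
    have hl0 := o.l0
    have hy0 : y a ≤ 0 := by nlinarith
    rw [Vf_neg hy0]
    have hkl := (abs_le.1 hk).1
    have hle : y a - (H a - η) ≤ √X * (d - l / 2 * (√X * Z)) := by
      have : √X * √X = X := Real.mul_self_sqrt hX0.le
      calc _ ≤ l / 2 * (-(X * Z)) + d * √X := by linarith
        _ = l / 2 * (-((√X * √X) * Z)) + d * √X := by rw [this]
        _ = _ := by ring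
    by_cases hz : Z ≤ w
    · obtain ⟨hmS, haA⟩ := hmem hz
      rw [indicator_of_mem hmS]
      have e1 : max (y a - (H a - η)) 0 ≤ d * √(2 * A2) := by
        refine max_le ?_ (by positivity)
        have : √X ≤ √(2 * A2) := Real.sqrt_le_sqrt (by linarith [o.p1])
        have : 0 ≤ √X * (l / 2 * (√X * Z)) := by positivity
        have : d * √X ≤ d * √(2 * A2) := by gcongr
        linarith
      have e2 : √(max (y a - (H a - η)) 0) ^ 3 ≤ M * (d * √d) := by
        calc _ ≤ √(d * √(2 * A2)) ^ 3 := by gcongr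
          _ = M * (√d ^ 2 * √d) := by rw [Real.sqrt_mul hd, hM]; ring
          _ = _ := by rw [Real.sq_sqrt hd]
      calc _ ≤ 1 / (A0 / 2) ^ 2 * (4 * √2 / 3 * (M * (d * √d))) := by gcongr
        _ = _ := by rw [hc2]; field_simp; ring
    · push Not at hz
      have : y a - (H a - η) ≤ 0 := by
        refine hle.trans (mul_nonpos_of_nonneg_of_nonpos hsX.le ?_)
        have : d ≤ l / 2 * (√X * Z) := by
          calc d = β / 2 * (√β * w) := by rw [hwdef]; field_simp
            _ ≤ _ := by gcongr
        linarith
      rw [max_eq_right this]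
      simp only [Real.sqrt_zero]
      have : 0 ≤ S.indicator (fun _ => c2 * (d * √d)) a := indicator_nonneg (fun _ _ => by positivity) a
      simpa using this
  have hI : ∀ a ∈ Ioo a1 a2, 1 / a ^ 2 * Vf (y a) (H a - η) ≤ √2 / 2 * ((H a - η) ^ 2 / (a ^ 2 * √(y a))) + (c1 * (d ^ 2 * √√d)) * (Uw (a - a1) + Uw (a2 - a)) := by
    intro a ha
    have hy := (o.sqrt_lo ha).1
    have ha0 : 0 < a := o.p1.trans ha.1
    have hx := sub_pos.2 ha.1
    have hz := sub_pos.2 ha.2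
    have hk : |H a - η| ≤ K * d := by
      refine (hin a ⟨ha.1.le, ha.2.le⟩).trans ?_
      rw [mul_comm, hK]; gcongr; linarith [o.p1]
    have hUx := Uw_nonneg (a - a1)
    have hUz := Uw_nonneg (a2 - a)
    have e1 : Uw (y a) ≤ (Uw (β / 2) * Uw (β / 2)) * (Uw (a - a1) + Uw (a2 - a)) := by
      have hlo := o.lo a ⟨ha.1.le, ha.2.le⟩
      have : β / 2 * ((a - a1) * (a2 - a)) ≤ y a := le_trans (by gcongr) hlo
      refine (Uw_anti (by positivity) this).trans ?_
      rw [Uw_mul (by positivity), Uw_mul hx.le, mul_assoc]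
      refine mul_le_mul_of_nonneg_left ?_ hUb
      rcases le_total (a - a1) (β / 2) with h | h
      · have := Uw_anti (half_pos hβ) (show β / 2 ≤ a2 - a by linarith)
        nlinarith [mul_nonneg hUb hUz, mul_le_mul_of_nonneg_left this hUx]
      · have := Uw_anti (half_pos hβ) h
        nlinarith [mul_nonneg hUb hUx, mul_le_mul_of_nonneg_right this hUz]
    have e2 : (H a - η) ^ 2 * √√|H a - η| ≤ (K ^ 2 * √√K) * (d ^ 2 * √√d) := by
      rw [← sq_abs]
      calc _ ≤ (K * d) ^ 2 * √√(K * d) := by gcongr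
        _ = _ := by rw [Real.sqrt_mul hK0, Real.sqrt_mul (Real.sqrt_nonneg _)]; ring
    have haA : A0 ≤ a := h1.trans ha.1.le
    calc _ ≤ 1 / a ^ 2 * ((√2 / 2) * ((H a - η) ^ 2 / √(y a)) + 2 * √2 * ((H a - η) ^ 2 * √√|H a - η| * Uw (y a))) := by
          gcongr; exact Vf_sharp hy
      _ = √2 / 2 * ((H a - η) ^ 2 / (a ^ 2 * √(y a))) + 1 / a ^ 2 * (2 * √2 * ((H a - η) ^ 2 * √√|H a - η| * Uw (y a))) := by
          have := Real.sqrt_pos.2 hy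
          field_simp
      _ ≤ √2 / 2 * ((H a - η) ^ 2 / (a ^ 2 * √(y a))) + 1 / A0 ^ 2 * (2 * √2 * (((K ^ 2 * √√K) * (d ^ 2 * √√d)) * ((Uw (β / 2) * Uw (β / 2)) * (Uw (a - a1) + Uw (a2 - a))))) := by
          have := Uw_nonneg (y a)
          gcongr
      _ = _ := by rw [hc1]; ring
  have hmU : Measurable fun a => ENNReal.ofReal ((c1 * (d ^ 2 * √√d)) * (Uw (a - a1) + Uw (a2 - a))) :=
    (((Uw_meas.comp (measurable_id.sub_const a1)).add (Uw_meas.comp (measurable_id.const_sub a2))).const_mul _).ennreal_ofReal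
  calc _ ≤ ∫⁻ a in Ioi (0:ℝ), ((Ioo a1 a2).indicator (fun a => ENNReal.ofReal (√2 / 2 * ((H a - η) ^ 2 / (a ^ 2 * √(y a)))) + ENNReal.ofReal ((c1 * (d ^ 2 * √√d)) * (Uw (a - a1) + Uw (a2 - a)))) a + S.indicator (fun _ => ENNReal.ofReal (c2 * (d * √d))) a) := by
        refine setLIntegral_mono' measurableSet_Ioi fun a ha => ?_
        rw [← ENNReal.ofReal_mul (by positivity)]
        by_cases h : a ∈ Ioo a1 a2
        · rw [indicator_of_mem h]
          refine le_trans ?_ le_self_add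
          refine (ENNReal.ofReal_le_ofReal (hI a h)).trans ENNReal.ofReal_add_le
        · rw [indicator_of_notMem h, zero_add]
          refine (ENNReal.ofReal_le_ofReal (hO a ha h)).trans (le_of_eq ?_)
          by_cases h' : a ∈ S <;> simp [h']
    _ ≤ ∫⁻ a, ((Ioo a1 a2).indicator (fun a => ENNReal.ofReal (√2 / 2 * ((H a - η) ^ 2 / (a ^ 2 * √(y a)))) + ENNReal.ofReal ((c1 * (d ^ 2 * √√d)) * (Uw (a - a1) + Uw (a2 - a)))) a + S.indicator (fun _ => ENNReal.ofReal (c2 * (d * √d))) a) :=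
        setLIntegral_le_lintegral _ _
    _ = (∫⁻ a in Ioo a1 a2, ENNReal.ofReal (√2 / 2 * ((H a - η) ^ 2 / (a ^ 2 * √(y a))))) + ENNReal.ofReal ((c1 * (d ^ 2 * √√d)) * (8 * √√(a2 - a1))) + ENNReal.ofReal (c2 * (d * √d)) * volume S := by
        rw [lintegral_add_right _ (measurable_const.indicator hSm), lintegral_indicator measurableSet_Ioo,
          lintegral_add_right _ hmU, Uw_sum_int o.lt (by positivity), lintegral_indicator_const hSm]
    _ ≤ (∫⁻ a in Ioo a1 a2, ENNReal.ofReal (√2 / 2 * ((H a - η) ^ 2 / (a ^ 2 * √(y a))))) + ENNReal.ofReal ((c1 * (d ^ 2 * √√d)) * (8 * √√(a2 - a1))) + ENNReal.ofReal (c2 * (d * √d)) * ENNReal.ofReal (2 * w) := by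
        gcongr
        refine (measure_union_le _ _).trans ?_
        rw [Real.volume_Icc, Real.volume_Icc, ← ENNReal.ofReal_add (by linarith) (by linarith)]
        apply ENNReal.ofReal_le_ofReal; linarith
    _ ≤ _ := by
        rw [add_assoc]
        gcongr
        rw [← ENNReal.ofReal_mul (by positivity), ← ENNReal.ofReal_add (by positivity) (by positivity)]
        apply ENNReal.ofReal_le_ofReal
        have e1 : √√(a2 - a1) ≤ √√A2 := Real.sqrt_le_sqrt (Real.sqrt_le_sqrt (by linarith [o.p1]))
        have e2 : √d ≤ √√d := by
          refine Real.le_sqrt_of_sq_le ?_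
          rw [Real.sq_sqrt hd]
          exact Real.le_sqrt_of_sq_le (by nlinarith)
        calc _ ≤ c1 * (d ^ 2 * √√d) * (8 * √√A2) + c2 * (d * √√d) * (2 * (2 * d / (β * √β))) := by gcongr
          _ = _ := by ring

end M14

section M15

variable {Q : Phase → ℝ} {F : ℝ → ℝ → ℝ} {e₀ : ℝ}

lemma chi_convex {f : Phase → ℝ} (hf : Nice f) : ConvexOn ℝ univ (chi f) := by
  have hd : deriv (chi f) = fun a => -(nf f a) / (4 * π) := funext fun a => (chi_hasDerivAt hf a).deriv
  refine Monotone.convexOn_univ_of_deriv (fun a => (chi_hasDerivAt hf a).differentiableAt) ?_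
  rw [hd]
  intro a b hab
  have := nf_anti hf hab
  have := Real.pi_pos
  dsimp only
  gcongr

lemma conc_sign {p : ℝ → ℝ} (hp : ConcaveOn ℝ univ p) {a1 a2 : ℝ} (h : a1 < a2) (h1 : p a1 = 0) (h2 : p a2 = 0) :
    (∀ a ∈ Icc a1 a2, 0 ≤ p a) ∧ ∀ a, a ≤ a1 ∨ a2 ≤ a → p a ≤ 0 := by
  have key : ∀ x y z, x ≤ y → y ≤ z → (z - y) * p x + (y - x) * p z ≤ (z - x) * p y := by
    intro x y z hxy hyz
    rcases eq_or_lt_of_le (hxy.trans hyz) with he | hlt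
    · have e1 : x = y := by linarith
      have e2 : z = y := by linarith
      subst e1; subst e2; simp
    · have hz : 0 < z - x := by linarith
      have := hp.2 (mem_univ x) (mem_univ z) 
        (div_nonneg (show 0 ≤ z - y by linarith) hz.le) (div_nonneg (show 0 ≤ y - x by linarith) hz.le) (by field_simp; ring)
      have e : ((z - y) / (z - x)) • x + ((y - x) / (z - x)) • z = y := by
        simp only [smul_eq_mul]; field_simp; ring
      rw [e] at this
      simp only [smul_eq_mul] at this
      have h3 := mul_le_mul_of_nonneg_left this hz.le
      calc _ = (z - x) * ((z - y) / (z - x) * p x + (y - x) / (z - x) * p z) := by field_simp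
        _ ≤ _ := h3
  refine ⟨fun a ha => ?_, fun a ha => ?_⟩
  · have := key a1 a a2 ha.1 ha.2
    rw [h1, h2] at this
    by_contra hc; push Not at hc
    nlinarith
  · rcases ha with ha | ha
    · have := key a a1 a2 ha h.le
      rw [h1, h2] at this
      by_contra hc; push Not at hc
      nlinarith
    · have := key a1 a2 a h.le ha
      rw [h1, h2] at this
      by_contra hc; push Not at hc
      nlinarith

lemma orb_exists (hQ : AssumptionA Q F e₀) {Φ : ℝ} (hΦ : ∀ a, -Φ ≤ chi Q a) {c0 l : ℝ} (hl : 0 < l) (hc : c0 ≤ e₀)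
    (hex : ∃ a > 0, 0 < c0 - chi Q a - l * a ^ 2 / 2) :
    ∃ a1 a2, Orb (fun a => c0 - chi Q a - l * a ^ 2 / 2) l a1 a2 ∧ c0 - chi Q a1 - l * a1 ^ 2 / 2 = 0 ∧
      c0 - chi Q a2 - l * a2 ^ 2 / 2 = 0 ∧ 4 * π * (-e₀) ≤ a1 * mass Q ∧ l * a2 ^ 2 ≤ 2 * Φ := by
  have hN := A_nice hQ
  have he := hQ.e₀neg
  obtain ⟨m, hm, hym⟩ := hex
  have hcont : Continuous fun a => c0 - chi Q a - l * a ^ 2 / 2 := by have := chi_cont hN; fun_prop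
  obtain ⟨a1, ha1, hy1⟩ := intermediate_value_Icc hm.le hcont.continuousOn (show (0:ℝ) ∈ Icc _ _ from
    ⟨by simp [chi_zero]; linarith, hym.le⟩)
  have hmΦ : l * m ^ 2 / 2 < Φ := by linarith [hΦ m]
  have hΦ0 : 0 < Φ := lt_of_le_of_lt (by positivity) hmΦ
  have hmb : m ≤ √(2 * Φ / l) := by
    apply Real.le_sqrt_of_sq_le
    rw [le_div_iff₀ hl]; linarith
  obtain ⟨a2, ha2, hy2⟩ := intermediate_value_Icc' hmb hcont.continuousOn (show (0:ℝ) ∈ Icc _ _ from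
    ⟨by
      rw [Real.sq_sqrt (by positivity)]
      have : l * (2 * Φ / l) / 2 = Φ := by field_simp
      rw [this]; linarith [hΦ (√(2 * Φ / l))], hym.le⟩)
  dsimp only at hy1 hy2
  have h1 : 0 < a1 := by
    rcases eq_or_lt_of_le ha1.1 with h | h
    · rw [← h] at hy1; simp [chi_zero] at hy1; linarith
    · exact h
  have h1m : a1 < m := by
    rcases eq_or_lt_of_le ha1.2 with h | h
    · rw [h] at hy1; linarith
    · exact h
  have h12 : a1 < a2 := h1m.trans_le ha2.1
  have hp : ConcaveOn ℝ univ fun a => c0 - chi Q a - l / 2 * ((a1 + a2) * a - a1 * a2) := by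
    refine ⟨convex_univ, fun x _ y _ α β hα hβ hab => ?_⟩
    have := (chi_convex hN).2 (mem_univ x) (mem_univ y) hα hβ hab
    simp only [smul_eq_mul] at this ⊢
    have e : β = 1 - α := by linarith
    subst e
    linarith
  obtain ⟨hs1, hs2⟩ := conc_sign hp h12 (by linear_combination hy1) (by linear_combination hy2)
  refine ⟨a1, a2, ⟨hl, h1, h12, hcont, fun a ha => ?_, fun a ha => ?_⟩, hy1, hy2, ?_, ?_⟩
  · have := hs1 a ha; linarith
  · have := hs2 a ha; linarith
  · have := chi_ge hN a1
    have h4 : 0 ≤ l * a1 ^ 2 / 2 := by positivity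
    have h5 : -(a1 * mass Q) / (4 * π) ≤ e₀ := by linarith
    rw [div_le_iff₀ (by positivity)] at h5
    linarith
  · linarith [hΦ a2]

/-- facts about `H = chi f - chi Q` -/
def Hf (f Q : Phase → ℝ) (a : ℝ) : ℝ := chi f a - chi Q a
def Hp (f Q : Phase → ℝ) (a : ℝ) : ℝ := -(nf f a - nf Q a) / (4 * π)
def dd (f Q : Phase → ℝ) : ℝ := √(∫ a in Ioi (0:ℝ), Hp f Q a ^ 2)

variable {f : Phase → ℝ}

lemma Hf_deriv (hf : Nice f) (hQ : Nice Q) (a : ℝ) : HasDerivAt (Hf f Q) (Hp f Q a) a := by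
  refine ((chi_hasDerivAt hf a).sub (chi_hasDerivAt hQ a)).congr_deriv ?_
  unfold Hp; ring

lemma Hp_meas (hf : Nice f) (hQ : Nice Q) : Measurable (Hp f Q) := by
  have := (nf_anti hf).measurable
  have := (nf_anti hQ).measurable
  unfold Hp; fun_prop

lemma Hf_cont (hf : Nice f) (hQ : Nice Q) : Continuous (Hf f Q) := (chi_cont hf).sub (chi_cont hQ)

lemma Hp_sq_int (hf : Nice f) (hQ : Nice Q) : IntegrableOn (fun a => Hp f Q a ^ 2) (Ioi 0) := by
  have := (sq_sub_int hf hQ).1.mul_const (1 / (4 * π) ^ 2)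
  refine this.congr (Eventually.of_forall fun a => ?_)
  unfold Hp; dsimp only; ring

lemma dd_sq (f Q : Phase → ℝ) : dd f Q ^ 2 = ∫ a in Ioi (0:ℝ), Hp f Q a ^ 2 :=
  Real.sq_sqrt (setIntegral_nonneg measurableSet_Ioi fun _ _ => sq_nonneg _)

lemma dd_fieldDist (hf : Nice f) (hQ : Nice Q) :
    fieldDist f Q ^ 2 = 4 * π * dd f Q ^ 2 ∧ (∫ a in Ioi (0:ℝ), (nf f a - nf Q a) ^ 2) = (4 * π) ^ 2 * dd f Q ^ 2 := by
  have h : (∫ a in Ioi (0:ℝ), (nf f a - nf Q a) ^ 2) = (4 * π) ^ 2 * dd f Q ^ 2 := by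
    rw [dd_sq, ← integral_const_mul]
    congr 1; ext a
    have := Real.pi_pos
    unfold Hp; field_simp
  refine ⟨?_, h⟩
  rw [fieldDist_sq hf hQ, h]
  have := Real.pi_pos
  field_simp

lemma Hf_holder (hf : Nice f) (hQ : Nice Q) {a b : ℝ} (ha : 0 ≤ a) (hb : 0 ≤ b) :
    |Hf f Q a - Hf f Q b| ≤ dd f Q * √|a - b| := by
  wlog hab : a ≤ b generalizing a b
  · rw [abs_sub_comm, abs_sub_comm a b]; exact this hb ha (by linarith)
  rcases eq_or_lt_of_le hab with h | h
  · rw [h]; simp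
  have hI : IntervalIntegrable (Hp f Q) volume a b := by
    have h1 := (nf_anti hf).intervalIntegrable (μ := volume) (a := a) (b := b)
    have h2 := (nf_anti hQ).intervalIntegrable (μ := volume) (a := a) (b := b)
    exact ((h1.sub h2).neg).div_const _
  have hftc := intervalIntegral.integral_eq_sub_of_hasDerivAt (fun x _ => Hf_deriv hf hQ x) hI
  have hsub : Ioc a b ⊆ Ioi 0 := fun x hx => lt_of_le_of_lt ha hx.1
  have hI2 : IntervalIntegrable (fun x => Hp f Q x ^ 2) volume a b :=
    (intervalIntegrable_iff_integrableOn_Ioc_of_le hab).2 ((Hp_sq_int hf hQ).mono_set hsub)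
  have hle : ∫ x in a..b, Hp f Q x ^ 2 ≤ dd f Q ^ 2 := by
    rw [dd_sq, intervalIntegral.integral_of_le hab]
    exact setIntegral_mono_set (Hp_sq_int hf hQ) (Eventually.of_forall fun _ => sq_nonneg _) hsub.eventuallyLE
  set I := Hf f Q b - Hf f Q a with hIdef
  have hba : 0 < b - a := by linarith
  have h0 : 0 ≤ ∫ x in a..b, (Hp f Q x - I / (b - a)) ^ 2 := intervalIntegral.integral_nonneg hab fun _ _ => sq_nonneg _
  have e : ∫ x in a..b, (Hp f Q x - I / (b - a)) ^ 2 = (∫ x in a..b, Hp f Q x ^ 2) - 2 * (I / (b - a)) * I + (I / (b - a)) ^ 2 * (b - a) := by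
    have : (fun x => (Hp f Q x - I / (b - a)) ^ 2) = fun x => (Hp f Q x ^ 2 - 2 * (I / (b - a)) * Hp f Q x) + (I / (b - a)) ^ 2 := by
      ext x; ring
    rw [this, intervalIntegral.integral_add (hI2.sub (hI.const_mul _)) (by simp), intervalIntegral.integral_sub hI2 (hI.const_mul _),
      intervalIntegral.integral_const_mul, hftc, intervalIntegral.integral_const]
    simp only [smul_eq_mul]; ring
  rw [e] at h0
  have h5 : I ^ 2 ≤ dd f Q ^ 2 * (b - a) := by
    have e2 : 2 * (I / (b - a)) * I - (I / (b - a)) ^ 2 * (b - a) = I ^ 2 / (b - a) := by field_simp; ring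
    rw [← div_le_iff₀ hba, ← e2]; linarith
  rw [abs_sub_comm, abs_sub_comm a b, abs_of_pos hba]
  have hd0 : 0 ≤ dd f Q := Real.sqrt_nonneg _
  refine abs_le_of_sq_le_sq ?_ (by positivity)
  rw [mul_pow, Real.sq_sqrt hba.le]; exact h5

lemma Hf_zero (f Q : Phase → ℝ) : Hf f Q 0 = 0 := by simp [Hf, chi_zero]

lemma Hf_le (hf : Nice f) (hQ : Nice Q) {a : ℝ} (ha : 0 ≤ a) : |Hf f Q a| ≤ dd f Q * √a := by
  have := Hf_holder hf hQ ha le_rfl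
  rwa [Hf_zero, sub_zero, sub_zero, abs_of_nonneg ha] at this

end M15

section M16

namespace Orb
variable {y : ℝ → ℝ} {l a1 a2 : ℝ}

lemma le_sqrt_sq' (x : ℝ) : x ≤ √x ^ 2 := by
  rcases le_total 0 x with h | h
  · rw [Real.sq_sqrt h]
  · exact h.trans (sq_nonneg _)

lemma sqrt_split (a a1 a2 : ℝ) : √(a2 - a1) ≤ √(a - a1) + √(a2 - a) := by
  refine Real.sqrt_le_iff.2 ⟨by positivity, ?_⟩
  have h1 : a - a1 ≤ √(a - a1) ^ 2 := le_sqrt_sq' _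
  have h2 : a2 - a ≤ √(a2 - a) ^ 2 := le_sqrt_sq' _
  nlinarith [mul_nonneg (Real.sqrt_nonneg (a - a1)) (Real.sqrt_nonneg (a2 - a))]

def WW (a1 a2 a : ℝ) : ℝ := 1 / √(a - a1) + 1 / √(a2 - a)

lemma WW_nonneg (a1 a2 a : ℝ) : 0 ≤ WW a1 a2 a := by unfold WW; positivity

lemma WW_deriv {a : ℝ} (ha : a ∈ Ioo a1 a2) :
    HasDerivAt (fun a => 2 * √(a - a1) - 2 * √(a2 - a)) (WW a1 a2 a) a := by
  have h1 := (((hasDerivAt_id a).sub_const a1).sqrt (sub_pos.2 ha.1).ne').const_mul 2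
  have h2 := (((hasDerivAt_id a).const_sub a2).sqrt (sub_pos.2 ha.2).ne').const_mul 2
  refine (h1.sub h2).congr_deriv ?_
  have := Real.sqrt_pos.2 (sub_pos.2 ha.1)
  have := Real.sqrt_pos.2 (sub_pos.2 ha.2)
  simp only [WW, id]
  field_simp
  ring

lemma WW_int (h : a1 ≤ a2) : IntervalIntegrable (WW a1 a2) volume a1 a2 := by
  rw [intervalIntegrable_iff_integrableOn_Ioc_of_le h]
  exact intervalIntegral.integrableOn_deriv_of_nonneg (g := fun a => 2 * √(a - a1) - 2 * √(a2 - a)) (by fun_prop)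
    (fun x hx => WW_deriv hx) fun x _ => WW_nonneg _ _ _

lemma WW_left {a : ℝ} (ha : a ∈ Icc a1 a2) : ∫ x in a1..a, WW a1 a2 x ≤ 4 * √(a - a1) := by
  have h := ha.1.trans ha.2
  rw [intervalIntegral.integral_eq_sub_of_hasDerivAt_of_le ha.1 (f := fun a => 2 * √(a - a1) - 2 * √(a2 - a)) (by fun_prop)
    (fun x hx => WW_deriv ⟨hx.1, hx.2.trans_le ha.2⟩) ((WW_int h).mono_set (by
      rw [uIcc_of_le ha.1, uIcc_of_le h]; exact Icc_subset_Icc_right ha.2))]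
  have : √(a2 - a1) ≤ √(a - a1) + √(a2 - a) := by
    exact sqrt_split _ _ _
  simp only [sub_self, Real.sqrt_zero]
  linarith

lemma WW_right {a : ℝ} (ha : a ∈ Icc a1 a2) : ∫ x in a..a2, WW a1 a2 x ≤ 4 * √(a2 - a) := by
  have h := ha.1.trans ha.2
  rw [intervalIntegral.integral_eq_sub_of_hasDerivAt_of_le ha.2 (f := fun a => 2 * √(a - a1) - 2 * √(a2 - a)) (by fun_prop)
    (fun x hx => WW_deriv ⟨ha.1.trans_lt hx.1, hx.2⟩) ((WW_int h).mono_set (by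
      rw [uIcc_of_le ha.2, uIcc_of_le h]; exact Icc_subset_Icc_left ha.1))]
  have : √(a2 - a1) ≤ √(a - a1) + √(a2 - a) := by
    exact sqrt_split _ _ _
  simp only [sub_self, Real.sqrt_zero]
  linarith

/-- weight bound -/
lemma inv_sqrt_le (o : Orb y l a1 a2) : ∃ C, 0 ≤ C ∧ ∀ a ∈ Ioo a1 a2, 1 / (a ^ 2 * √(y a)) ≤ C * WW a1 a2 a := by
  have h1 := o.p1
  have hD := sub_pos.2 o.lt
  have hsD := Real.sqrt_pos.2 hD
  refine ⟨1 / a1 ^ 2 * ((√2 / √l) * (1 / √(a2 - a1))), by positivity, fun a ha => ?_⟩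
  obtain ⟨hy, hi⟩ := o.sqrt_lo ha
  have hx := Real.sqrt_pos.2 (sub_pos.2 ha.1)
  have hz := Real.sqrt_pos.2 (sub_pos.2 ha.2)
  have hsum : √(a2 - a1) ≤ √(a - a1) + √(a2 - a) := by
    exact sqrt_split _ _ _
  have e : 1 / (√(a - a1) * √(a2 - a)) ≤ 1 / √(a2 - a1) * WW a1 a2 a := by
    have e1 : 1 / √(a2 - a1) * WW a1 a2 a = 1 / (√(a - a1) * √(a2 - a)) * ((√(a - a1) + √(a2 - a)) / √(a2 - a1)) := by
      unfold WW; field_simp; ring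
    rw [e1]
    refine le_mul_of_one_le_right (by positivity) ?_
    rwa [le_div_iff₀ hsD, one_mul]
  have ha1 : a1 ≤ a := ha.1.le
  calc 1 / (a ^ 2 * √(y a)) = 1 / a ^ 2 * (1 / √(y a)) := by rw [one_div_mul_one_div]
    _ ≤ 1 / a1 ^ 2 * ((√2 / √l) * (1 / √(a2 - a1) * WW a1 a2 a)) := by
        have hq : 1 / √(y a) ≤ (√2 / √l) * (1 / √(a2 - a1) * WW a1 a2 a) := hi.trans (by gcongr)
        have : 1 / a ^ 2 ≤ 1 / a1 ^ 2 := by gcongr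
        exact mul_le_mul this hq (by positivity) (by positivity)
    _ = _ := by ring

lemma wt_int (o : Orb y l a1 a2) {k : ℝ → ℝ} (hk : Continuous k) :
    IntegrableOn (fun a => k a / (a ^ 2 * √(y a))) (Ioo a1 a2) := by
  obtain ⟨C, hC, hle⟩ := o.inv_sqrt_le
  obtain ⟨K, hK⟩ := (isCompact_Icc (a := a1) (b := a2)).exists_bound_of_continuousOn hk.continuousOn
  have hW : IntegrableOn (fun a => K * (C * WW a1 a2 a)) (Ioo a1 a2) := by
    have := (intervalIntegrable_iff_integrableOn_Ioo_of_le o.lt.le).1 (WW_int o.lt.le)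
    exact (this.const_mul C).const_mul K
  refine Integrable.mono' hW ?_ ?_
  · have := o.cont.measurable
    have := hk.measurable
    exact (by fun_prop : Measurable fun a => k a / (a ^ 2 * √(y a))).aestronglyMeasurable
  · refine (ae_restrict_mem measurableSet_Ioo).mono fun a ha => ?_
    have h1 := hle a ha
    have h2 := hK a ⟨ha.1.le, ha.2.le⟩
    have h3 := o.p1.trans ha.1
    have hK0 : 0 ≤ K := (norm_nonneg _).trans h2
    rw [norm_div, div_eq_mul_one_div, norm_of_nonneg (by positivity : 0 ≤ a ^ 2 * √(y a))]
    gcongr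

set_option maxHeartbeats 1000000 in
theorem poincare (o : Orb y l a1 a2) {y1 y2 k k1 : ℝ → ℝ} {B1 m0 : ℝ} (hy : ∀ a ∈ Ioo a1 a2, HasDerivAt y (y1 a) a)
    (hy1 : ∀ a ∈ Ioo a1 a2, HasDerivAt y1 (y2 a) a) (hB : ∀ a ∈ Ioo a1 a2, |y1 a| ≤ B1)
    (hk : ∀ a, HasDerivAt k (k1 a) a) (hk1 : IntegrableOn (fun a => k1 a ^ 2) (Ioo a1 a2)) (hm0 : 0 < m0)
    (hM : ∀ a ∈ Ioo a1 a2, m0 ≤ y1 a - a * y2 a) (hmy1 : Measurable y1) (hmy2 : Measurable y2)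
    (h0 : ∫ a in Ioo a1 a2, k a / (a ^ 2 * √(y a)) = 0) :
    ∫ a in Ioo a1 a2, k a ^ 2 / (a ^ 2 * √(y a)) ≤ 2 * ∫ a in Ioo a1 a2, k1 a ^ 2 * (√(y a) / (a * (y1 a - a * y2 a))) := by
  have h1 := o.p1
  have h12 := o.lt
  have hkc : Continuous k := continuous_iff_continuousAt.2 fun a => (hk a).continuousAt
  have hwI := o.wt_int hkc
  have hwII : IntervalIntegrable (fun a => k a / (a ^ 2 * √(y a))) volume a1 a2 :=
    (intervalIntegrable_iff_integrableOn_Ioo_of_le h12.le).2 hwI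
  have h0' : ∫ a in a1..a2, k a / (a ^ 2 * √(y a)) = 0 := by
    rw [intervalIntegral.integral_of_le h12.le, integral_Ioc_eq_integral_Ioo]; exact h0
  set g : ℝ → ℝ := fun a => ∫ x in a1..a, k x / (x ^ 2 * √(y x)) with hg
  obtain ⟨C, hC, hCle⟩ := o.inv_sqrt_le
  obtain ⟨K, hK⟩ := (isCompact_Icc (a := a1) (b := a2)).exists_bound_of_continuousOn hkc.continuousOn
  have hK0 : 0 ≤ K := (norm_nonneg _).trans (hK a1 ⟨le_rfl, h12.le⟩)
  have hwle : ∀ a ∈ Ioo a1 a2, ‖k a / (a ^ 2 * √(y a))‖ ≤ K * C * WW a1 a2 a := by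
    intro a ha
    have h1 := hCle a ha
    have h2 := hK a ⟨ha.1.le, ha.2.le⟩
    have h3 := o.p1.trans ha.1
    rw [norm_div, div_eq_mul_one_div, norm_of_nonneg (by positivity : 0 ≤ a ^ 2 * √(y a)), mul_assoc]
    gcongr
  set c := K * C * 4 with hc
  have hc0 : 0 ≤ c := by positivity
  have hsubint : ∀ {u v : ℝ}, a1 ≤ u → u ≤ v → v ≤ a2 → |∫ x in u..v, k x / (x ^ 2 * √(y x))| ≤ K * C * ∫ x in u..v, WW a1 a2 x := by
    intro u v hu huv hv
    rw [← Real.norm_eq_abs, ← intervalIntegral.integral_const_mul]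
    refine intervalIntegral.norm_integral_le_of_norm_le huv ?_ ?_
    · have : ∀ᵐ x : ℝ, x ≠ a2 := by simp [ae_iff, measure_singleton]
      filter_upwards [this] with x hx hxm
      exact hwle x ⟨hu.trans_lt hxm.1, lt_of_le_of_ne (hxm.2.trans hv) hx⟩
    · refine ((WW_int h12.le).const_mul _).mono_set ?_
      rw [uIcc_of_le huv, uIcc_of_le h12.le]; exact Icc_subset_Icc hu hv
  have hgl : ∀ a ∈ Icc a1 a2, |g a| ≤ c * √(a - a1) := by
    intro a ha
    refine (hsubint le_rfl ha.1 ha.2).trans ?_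
    have := mul_le_mul_of_nonneg_left (WW_left ha) (by positivity : 0 ≤ K * C)
    linarith
  have hgr : ∀ a ∈ Icc a1 a2, |g a| ≤ c * √(a2 - a) := by
    intro a ha
    have e : g a = -∫ x in a..a2, k x / (x ^ 2 * √(y x)) := by
      have := intervalIntegral.integral_add_adjacent_intervals (μ := volume) (f := fun x => k x / (x ^ 2 * √(y x))) (a := a1) (b := a) (c := a2)
        (hwII.mono_set (by rw [uIcc_of_le ha.1, uIcc_of_le h12.le]; exact Icc_subset_Icc_right ha.2))
        (hwII.mono_set (by rw [uIcc_of_le ha.2, uIcc_of_le h12.le]; exact Icc_subset_Icc_left ha.1))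
      rw [h0'] at this
      simp only [hg]; linarith
    rw [e, abs_neg]
    refine (hsubint ha.1 ha.2 le_rfl).trans ?_
    have := mul_le_mul_of_nonneg_left (WW_right ha) (by positivity : 0 ≤ K * C)
    linarith
  have hga1 : g a1 = 0 := by simp [hg]
  have hga2 : g a2 = 0 := h0'
  have hgd : ∀ a ∈ Ioo a1 a2, HasDerivAt g (k a / (a ^ 2 * √(y a))) a := by
    intro a ha
    have hya := (o.sqrt_lo ha).1
    have h3 := o.p1.trans ha.1
    refine intervalIntegral.integral_hasDerivAt_right
      (hwII.mono_set (by rw [uIcc_of_le ha.1.le, uIcc_of_le h12.le]; exact Icc_subset_Icc_right ha.2.le)) ?_ ?_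
    · have := o.cont.measurable
      have := hkc.measurable
      exact (by fun_prop : Measurable fun a => k a / (a ^ 2 * √(y a))).stronglyMeasurable.stronglyMeasurableAtFilter
    · have hs := Real.sqrt_pos.2 hya
      exact hkc.continuousAt.div (by have := o.cont; fun_prop) (by positivity)
  set B : ℝ → ℝ := fun a => k a * g a + a * g a ^ 2 * (2 * y a - a * y1 a) / (4 * √(y a)) with hBdef
  have hBd : ∀ a ∈ Ioo a1 a2, HasDerivAt B (k a ^ 2 / (2 * (a ^ 2 * √(y a))) + (1 / (2 * a ^ 2 * √(y a))) * (k a + a * g a * (2 * y a - a * y1 a) / (2 * √(y a))) ^ 2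
      + (k1 a * g a + a * (y1 a - a * y2 a) / (4 * √(y a)) * g a ^ 2)) a := by
    intro a ha
    have hya := (o.sqrt_lo ha).1
    have hs := Real.sqrt_pos.2 hya
    have h3 := o.p1.trans ha.1
    have d1 := (hk a).mul (hgd a ha)
    have d2 := ((hasDerivAt_id a).mul ((hgd a ha).pow 2)).mul (((hy a ha).const_mul 2).sub ((hasDerivAt_id a).mul (hy1 a ha)))
    have d3 := d2.div (((hy a ha).sqrt hya.ne').const_mul 4) (by positivity)
    refine (d1.add d3).congr_deriv ?_
    have hyy : y a = √(y a) ^ 2 := (Real.sq_sqrt hya.le).symm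
    simp only [id, Pi.mul_apply, Pi.sub_apply, Pi.pow_apply]
    set s := √(y a)
    rw [hyy]
    field_simp
    ring
  obtain ⟨Y, hY⟩ := (isCompact_Icc (a := a1) (b := a2)).exists_bound_of_continuousOn o.cont.continuousOn
  set S0 := 2 * Y + a2 * B1 with hS0
  have hS : ∀ a ∈ Ioo a1 a2, |2 * y a - a * y1 a| ≤ S0 := by
    intro a ha
    have e1 := hY a ⟨ha.1.le, ha.2.le⟩
    have h3 := o.p1.trans ha.1
    have e2 := hB a ha
    rw [Real.norm_eq_abs] at e1
    calc _ ≤ |2 * y a| + |a * y1 a| := abs_sub _ _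
      _ = 2 * |y a| + a * |y1 a| := by rw [abs_mul, abs_mul, abs_of_pos h3]; norm_num
      _ ≤ _ := by
        have : a * |y1 a| ≤ a2 * B1 := mul_le_mul ha.2.le e2 (abs_nonneg _) (by linarith)
        linarith
  -- end bounds
  have hBb : ∀ (X Z : ℝ → ℝ), (∀ a ∈ Ioo a1 a2, 0 < X a ∧ 0 < Z a ∧ (a - a1) * (a2 - a) = X a * Z a ∧ |g a| ≤ c * √(X a)) →
      ∀ a ∈ Ioo a1 a2, |B a| ≤ K * c * √(X a) + a2 * c ^ 2 * S0 * (√2 / √l) / 4 * (√(X a) / √(Z a)) := by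
    intro X Z hXZ a ha
    obtain ⟨hX, hZ, hXZ, hga⟩ := hXZ a ha
    have h3 := o.p1.trans ha.1
    obtain ⟨hya, hi⟩ := o.sqrt_lo ha
    have hs := Real.sqrt_pos.2 hya
    have e1 := hK a ⟨ha.1.le, ha.2.le⟩
    rw [Real.norm_eq_abs] at e1
    have e2 := hS a ha
    have hsX := Real.sqrt_pos.2 hX
    have hsZ := Real.sqrt_pos.2 hZ
    rw [← Real.sqrt_mul (sub_pos.2 ha.1).le, hXZ, Real.sqrt_mul hX.le] at hi
    have hS00 : 0 ≤ S0 := (abs_nonneg _).trans e2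
    have hl := o.l0
    calc |B a| ≤ |k a * g a| + |a * g a ^ 2 * (2 * y a - a * y1 a) / (4 * √(y a))| := abs_add_le _ _
      _ = |k a| * |g a| + a * |g a| ^ 2 * |2 * y a - a * y1 a| / 4 * (1 / √(y a)) := by
          rw [abs_mul, abs_div, abs_mul, abs_mul, abs_of_pos h3, abs_pow, abs_of_pos (by positivity : 0 < 4 * √(y a))]
          field_simp
      _ ≤ K * (c * √(X a)) + a2 * (c * √(X a)) ^ 2 * S0 / 4 * ((√2 / √l) * (1 / (√(X a) * √(Z a)))) := by
          have := ha.2.le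
          have ha20 : 0 < a2 := h3.trans ha.2
          gcongr
      _ = _ := by field_simp
  have hdist1 := hBb (fun a => a - a1) (fun a => a2 - a) fun a ha => ⟨sub_pos.2 ha.1, sub_pos.2 ha.2, rfl, hgl a ⟨ha.1.le, ha.2.le⟩⟩
  have hdist2 := hBb (fun a => a2 - a) (fun a => a - a1) fun a ha => ⟨sub_pos.2 ha.2, sub_pos.2 ha.1, mul_comm _ _, hgr a ⟨ha.1.le, ha.2.le⟩⟩
  have hBa1 : B a1 = 0 := by simp [hBdef, hga1]
  have hBa2 : B a2 = 0 := by simp [hBdef, hga2]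
  have hD := sub_pos.2 h12
  have hsD := Real.sqrt_pos.2 hD
  have hBc : ContinuousOn B (Icc a1 a2) := by
    intro a ha
    rcases eq_or_lt_of_le ha.1 with e | e
    · subst e
      have hcw : ContinuousAt (fun a => K * c * √(a - a1) + a2 * c ^ 2 * S0 * (√2 / √l) / 4 * (√(a - a1) / √(a2 - a))) a1 := by
        have : ContinuousAt (fun a => √(a - a1) / √(a2 - a)) a1 := ContinuousAt.div (by fun_prop) (by fun_prop) hsD.ne'
        fun_prop
      have ht := hcw.continuousWithinAt (s := Icc a1 a2)
      unfold ContinuousWithinAt at ht ⊢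
      simp only [sub_self, Real.sqrt_zero, zero_div, mul_zero, add_zero] at ht
      rw [hBa1]
      refine squeeze_zero_norm' ?_ ht
      have : ∀ᶠ x in 𝓝[Icc a1 a2] a1, x < a2 := (eventually_lt_nhds h12).filter_mono nhdsWithin_le_nhds
      filter_upwards [this, self_mem_nhdsWithin] with x hx hxm
      rcases eq_or_lt_of_le hxm.1 with e | e
      · subst e; simp [hBa1]
      · exact hdist1 x ⟨e, hx⟩
    rcases eq_or_lt_of_le ha.2 with e' | e'
    · subst e'
      have hcw : ContinuousAt (fun x => K * c * √(a - x) + a * c ^ 2 * S0 * (√2 / √l) / 4 * (√(a - x) / √(x - a1))) a := by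
        have : ContinuousAt (fun x => √(a - x) / √(x - a1)) a := ContinuousAt.div (by fun_prop) (by fun_prop) hsD.ne'
        fun_prop
      have ht := hcw.continuousWithinAt (s := Icc a1 a)
      unfold ContinuousWithinAt at ht ⊢
      simp only [sub_self, Real.sqrt_zero, zero_div, mul_zero, add_zero] at ht
      rw [hBa2]
      refine squeeze_zero_norm' ?_ ht
      have : ∀ᶠ x in 𝓝[Icc a1 a] a, a1 < x := (eventually_gt_nhds h12).filter_mono nhdsWithin_le_nhds
      filter_upwards [this, self_mem_nhdsWithin] with x hx hxm
      rcases eq_or_lt_of_le hxm.2 with e | e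
      · subst e; simp [hBa2]
      · exact hdist2 x ⟨hx, e⟩
    · exact (hBd a ⟨e, e'⟩).continuousAt.continuousWithinAt
  have hI1 : IntegrableOn (fun a => k a ^ 2 / (a ^ 2 * √(y a))) (Ioo a1 a2) := o.wt_int (hkc.pow 2)
  have hI2 : IntegrableOn (fun a => k1 a ^ 2 * (√(y a) / (a * (y1 a - a * y2 a)))) (Ioo a1 a2) := by
    refine Integrable.mul_bdd (c := √Y / (a1 * m0)) hk1 ?_ ?_
    · have := o.cont.measurable
      exact (by fun_prop : Measurable fun a => √(y a) / (a * (y1 a - a * y2 a))).aestronglyMeasurable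
    · refine (ae_restrict_mem measurableSet_Ioo).mono fun a ha => ?_
      have h3 := o.p1.trans ha.1
      have hMa := hM a ha
      have hMp : 0 < y1 a - a * y2 a := hm0.trans_le hMa
      rw [Real.norm_of_nonneg (by positivity)]
      have := ha.1.le
      have hYa : y a ≤ Y := (le_abs_self _).trans (hY a ⟨ha.1.le, ha.2.le⟩)
      gcongr
  have hfin := intervalIntegral.integral_le_sub_of_hasDeriv_right_of_le (φ := fun a => (1/2 : ℝ) * (k a ^ 2 / (a ^ 2 * √(y a))) - k1 a ^ 2 * (√(y a) / (a * (y1 a - a * y2 a))))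
    h12.le hBc (fun x hx => (hBd x hx).hasDerivWithinAt) (by
      rw [integrableOn_Icc_iff_integrableOn_Ioo]
      exact (hI1.const_mul _).sub hI2) (by
      intro a ha
      have h3 := o.p1.trans ha.1
      have hya := (o.sqrt_lo ha).1
      have hs := Real.sqrt_pos.2 hya
      have hMp : 0 < y1 a - a * y2 a := hm0.trans_le (hM a ha)
      have q1 : 0 ≤ (1 / (2 * a ^ 2 * √(y a))) * (k a + a * g a * (2 * y a - a * y1 a) / (2 * √(y a))) ^ 2 := by positivity
      have q2 : 0 ≤ k1 a ^ 2 * (√(y a) / (a * (y1 a - a * y2 a))) + (k1 a * g a + a * (y1 a - a * y2 a) / (4 * √(y a)) * g a ^ 2) := by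
        set M := y1 a - a * y2 a
        set s := √(y a)
        have : k1 a ^ 2 * (s / (a * M)) + (k1 a * g a + a * M / (4 * s) * g a ^ 2) = s / (a * M) * (k1 a + a * M / (2 * s) * g a) ^ 2 := by
          field_simp; ring
        rw [this]; positivity
      have q3 : (1/2 : ℝ) * (k a ^ 2 / (a ^ 2 * √(y a))) = k a ^ 2 / (2 * (a ^ 2 * √(y a))) := by field_simp
      rw [q3]; linarith)
  rw [hBa1, hBa2, intervalIntegral.integral_of_le h12.le, integral_Ioc_eq_integral_Ioo, integral_sub (hI1.const_mul _) hI2, integral_const_mul] at hfin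
  linarith
end Orb

end M16

section M17

variable {Q : Phase → ℝ} {F : ℝ → ℝ → ℝ} {e₀ : ℝ}

def LW : Measure (ℝ × ℝ) := (volume.restrict (Ioi (0:ℝ))).prod volume
def TT (Q : Phase → ℝ) (r : ℝ) : ℝ := ∫ p, Q (pt r p.2 p.1) ∂LW

lemma Q_supp (hQ : AssumptionA Q F e₀) : ∃ R : ℝ, 0 < R ∧ ∀ r w l, 0 < r → 0 ≤ l → Q (pt r w l) ≠ 0 →
    r ≤ R ∧ |w| ≤ R ∧ l ≤ R ^ 2 * r ^ 2 := by
  obtain ⟨R, hR0, hR⟩ := hQ.cpt.isCompact.isBounded.subset_closedBall_lt 0 (0 : Phase)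
  refine ⟨R, hR0, fun r w l hr hl h => ?_⟩
  have hz := hR (subset_tsupport _ h)
  rw [mem_closedBall_zero_iff] at hz
  have h1 : ‖(pt r w l).1‖ ≤ R := (norm_fst_le _).trans hz
  have h2 : ‖(pt r w l).2‖ ≤ R := (norm_snd_le _).trans hz
  rw [norm_pt1 hr] at h1
  have h3 : w ^ 2 + l / r ^ 2 ≤ R ^ 2 := by rw [← norm_pt2 w hl]; gcongr
  have h4 : 0 ≤ l / r ^ 2 := by positivity
  refine ⟨h1, abs_le_of_sq_le_sq (by linarith) hR0.le, ?_⟩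
  rw [← div_le_iff₀ (by positivity)]
  linarith [sq_nonneg w]

lemma box_int (c M R : ℝ) : Integrable ((Icc 0 M ×ˢ Icc (-R) R).indicator fun _ => c) LW ∧
    ∫ p, (Icc 0 M ×ˢ Icc (-R) R).indicator (fun _ => c) p ∂LW ≤ |c| * (|M| * (2 * |R|)) := by
  have hm : MeasurableSet (Icc (0:ℝ) M ×ˢ Icc (-R) R) := measurableSet_Icc.prod measurableSet_Icc
  have hv : LW (Icc 0 M ×ˢ Icc (-R) R) ≤ ENNReal.ofReal (|M| * (2 * |R|)) := by
    rw [LW, Measure.prod_prod, ENNReal.ofReal_mul (abs_nonneg _)]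
    gcongr
    · refine (Measure.restrict_apply_le _ _).trans ?_
      rw [Real.volume_Icc, sub_zero]; exact ENNReal.ofReal_le_ofReal (le_abs_self _)
    · rw [Real.volume_Icc]; apply ENNReal.ofReal_le_ofReal; linarith [le_abs_self R]
  have hlt : LW (Icc 0 M ×ˢ Icc (-R) R) ≠ ⊤ := (hv.trans_lt ENNReal.ofReal_lt_top).ne
  refine ⟨(integrable_indicator_iff hm).2 (integrableOn_const hlt), ?_⟩
  rw [integral_indicator hm, setIntegral_const, smul_eq_mul, mul_comm]
  have : LW.real (Icc 0 M ×ˢ Icc (-R) R) ≤ |M| * (2 * |R|) := ENNReal.toReal_le_of_le_ofReal (by positivity) hv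
  calc _ ≤ |c| * LW.real (Icc 0 M ×ˢ Icc (-R) R) := by gcongr; exact le_abs_self c
    _ ≤ _ := by gcongr

lemma LW_pos : ∀ᵐ p ∂LW, (0:ℝ) < p.1 := by
  have : LW = volume.restrict (Ioi (0:ℝ) ×ˢ univ) := by
    rw [LW, Measure.volume_eq_prod, ← Measure.prod_restrict, Measure.restrict_univ]
  rw [this]
  exact (ae_restrict_mem (measurableSet_Ioi.prod MeasurableSet.univ)).mono fun p hp => hp.1

lemma Q_le_box (hQ : AssumptionA Q F e₀) : ∃ R B : ℝ, 0 < R ∧ 0 ≤ B ∧ (∀ z, Q z ≤ B) ∧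
    (∀ r M, 0 < r → R ^ 2 * r ^ 2 ≤ M → ∀ᵐ p ∂LW, ‖Q (pt r p.2 p.1)‖ ≤ (Icc 0 M ×ˢ Icc (-R) R).indicator (fun _ => B) p) ∧
    ∀ r w l, 0 < r → 0 ≤ l → Q (pt r w l) ≠ 0 → r ≤ R := by
  obtain ⟨R, hR, h⟩ := Q_supp hQ
  obtain ⟨B, hB0, hB⟩ := A_bdd hQ
  refine ⟨R, B, hR, hB0, hB, fun r M hr hM => ?_, fun r w l hr hl h' => (h r w l hr hl h').1⟩
  filter_upwards [LW_pos] with p hp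
  by_cases hz : Q (pt r p.2 p.1) = 0
  · rw [hz, norm_zero]; exact indicator_nonneg (fun _ _ => hB0) p
  · obtain ⟨_, h2, h3⟩ := h r p.2 p.1 hr hp.le hz
    have hmem : p ∈ Icc 0 M ×ˢ Icc (-R) R := ⟨⟨hp.le, h3.trans hM⟩, abs_le.1 h2⟩
    rw [indicator_of_mem hmem, Real.norm_of_nonneg (hQ.nonneg _)]
    exact hB _

lemma pt_meas2 (r : ℝ) : Measurable fun p : ℝ × ℝ => pt r p.2 p.1 :=
  measurable_pt' (by fun_prop) (by fun_prop) (by fun_prop)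

lemma TT_cont (hQ : AssumptionA Q F e₀) : ContinuousOn (TT Q) (Ioi 0) := by
  intro r0 hr0
  have hr0' : (0:ℝ) < r0 := hr0
  refine ContinuousAt.continuousWithinAt ?_
  obtain ⟨R, B, hR, hB0, hB, hbox, -⟩ := Q_le_box hQ
  refine continuousAt_of_dominated (bound := (Icc 0 (R ^ 2 * (2 * r0) ^ 2) ×ˢ Icc (-R) R).indicator fun _ => B) ?_ ?_ (box_int _ _ _).1 ?_
  · exact Eventually.of_forall fun r => ((A_nice hQ).meas.comp (pt_meas2 r)).aestronglyMeasurable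
  · filter_upwards [Ioo_mem_nhds hr0' (by linarith : r0 < 2 * r0)] with r hr
    exact hbox r _ hr.1 (by have := hr.1; have := hr.2.le; gcongr)
  · refine ae_of_all _ fun p => hQ.contQ.continuousAt.comp ?_
    unfold pt
    have : r0 ≠ 0 := hr0'.ne'
    fun_prop (disch := assumption)

lemma TT_integrable (hQ : AssumptionA Q F e₀) {r : ℝ} (hr : 0 < r) : Integrable (fun p => Q (pt r p.2 p.1)) LW := by
  obtain ⟨R, B, hR, hB0, hB, hbox, -⟩ := Q_le_box hQ
  exact Integrable.mono' (box_int B (R ^ 2 * r ^ 2) R).1 ((A_nice hQ).meas.comp (pt_meas2 r)).aestronglyMeasurable (hbox r _ hr le_rfl)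

lemma TT_nonneg (hQ : AssumptionA Q F e₀) (r : ℝ) : 0 ≤ TT Q r := integral_nonneg fun _ => hQ.nonneg _

lemma TT_lint (hQ : AssumptionA Q F e₀) {r : ℝ} (hr : 0 < r) :
    ENNReal.ofReal (TT Q r) = ∫⁻ l in Ioi (0:ℝ), ∫⁻ w, ENNReal.ofReal (Q (pt r w l)) := by
  have hm : Measurable fun p : ℝ × ℝ => ENNReal.ofReal (Q (pt r p.2 p.1)) := ((A_nice hQ).meas.comp (pt_meas2 r)).ennreal_ofReal
  rw [TT, ofReal_integral_eq_lintegral_ofReal (TT_integrable hQ hr) (ae_of_all _ fun _ => hQ.nonneg _), LW,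
    lintegral_prod _ hm.aemeasurable]

/-- bounds: `TT r ≤ C r ^ 2`, vanishing for large `r` -/
lemma TT_bd (hQ : AssumptionA Q F e₀) : ∃ K : ℝ, 0 ≤ K ∧ (∀ r, 0 < r → TT Q r * r ≤ K) ∧ ∀ r, 0 < r → TT Q r ≤ K * r ^ 2 := by
  obtain ⟨R, B, hR, hB0, hB, hbox, hz⟩ := Q_le_box hQ
  have h1 : ∀ r, 0 < r → TT Q r ≤ B * (R ^ 2 * (2 * R)) * r ^ 2 := by
    intro r hr
    have e := (box_int B (R ^ 2 * r ^ 2) R)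
    have : TT Q r ≤ ∫ p, (Icc 0 (R ^ 2 * r ^ 2) ×ˢ Icc (-R) R).indicator (fun _ => B) p ∂LW := by
      refine integral_mono_ae (TT_integrable hQ hr) e.1 ?_
      filter_upwards [hbox r _ hr le_rfl] with p hp
      exact (le_abs_self _).trans hp
    refine (this.trans e.2).trans (le_of_eq ?_)
    rw [abs_of_nonneg hB0, abs_of_pos hR, abs_of_nonneg (by positivity)]; ring
  refine ⟨B * (R ^ 2 * (2 * R)) + B * (R ^ 2 * (2 * R)) * R ^ 3, by positivity, fun r hr => ?_, fun r hr => (h1 r hr).trans (by gcongr; linarith [(by positivity : 0 ≤ B * (R ^ 2 * (2 * R)) * R ^ 3)])⟩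
  rcases le_or_gt r R with h | h
  · calc _ ≤ B * (R ^ 2 * (2 * R)) * r ^ 2 * r := by gcongr; exact h1 r hr
      _ = B * (R ^ 2 * (2 * R)) * r ^ 3 := by ring
      _ ≤ B * (R ^ 2 * (2 * R)) * R ^ 3 := by gcongr
      _ ≤ _ := by linarith [(by positivity : 0 ≤ B * (R ^ 2 * (2 * R)))]
  · have : TT Q r = 0 := by
      refine integral_eq_zero_of_ae ?_
      filter_upwards [LW_pos] with p hp
      by_contra hc
      exact absurd (hz r p.2 p.1 hr hp.le hc) (not_le.2 h)
    rw [this, zero_mul]; positivity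

lemma rad_int (hQ : AssumptionA Q F e₀) (ψ : ℝ → ℝ≥0∞) (hψ : Measurable ψ) :
    ∫⁻ z : Phase, ψ ‖z.1‖ * ENNReal.ofReal (Q z) = ∫⁻ r in Ioi (0:ℝ), ENNReal.ofReal (4 * π ^ 2) * (ψ r * ENNReal.ofReal (TT Q r)) := by
  have hN := A_nice hQ
  have hm : Measurable fun x : ℝ × ℝ × ℝ => ENNReal.ofReal (Q (pt x.1 x.2.2 x.2.1)) :=
    (hN.meas.comp (measurable_pt' (by fun_prop) (by fun_prop) (by fun_prop))).ennreal_ofReal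
  have hm2 : Measurable fun x : (ℝ × ℝ) × ℝ => ENNReal.ofReal (4 * π ^ 2) * (ψ ‖(pt x.1.2 x.2 x.1.1).1‖ * ENNReal.ofReal (Q (pt x.1.2 x.2 x.1.1))) := by
    have hp : Measurable fun x : (ℝ × ℝ) × ℝ => pt x.1.2 x.2 x.1.1 := measurable_pt' (by fun_prop) (by fun_prop) (by fun_prop)
    exact ((hψ.comp hp.fst.norm).mul (hN.meas.comp hp).ennreal_ofReal).const_mul _
  rw [disint (fun z => ψ ‖z.1‖ * ENNReal.ofReal (Q z)) ((hψ.comp measurable_fst.norm).mul hN.meas.ennreal_ofReal)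
    (fun R hR z => by simp only [LinearIsometryEquiv.norm_map]; rw [hN.sph R hR z])]
  rw [lintegral_lintegral_swap (hm2.lintegral_prod_right' (ν := volume)).aemeasurable]
  refine setLIntegral_congr_fun measurableSet_Ioi fun r hr => ?_
  have hr' : (0:ℝ) < r := hr
  rw [TT_lint hQ hr', ← lintegral_const_mul _ (Measurable.lintegral_prod_right' (f := fun x : ℝ × ℝ => ENNReal.ofReal (Q (pt r x.2 x.1))) (hm.comp (measurable_prodMk_left (x := r)))),
    ← lintegral_const_mul _ ((Measurable.lintegral_prod_right' (f := fun x : ℝ × ℝ => ENNReal.ofReal (Q (pt r x.2 x.1))) (hm.comp (measurable_prodMk_left (x := r)))).const_mul _)]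
  refine lintegral_congr fun l => ?_
  have hml : Measurable fun w => ENNReal.ofReal (Q (pt r w l)) := hm.comp (by fun_prop : Measurable fun w : ℝ => (r, l, w))
  rw [← lintegral_const_mul _ hml, ← lintegral_const_mul _ (hml.const_mul _)]
  refine lintegral_congr fun w => ?_
  rw [norm_pt1 hr']

def chi1 (Q : Phase → ℝ) (a : ℝ) : ℝ := -(nf Q a) / (4 * π)
def chi2 (Q : Phase → ℝ) (a : ℝ) : ℝ := π * TT Q (1 / a) / a ^ 2

lemma TT_ii (hQ : AssumptionA Q F e₀) {b : ℝ} (hb : 0 < b) : IntervalIntegrable (fun r => 4 * π ^ 2 * TT Q r) volume 0 b := by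
  obtain ⟨K, hK0, -, hK⟩ := TT_bd hQ
  rw [intervalIntegrable_iff_integrableOn_Ioc_of_le hb.le]
  refine Integrable.const_mul ?_ _
  refine IntegrableOn.of_bound (by simp) (((TT_cont hQ).mono Ioc_subset_Ioi_self).aestronglyMeasurable measurableSet_Ioc) (K * b ^ 2) ?_
  · refine (ae_restrict_mem measurableSet_Ioc).mono fun r hr => ?_
    rw [Real.norm_of_nonneg (TT_nonneg hQ r)]
    refine (hK r hr.1).trans ?_
    have := hr.1.le; have := hr.2
    gcongr

lemma nf_TT (hQ : AssumptionA Q F e₀) {a : ℝ} (ha : 0 < a) : nf Q a = ∫ r in (0:ℝ)..(1 / a), 4 * π ^ 2 * TT Q r := by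
  have hN := A_nice hQ
  have hb : 0 < 1 / a := by positivity
  rw [intervalIntegral.integral_of_le hb.le]
  have hi := (intervalIntegrable_iff_integrableOn_Ioc_of_le hb.le).1 (TT_ii hQ hb)
  have h0 : ∀ r, 0 ≤ 4 * π ^ 2 * TT Q r := fun r => mul_nonneg (by positivity) (TT_nonneg hQ r)
  have e : ENNReal.ofReal (nf Q a) = ENNReal.ofReal (∫ r in Ioc 0 (1 / a), 4 * π ^ 2 * TT Q r) := by
    rw [ofReal_integral_eq_lintegral_ofReal hi (ae_of_all _ h0), nf,
      ofReal_integral_eq_lintegral_ofReal (nf_integrable hN a) (ae_of_all _ fun z => mul_nonneg (hN.nn z) (by split_ifs <;> norm_num))]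
    have hψ : Measurable fun r : ℝ => if a < 1 / r then (1:ℝ≥0∞) else 0 :=
      Measurable.ite (measurableSet_lt measurable_const (by fun_prop : Measurable fun r : ℝ => 1 / r)) measurable_const measurable_const
    have := rad_int hQ _ hψ
    calc _ = ∫⁻ z : Phase, (if a < 1 / ‖z.1‖ then (1:ℝ≥0∞) else 0) * ENNReal.ofReal (Q z) := by
          refine lintegral_congr fun z => ?_
          split_ifs <;> simp
      _ = _ := this
      _ = ∫⁻ r in Ioi (0:ℝ), (Iio (1 / a)).indicator (fun r => ENNReal.ofReal (4 * π ^ 2 * TT Q r)) r := by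
          refine setLIntegral_congr_fun measurableSet_Ioi fun r hr => ?_
          have hr' : (0:ℝ) < r := hr
          have hiff : a < 1 / r ↔ r < 1 / a := lt_one_div ha hr'
          rw [indicator_apply]
          simp only [hiff, mem_Iio]
          split_ifs
          · rw [one_mul, ENNReal.ofReal_mul (p := 4 * π ^ 2) (by positivity)]
          · simp
      _ = ∫⁻ r in Ioo 0 (1 / a), ENNReal.ofReal (4 * π ^ 2 * TT Q r) := by
          rw [lintegral_indicator measurableSet_Iio, Measure.restrict_restrict measurableSet_Iio, inter_comm, Ioi_inter_Iio]
      _ = _ := by rw [restrict_Ioo_eq_restrict_Ioc]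
  have h1 : 0 ≤ nf Q a := nf_nonneg hN a
  exact (ENNReal.ofReal_eq_ofReal_iff h1 (integral_nonneg h0)).1 e

lemma chi1_deriv (hQ : AssumptionA Q F e₀) {a : ℝ} (ha : 0 < a) : HasDerivAt (chi1 Q) (chi2 Q a) a := by
  have hb : 0 < 1 / a := by positivity
  have hc : ContinuousOn (fun r => 4 * π ^ 2 * TT Q r) (Ioi 0) := (TT_cont hQ).const_mul _
  have h1 : HasDerivAt (fun b => ∫ r in (0:ℝ)..b, 4 * π ^ 2 * TT Q r) (4 * π ^ 2 * TT Q (1 / a)) (1 / a) :=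
    intervalIntegral.integral_hasDerivAt_right (TT_ii hQ hb) (hc.stronglyMeasurableAtFilter isOpen_Ioi _ hb)
      (hc.continuousAt (Ioi_mem_nhds hb))
  have h2 : HasDerivAt (fun a : ℝ => 1 / a) (-(1 / a ^ 2)) a := by
    have := hasDerivAt_inv ha.ne'
    simpa [one_div] using this
  have h3 := (((h1.comp a h2).neg).div_const (4 * π))
  have h4 : HasDerivAt (chi1 Q) (-(4 * π ^ 2 * TT Q (1 / a) * -(1 / a ^ 2)) / (4 * π)) a := by
    refine h3.congr_of_eventuallyEq ?_
    filter_upwards [Ioi_mem_nhds ha] with x hx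
    simp only [chi1, nf_TT hQ hx]
    rfl
  refine h4.congr_deriv ?_
  have := Real.pi_pos
  unfold chi2; field_simp

end M17

section M18

variable {Q f : Phase → ℝ} {F : ℝ → ℝ → ℝ} {e₀ : ℝ}

lemma nf_pos (hQ : AssumptionA Q F e₀) {z0 : Phase} (h : 0 < Q z0) (hx : 0 < ‖z0.1‖) {a : ℝ} (ha : a < 1 / ‖z0.1‖) : 0 < nf Q a := by
  have hN := A_nice hQ
  rw [nf, integral_pos_iff_support_of_nonneg (fun z => mul_nonneg (hN.nn z) (by split_ifs <;> norm_num)) (nf_integrable hN a)]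
  refine Measure.measure_pos_of_mem_nhds (x := z0) _ ?_
  have h1 : ∀ᶠ z in 𝓝 z0, 0 < Q z := hQ.contQ.continuousAt.eventually (lt_mem_nhds h)
  have hc : ContinuousAt (fun z : Phase => 1 / ‖z.1‖) z0 := continuousAt_const.div (by fun_prop) hx.ne'
  filter_upwards [h1, hc.eventually (lt_mem_nhds ha)] with z hz1 hz2
  rw [one_div] at hz2
  simp [hz2, hz1.ne']

lemma Q_iff (hQ : AssumptionA Q F e₀) {s l c0 : ℝ} (hl : 0 < l) (hc : ∀ e, s < F e l ↔ e < c0) {a : ℝ} (ha : 0 < a) (w : ℝ) :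
    s < Q (pt (1 / a) w l) ↔ w ^ 2 / 2 < c0 - chi Q a - l * a ^ 2 / 2 := by
  rw [Q_pt hQ (by positivity) w hl.le, hc]
  have e1 : l / (2 * (1 / a) ^ 2) = l * a ^ 2 / 2 := by field_simp
  have e2 : 1 / (1 / a) = a := by simp
  rw [e1, e2]
  constructor <;> intro h <;> linarith

def mm (Q : Phase → ℝ) (s l a : ℝ) : ℝ≥0∞ := volume {w | s < Q (pt (1 / a) w l)}

lemma mm_eq (hQ : AssumptionA Q F e₀) {s l c0 : ℝ} (hl : 0 < l) (hc : ∀ e, s < F e l ↔ e < c0) {a : ℝ} (ha : 0 < a) :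
    mm Q s l a = ENNReal.ofReal (2 * √2 * √(max (c0 - chi Q a - l * a ^ 2 / 2) 0)) := by
  rw [mm, ← slice_lt]
  simp only [Q_iff hQ hl hc ha]

lemma orbit_nf (hQ : AssumptionA Q F e₀) {s l c0 : ℝ} (hs : 0 < s) (hl : 0 < l) (hc : ∀ e, s < F e l ↔ e < c0) {a2 : ℝ} (ha : 0 < a2)
    (hy : c0 - chi Q a2 - l * a2 ^ 2 / 2 = 0) : ∃ p > a2, 0 < nf Q p := by
  have h1 : s ≤ F c0 l := by
    refine ge_of_tendsto ((F_cont hQ hl.le).continuousAt.mono_left nhdsWithin_le_nhds : Tendsto _ (𝓝[<] c0) _) ?_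
    filter_upwards [self_mem_nhdsWithin] with e he
    exact ((hc e).2 he).le
  have h2 : Q (pt (1 / a2) 0 l) = F c0 l := by
    rw [Q_pt hQ (by positivity) 0 hl.le]
    congr 1
    have e1 : l / (2 * (1 / a2) ^ 2) = l * a2 ^ 2 / 2 := by field_simp
    have e2 : 1 / (1 / a2) = a2 := by simp
    rw [e1, e2]; linarith
  have h3 : ContinuousAt (fun a => Q (pt (1 / a) 0 l)) a2 := by
    refine hQ.contQ.continuousAt.comp ?_
    unfold pt
    have : a2 ≠ 0 := ha.ne'
    have : (1 / a2) ≠ 0 := by positivity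
    fun_prop (disch := assumption)
  have h4 : ∀ᶠ a in 𝓝[>] a2, 0 < Q (pt (1 / a) 0 l) :=
    (h3.eventually (lt_mem_nhds (by rw [h2]; linarith : 0 < Q (pt (1 / a2) 0 l)))).filter_mono nhdsWithin_le_nhds
  obtain ⟨a', h5, h6⟩ := (h4.and self_mem_nhdsWithin).exists
  have h6' : a2 < a' := h6
  have ha' : 0 < a' := ha.trans h6'
  refine ⟨(a2 + a') / 2, by linarith, nf_pos hQ h5 ?_ ?_⟩
  · rw [norm_pt1 (by positivity)]; positivity
  · rw [norm_pt1 (by positivity)]; simp; linarith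

def MM (Q : Phase → ℝ) (a : ℝ) : ℝ := a * chi2 Q a - chi1 Q a

lemma chi1_meas (hQ : AssumptionA Q F e₀) : Measurable (chi1 Q) := by
  have := (nf_anti (A_nice hQ)).measurable
  unfold chi1; fun_prop

lemma TT_meas (hQ : AssumptionA Q F e₀) : Measurable (TT Q) := by
  have h : Measurable fun x : ℝ × ℝ × ℝ => Q (pt x.1 x.2.2 x.2.1) :=
    (A_nice hQ).meas.comp (measurable_pt' (by fun_prop) (by fun_prop) (by fun_prop))
  have hs : SFinite LW := by unfold LW; infer_instance
  exact (h.stronglyMeasurable.integral_prod_right' (ν := LW)).measurable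

lemma chi2_meas (hQ : AssumptionA Q F e₀) : Measurable (chi2 Q) := by
  have h := (TT_meas hQ).comp (by fun_prop : Measurable fun a : ℝ => 1 / a)
  exact (h.const_mul π).div (by fun_prop)

lemma chi2_nonneg (hQ : AssumptionA Q F e₀) (a : ℝ) : 0 ≤ chi2 Q a := by
  have := TT_nonneg hQ (1 / a)
  unfold chi2; positivity

lemma chi1_nonpos (hQ : AssumptionA Q F e₀) (a : ℝ) : 0 ≤ -chi1 Q a := by
  have := nf_nonneg (A_nice hQ) a
  unfold chi1; rw [neg_div, neg_neg]; positivity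

lemma chi1_mono (hQ : AssumptionA Q F e₀) : Monotone (chi1 Q) := by
  intro a b hab
  have := nf_anti (A_nice hQ) hab
  unfold chi1; gcongr

/-- weighted average bounds -/
lemma avg_bound {y H : ℝ → ℝ} {l a1 a2 : ℝ} (o : Orb y l a1 a2) (hH : Continuous H) :
    ∃ η, (∫ a in Ioo a1 a2, (H a - η) / (a ^ 2 * √(y a)) = 0) ∧ ∀ x c, (∀ b ∈ Ioo a1 a2, |x - H b| ≤ c) → |x - η| ≤ c := by
  set ω : ℝ → ℝ := fun a => 1 / (a ^ 2 * √(y a)) with hω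
  have hωi : IntegrableOn ω (Ioo a1 a2) := o.wt_int (k := fun _ => 1) continuous_const
  have hHi : IntegrableOn (fun a => H a * ω a) (Ioo a1 a2) := by
    have := o.wt_int hH
    refine this.congr (ae_of_all _ fun a => ?_)
    simp only [hω]; rw [mul_one_div]
  have hωp : ∀ a ∈ Ioo a1 a2, 0 < ω a := by
    intro a ha
    have h1 := Real.sqrt_pos.2 (o.sqrt_lo ha).1
    have h2 := o.p1.trans ha.1
    simp only [hω]; positivity
  have hpos : 0 < ∫ a in Ioo a1 a2, ω a := by
    rw [setIntegral_pos_iff_support_of_nonneg_ae ((ae_restrict_mem measurableSet_Ioo).mono fun a ha => (hωp a ha).le) hωi]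
    have : Function.support ω ∩ Ioo a1 a2 = Ioo a1 a2 := inter_eq_right.2 fun a ha => (hωp a ha).ne'
    rw [this, Real.volume_Ioo]; simpa using o.lt
  set W := ∫ a in Ioo a1 a2, ω a
  have key : ∀ x, ∫ a in Ioo a1 a2, (x - H a) * ω a = x * W - ∫ a in Ioo a1 a2, H a * ω a := by
    intro x
    simp only [sub_mul]
    rw [integral_sub (hωi.const_mul x) hHi, integral_const_mul]
  refine ⟨(∫ a in Ioo a1 a2, H a * ω a) / W, ?_, fun x c hc => ?_⟩
  · have := key ((∫ a in Ioo a1 a2, H a * ω a) / W)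
    rw [div_mul_cancel₀ _ hpos.ne', sub_self] at this
    rw [← neg_eq_zero, ← integral_neg, ← this]
    congr 1; ext a; simp only [hω]; ring
  · have e : x - (∫ a in Ioo a1 a2, H a * ω a) / W = (∫ a in Ioo a1 a2, (x - H a) * ω a) / W := by
      rw [key]; field_simp
    rw [e, abs_div, abs_of_pos hpos, div_le_iff₀ hpos]
    have h1 : ∫ a in Ioo a1 a2, c * ω a = c * W := integral_const_mul _ _
    rw [← h1, ← Real.norm_eq_abs]
    refine norm_integral_le_of_norm_le (hωi.const_mul c) ((ae_restrict_mem measurableSet_Ioo).mono fun a ha => ?_)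
    rw [norm_mul, Real.norm_of_nonneg (hωp a ha).le, Real.norm_eq_abs]
    exact mul_le_mul_of_nonneg_right (hc a ha) (hωp a ha).le

theorem good_orbit (hQ : AssumptionA Q F e₀) {A0 A2 β : ℝ} (hA : 0 < A0) (hA2 : A0 ≤ A2) (hβ : 0 < β) :
    ∃ C, 0 ≤ C ∧ ∀ f, Nice f → dd f Q ≤ 1 → 2 * dd f Q / (β * √β) ≤ A0 / 2 → dd f Q * √A2 ≤ -e₀ →
      ∀ s l c0 a1 a2, 0 < s → 0 < l → (∀ e, s < F e l ↔ e < c0) → c0 ≤ e₀ →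
      Orb (fun a => c0 - chi Q a - l * a ^ 2 / 2) l a1 a2 → c0 - chi Q a2 - l * a2 ^ 2 / 2 = 0 →
      A0 ≤ a1 → a2 ≤ A2 → β ≤ l → β ≤ a2 - a1 →
      ∃ η, c0 + η ≤ 0 ∧ ∫⁻ a in Ioi (0:ℝ), ENNReal.ofReal (1 / a ^ 2) *
        ENNReal.ofReal (Vf (c0 - chi Q a - l * a ^ 2 / 2) (chi f a - chi Q a - η)) ≤
        (∫⁻ a in Ioo a1 a2, ENNReal.ofReal (Hp f Q a ^ 2 / (2 * (a * MM Q a))) * mm Q s l a)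
         + ENNReal.ofReal (C * (dd f Q ^ 2 * √√(dd f Q))) := by
  obtain ⟨C, hC, hgc⟩ := good_cost hA hA2 hβ
  refine ⟨C, hC, fun f hf hd1 hd2 hd3 s l c0 a1 a2 hs hl hc hc0 o hy2 h1 h2 h3 h4 => ?_⟩
  have hN := A_nice hQ
  have hd0 : 0 ≤ dd f Q := Real.sqrt_nonneg _
  have ha1 := o.p1
  have h12 := o.lt
  have ha2 : 0 < a2 := ha1.trans h12
  obtain ⟨η, h0, hη⟩ := avg_bound o (Hf_cont hf hN)
  have hηb : |η| ≤ dd f Q * √A2 := by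
    have := hη 0 (dd f Q * √A2) fun b hb => by
      rw [zero_sub, abs_neg]
      refine (Hf_le hf hN (ha1.trans hb.1).le).trans ?_
      gcongr; linarith [hb.2]
    rwa [zero_sub, abs_neg] at this
  refine ⟨η, by linarith [le_abs_self η], ?_⟩
  refine (hgc (fun a => c0 - chi Q a - l * a ^ 2 / 2) (Hf f Q) l a1 a2 (dd f Q) η o h1 h2 h3 h4 hd0 hd1 hd2 ?_ ?_ ?_).trans ?_
  · intro a ha
    refine hη _ _ fun b hb => (Hf_holder hf hN (ha1.le.trans ha.1) (ha1.trans hb.1).le).trans ?_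
    gcongr
    rw [abs_le]; constructor <;> linarith [hb.1, hb.2, ha.1, ha.2]
  · intro a ha
    refine hη _ _ fun b hb => (Hf_holder hf hN (ha2.le.trans ha) (ha1.trans hb.1).le).trans ?_
    gcongr
    rw [abs_le]; constructor <;> linarith [hb.1, hb.2]
  · intro a ha0 ha
    refine hη _ _ fun b hb => (Hf_holder hf hN ha0.le (ha1.trans hb.1).le).trans ?_
    gcongr
    rw [abs_le]; constructor <;> linarith [hb.1, hb.2]
  refine add_le_add ?_ le_rfl
  obtain ⟨p, hp, hnf⟩ := orbit_nf hQ hs hl hc ha2 hy2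
  have hm0 : 0 < -chi1 Q p := by unfold chi1; rw [neg_div, neg_neg]; positivity
  have hMeq : ∀ a, (-chi1 Q a - l * a) - a * (-chi2 Q a - l) = MM Q a := fun a => by unfold MM; ring
  have hMle : ∀ a ∈ Ioo a1 a2, -chi1 Q p ≤ MM Q a := by
    intro a ha
    have e1 := chi1_mono hQ (show a ≤ p by linarith [ha.2])
    have e2 := mul_nonneg (ha1.trans ha.1).le (chi2_nonneg hQ a)
    unfold MM; linarith
  have hP := o.poincare (y1 := fun a => -chi1 Q a - l * a) (y2 := fun a => -chi2 Q a - l) (k := fun a => Hf f Q a - η) (k1 := Hp f Q)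
    (B1 := -chi1 Q a1 + l * a2) (m0 := -chi1 Q p) ?_ ?_ ?_ (fun a => (Hf_deriv hf hN a).sub_const η) ((Hp_sq_int hf hN).mono_set fun a ha => ha1.trans ha.1) hm0
    (fun a ha => by rw [hMeq]; exact hMle a ha) (by have := chi1_meas hQ; fun_prop) (by have := chi2_meas hQ; fun_prop) h0
  · simp only [hMeq] at hP
    have hI1 := o.wt_int (k := fun a => (Hf f Q a - η) ^ 2) (by have := Hf_cont hf hN; fun_prop)
    have hnn : ∀ a ∈ Ioo a1 a2, 0 ≤ Hp f Q a ^ 2 * (√(c0 - chi Q a - l * a ^ 2 / 2) / (a * MM Q a)) := by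
      intro a ha
      have := ha1.trans ha.1
      have := hm0.trans_le (hMle a ha)
      positivity
    calc _ = ENNReal.ofReal (∫ a in Ioo a1 a2, √2 / 2 * ((Hf f Q a - η) ^ 2 / (a ^ 2 * √(c0 - chi Q a - l * a ^ 2 / 2)))) := by
          rw [ofReal_integral_eq_lintegral_ofReal (hI1.const_mul _) (ae_of_all _ fun a => by positivity)]
      _ ≤ ENNReal.ofReal (√2 * ∫ a in Ioo a1 a2, Hp f Q a ^ 2 * (√(c0 - chi Q a - l * a ^ 2 / 2) / (a * MM Q a))) := by
          apply ENNReal.ofReal_le_ofReal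
          rw [integral_const_mul]
          have := mul_le_mul_of_nonneg_left hP (by positivity : 0 ≤ √2 / 2)
          linarith
      _ ≤ ∫⁻ a in Ioo a1 a2, ENNReal.ofReal (√2 * (Hp f Q a ^ 2 * (√(c0 - chi Q a - l * a ^ 2 / 2) / (a * MM Q a)))) := by
          rw [← integral_const_mul]
          by_cases hi : IntegrableOn (fun a => √2 * (Hp f Q a ^ 2 * (√(c0 - chi Q a - l * a ^ 2 / 2) / (a * MM Q a)))) (Ioo a1 a2)
          · exact (ofReal_integral_eq_lintegral_ofReal hi ((ae_restrict_mem measurableSet_Ioo).mono fun a ha => mul_nonneg (by positivity) (hnn a ha))).le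
          · rw [integral_undef hi]; simp
      _ = _ := by
          refine setLIntegral_congr_fun measurableSet_Ioo fun a ha => ?_
          have h3 := ha1.trans ha.1
          have hMp := hm0.trans_le (hMle a ha)
          have hy := (o.sqrt_lo ha).1
          rw [mm_eq hQ hl hc h3, max_eq_left hy.le, ← ENNReal.ofReal_mul (by positivity)]
          congr 1
          field_simp
  · intro a ha
    refine (((chi_hasDerivAt hN a).const_sub c0).sub ((((hasDerivAt_id a).pow 2).const_mul l).div_const 2)).congr_deriv ?_
    simp only [chi1, id]; ring
  · intro a ha
    refine (((chi1_deriv hQ (ha1.trans ha.1)).neg).sub ((hasDerivAt_id a).const_mul l)).congr_deriv ?_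
    simp
  · intro a ha
    have e1 := chi1_mono hQ ha.1.le
    have e2 := chi1_nonpos hQ a
    have e3 : 0 ≤ l * a := mul_nonneg hl.le (ha1.trans ha.1).le
    have e4 : l * a ≤ l * a2 := mul_le_mul_of_nonneg_left ha.2.le hl.le
    rw [abs_le]; constructor <;> linarith [chi1_nonpos hQ a1]

end M18

section M19

variable {Q f : Phase → ℝ} {F : ℝ → ℝ → ℝ} {e₀ : ℝ}

lemma main_fn (hQ : AssumptionA Q F e₀) {h : ℝ → ℝ} (hm : Measurable h) :
    ∃ Gm : ℝ × ℝ → ℝ≥0∞, Measurable Gm ∧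
      (∀ q, Gm q = ENNReal.ofReal (4 * π ^ 2) * ∫⁻ a in Ioi (0:ℝ), ENNReal.ofReal (h a) * mm Q q.1 q.2 a) ∧
      ∫⁻ q, Gm q ∂SL = ENNReal.ofReal (4 * π ^ 2) * ∫⁻ a in Ioi (0:ℝ), ENNReal.ofReal (h a) * ENNReal.ofReal (TT Q (1 / a)) := by
  have hN := A_nice hQ
  set ψ : ℝ → ℝ := fun r => h (1 / r) * (1 / r ^ 2) with hψ
  have hψm : Measurable ψ := (hm.comp (by fun_prop : Measurable fun r : ℝ => 1 / r)).mul (by fun_prop)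
  have hφm : Measurable fun z : Phase => ψ ‖z.1‖ := hψm.comp (by fun_prop)
  have hinv : ∀ a ∈ Ioi (0:ℝ), ENNReal.ofReal (1 / a ^ 2) * ENNReal.ofReal (ψ (1 / a)) = ENNReal.ofReal (h a) := by
    intro a ha
    have ha' : 0 < a := ha
    rw [← ENNReal.ofReal_mul (by positivity)]
    congr 1
    simp only [hψ]; field_simp
  refine ⟨fun q => ∫⁻ p, ENNReal.ofReal (ψ ‖(pt p.1 p.2 q.2).1‖) * (if q.1 < Q (pt p.1 p.2 q.2) then 1 else 0) ∂LM,
    (ind_meas hφm hN.meas).lintegral_prod_right' (ν := LM), fun q => ?_, ?_⟩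
  · have h0 := (ind_meas hφm hN.meas).comp (measurable_prodMk_left (x := q))
    beta_reduce
    rw [LM_lint (fun p => ENNReal.ofReal (ψ ‖(pt p.1 p.2 q.2).1‖) * (if q.1 < Q (pt p.1 p.2 q.2) then 1 else 0)) h0, inv_lint]
    congr 1
    refine setLIntegral_congr_fun measurableSet_Ioi fun a ha => ?_
    have ha' : 0 < a := ha
    have hset : MeasurableSet {w | q.1 < Q (pt (1 / a) w q.2)} :=
      measurableSet_lt measurable_const (hN.meas.comp (measurable_pt' (by fun_prop) (by fun_prop) (by fun_prop)))
    simp only [norm_pt1 (show 0 < 1 / a by positivity)]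
    have e : (fun w => if q.1 < Q (pt (1 / a) w q.2) then (1:ℝ≥0∞) else 0) = {w | q.1 < Q (pt (1 / a) w q.2)}.indicator 1 := by
      funext w; simp [indicator_apply]
    rw [lintegral_const_mul' _ _ ENNReal.ofReal_ne_top, e, lintegral_indicator_one hset, ← mul_assoc, hinv a ha]
    rfl
  · rw [← layer hφm (fun R hR z => by simp) hN.meas hN.sph, rad_int hQ (fun r => ENNReal.ofReal (ψ r)) hψm.ennreal_ofReal,
      lintegral_const_mul' _ _ ENNReal.ofReal_ne_top, inv_lint]
    congr 1
    refine setLIntegral_congr_fun measurableSet_Ioi fun a ha => ?_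
    rw [← mul_assoc, hinv a ha]

lemma Orb.mem_of_pos {y : ℝ → ℝ} {l a1 a2 : ℝ} (o : Orb y l a1 a2) {a : ℝ} (h : 0 < y a) : a ∈ Ioo a1 a2 := by
  have hl := o.l0
  have hlt := o.lt
  by_contra hn
  have h1 : a ≤ a1 ∨ a2 ≤ a := by
    by_contra h2; push Not at h2; exact hn h2
  have h2 := o.hi a h1
  have h3 : (a - a1) * (a2 - a) ≤ 0 := by
    rcases h1 with h1 | h1
    · exact mul_nonpos_of_nonpos_of_nonneg (by linarith) (by linarith)
    · exact mul_nonpos_of_nonneg_of_nonpos (by linarith) (by linarith)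
  have h4 := mul_nonpos_of_nonneg_of_nonpos (by positivity : 0 ≤ l / 2) h3
  linarith

def q0 (Q : Phase → ℝ) (p : ℚ) (l : ℝ) : ℝ := Q (pt (1 / (p:ℝ)) 0 l)

lemma q0_meas (hQ : AssumptionA Q F e₀) (p : ℚ) : Measurable (fun q : ℝ × ℝ => q0 Q p q.2) :=
  (A_nice hQ).meas.comp (measurable_pt' (by fun_prop) (by fun_prop) (by fun_prop))

lemma q0_iff (hQ : AssumptionA Q F e₀) {s l c0 : ℝ} (hl : 0 < l) (hc : ∀ e, s < F e l ↔ e < c0) {p : ℚ} (hp : 0 < p) :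
    s < q0 Q p l ↔ 0 < c0 - chi Q p - l * (p:ℝ) ^ 2 / 2 := by
  have hp' : (0:ℝ) < p := by exact_mod_cast hp
  rw [q0, Q_iff hQ hl hc hp']; simp

def Act (Q : Phase → ℝ) : Set (ℝ × ℝ) := {q | 0 < q.1 ∧ 0 < q.2 ∧ ∃ p : ℚ, 0 < p ∧ q.1 < q0 Q p q.2}

def Wn (Q : Phase → ℝ) (n : ℕ) : Set (ℝ × ℝ) := {q | 1 / ((n:ℝ) + 1) ≤ q.2 ∧ ∃ p p' p'' : ℚ, (0 < p ∧ p < p' ∧ p < p'' ∧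
  1 / ((n:ℝ) + 1) ≤ p' - p ∧ 1 / ((n:ℝ) + 1) ≤ -chi1 Q p'') ∧ q.1 < q0 Q p q.2 ∧ q.1 < q0 Q p' q.2 ∧ q0 Q p'' q.2 ≤ q.1}

lemma Act_meas (hQ : AssumptionA Q F e₀) : MeasurableSet (Act Q) := by
  have e : Act Q = ({q | 0 < q.1} ∩ {q | 0 < q.2}) ∩ ⋃ p : ℚ, {q | 0 < p} ∩ {q : ℝ × ℝ | q.1 < q0 Q p q.2} := by
    ext q; simp [Act, and_assoc]
  rw [e]
  refine MeasurableSet.inter ((measurableSet_lt measurable_const measurable_fst).inter (measurableSet_lt measurable_const measurable_snd)) ?_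
  exact MeasurableSet.iUnion fun p => (MeasurableSet.const _).inter (measurableSet_lt measurable_fst (q0_meas hQ p))

lemma Wn_meas (hQ : AssumptionA Q F e₀) (n : ℕ) : MeasurableSet (Wn Q n) := by
  refine MeasurableSet.inter (measurableSet_le measurable_const measurable_snd) ?_
  change MeasurableSet {q : ℝ × ℝ | ∃ p p' p'' : ℚ, (0 < p ∧ p < p' ∧ p < p'' ∧
    1 / ((n:ℝ) + 1) ≤ p' - p ∧ 1 / ((n:ℝ) + 1) ≤ -chi1 Q p'') ∧ q.1 < q0 Q p q.2 ∧ q.1 < q0 Q p' q.2 ∧ q0 Q p'' q.2 ≤ q.1}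
  simp only [ofPred_exists]
  refine MeasurableSet.iUnion fun p => MeasurableSet.iUnion fun p' => MeasurableSet.iUnion fun p'' => ?_
  exact (MeasurableSet.const _).inter ((measurableSet_lt measurable_fst (q0_meas hQ p)).inter
    ((measurableSet_lt measurable_fst (q0_meas hQ p')).inter (measurableSet_le (q0_meas hQ p'') measurable_fst)))

lemma Wn_mono (Q : Phase → ℝ) : Monotone (Wn Q) := by
  intro n m hnm q hq
  obtain ⟨h1, p, p', p'', ⟨h2, h3, h4, h5, h6⟩, h7⟩ := hq
  have : 1 / ((m:ℝ) + 1) ≤ 1 / ((n:ℝ) + 1) := by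
    have : (n:ℝ) ≤ m := by exact_mod_cast hnm
    gcongr
  exact ⟨this.trans h1, p, p', p'', ⟨h2, h3, h4, this.trans h5, this.trans h6⟩, h7⟩

lemma Act_of_orb (hQ : AssumptionA Q F e₀) {s l c0 a1 a2 : ℝ} (hs : 0 < s) (hl : 0 < l) (hc : ∀ e, s < F e l ↔ e < c0)
    (o : Orb (fun a => c0 - chi Q a - l * a ^ 2 / 2) l a1 a2) : (s, l) ∈ Act Q := by
  obtain ⟨p, hp1, hp2⟩ := exists_rat_btwn o.lt
  have hp : 0 < p := by exact_mod_cast o.p1.trans hp1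
  exact ⟨hs, hl, p, hp, (q0_iff hQ hl hc hp).2 (o.sqrt_lo ⟨hp1, hp2⟩).1⟩

lemma orb_exists' (hQ : AssumptionA Q F e₀) {Φ A0 : ℝ} (hΦ : ∀ a, -Φ ≤ chi Q a) (hA : A0 * (mass Q + 1) = 4 * π * (-e₀))
    {c0 l : ℝ} (hl : 0 < l) (hc : c0 ≤ e₀) (hex : ∃ a > 0, 0 < c0 - chi Q a - l * a ^ 2 / 2) :
    ∃ a1 a2, Orb (fun a => c0 - chi Q a - l * a ^ 2 / 2) l a1 a2 ∧ c0 - chi Q a2 - l * a2 ^ 2 / 2 = 0 ∧ A0 ≤ a1 ∧ l * a2 ^ 2 ≤ 2 * Φ := by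
  obtain ⟨a1, a2, o, -, h2, h3, h4⟩ := orb_exists hQ hΦ hl hc hex
  refine ⟨a1, a2, o, h2, ?_, h4⟩
  have := mass_nonneg (A_nice hQ)
  have := o.p1
  refine le_of_mul_le_mul_right (a := mass Q + 1) ?_ (by linarith)
  linarith

lemma Act_orb (hQ : AssumptionA Q F e₀) {Φ A0 : ℝ} (hΦ : ∀ a, -Φ ≤ chi Q a) (hA : A0 * (mass Q + 1) = 4 * π * (-e₀))
    {q : ℝ × ℝ} (hq : q ∈ Act Q) : ∃ c0 a1 a2, (∀ e, q.1 < F e q.2 ↔ e < c0) ∧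
      Orb (fun a => c0 - chi Q a - q.2 * a ^ 2 / 2) q.2 a1 a2 ∧ c0 - chi Q a2 - q.2 * a2 ^ 2 / 2 = 0 ∧ A0 ≤ a1 ∧ q.2 * a2 ^ 2 ≤ 2 * Φ := by
  obtain ⟨hs, hl, p, hp, hpq⟩ := hq
  have hp' : (0:ℝ) < p := by exact_mod_cast hp
  have h1 := hpq
  rw [q0, Q_pt hQ (by positivity) 0 hl.le] at h1
  obtain ⟨c0, h2, hc⟩ := exists_c0 hQ hs.le hl.le ⟨_, h1⟩
  obtain ⟨a1, a2, h⟩ := orb_exists' hQ hΦ hA hl h2 ⟨p, hp', (q0_iff hQ hl hc hp).1 hpq⟩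
  exact ⟨c0, a1, a2, hc, h⟩

lemma Act_Wn (hQ : AssumptionA Q F e₀) {Φ A0 : ℝ} (hΦ : ∀ a, -Φ ≤ chi Q a) (hA : A0 * (mass Q + 1) = 4 * π * (-e₀))
    {q : ℝ × ℝ} (hq : q ∈ Act Q) : ∃ n, q ∈ Wn Q n := by
  obtain ⟨c0, a1, a2, hc, o, h2, -, -⟩ := Act_orb hQ hΦ hA hq
  obtain ⟨hs, hl, -⟩ := hq
  obtain ⟨p, hp1, hp2⟩ := exists_rat_btwn o.lt
  obtain ⟨p', hp3, hp4⟩ := exists_rat_btwn hp2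
  obtain ⟨b, hb, hnb⟩ := orbit_nf hQ hs hl hc (o.p1.trans o.lt) h2
  obtain ⟨p'', hp5, hp6⟩ := exists_rat_btwn hb
  have hp0 : (0:ℝ) < p := o.p1.trans hp1
  have hm0 : 0 < -chi1 Q p'' := by
    have := chi1_mono hQ hp6.le
    have : 0 < -chi1 Q b := by unfold chi1; rw [neg_div, neg_neg]; positivity
    linarith
  have hpp : p < p' := by exact_mod_cast hp3
  have hpp2 : (p:ℝ) < p'' := hp2.trans hp5
  obtain ⟨n, hn⟩ := exists_nat_one_div_lt (show 0 < min q.2 (min ((p':ℝ) - p) (-chi1 Q p'')) from lt_min hl (lt_min (by linarith) hm0))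
  rw [lt_min_iff, lt_min_iff] at hn
  refine ⟨n, hn.1.le, p, p', p'', ⟨by exact_mod_cast hp0, hpp, by exact_mod_cast hpp2, hn.2.1.le, hn.2.2.le⟩, ?_, ?_, ?_⟩
  · exact (q0_iff hQ hl hc (by exact_mod_cast hp0)).2 (o.sqrt_lo ⟨hp1, hp2⟩).1
  · exact (q0_iff hQ hl hc (by exact_mod_cast hp0.trans hp3)).2 (o.sqrt_lo ⟨hp1.trans hp3, hp4⟩).1
  · rw [← not_lt, q0_iff hQ hl hc (by exact_mod_cast hp0.trans hpp2)]
    intro h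
    have := o.mem_of_pos h
    linarith [this.2]

lemma Wn_orb (hQ : AssumptionA Q F e₀) {s l c0 a1 a2 : ℝ} {n : ℕ} (hl : 0 < l) (hc : ∀ e, s < F e l ↔ e < c0)
    (o : Orb (fun a => c0 - chi Q a - l * a ^ 2 / 2) l a1 a2) (hW : (s, l) ∈ Wn Q n) :
    1 / ((n:ℝ) + 1) ≤ l ∧ 1 / ((n:ℝ) + 1) ≤ a2 - a1 ∧ ∀ a ∈ Ioo a1 a2, 1 / ((n:ℝ) + 1) ≤ -chi1 Q a := by
  obtain ⟨h1, p, p', p'', ⟨h2, h3, h4, h5, h6⟩, h7, h8, h9⟩ := hW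
  have e1 := o.mem_of_pos ((q0_iff hQ hl hc h2).1 h7)
  have e2 := o.mem_of_pos ((q0_iff hQ hl hc (h2.trans h3)).1 h8)
  have e3 : a2 ≤ p'' := by
    by_contra hn
    push Not at hn
    have h4' : (p:ℝ) < p'' := by exact_mod_cast h4
    have := (o.sqrt_lo (a := p'') ⟨e1.1.trans h4', hn⟩).1
    exact absurd ((q0_iff hQ hl hc (h2.trans h4)).2 this) (not_lt.2 h9)
  refine ⟨h1, by linarith [e1.1, e2.2], fun a ha => ?_⟩
  have := chi1_mono hQ (ha.2.le.trans e3)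
  linarith

def Wl (Φ l : ℝ) : ℝ := l ^ (-(1/2) : ℝ) + (2 * Φ) ^ (3/8 : ℝ) * l ^ (-(7/8) : ℝ)

lemma Wl_meas (Φ : ℝ) : Measurable (Wl Φ) := by unfold Wl; fun_prop

lemma Wl_le {Φ l x a2 : ℝ} (hΦ : 0 ≤ Φ) (hl : 0 < l) (hx0 : 0 ≤ x) (hx : x ≤ a2) (h : l * a2 ^ 2 ≤ 2 * Φ) :
    1 / √l * (1 + √x * √√x) ≤ Wl Φ l := by
  have h1 : 1 / √l = l ^ (-(1/2) : ℝ) := by rw [Real.sqrt_eq_rpow, Real.rpow_neg hl.le, one_div]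
  have h2 : √x * √√x = x ^ (3/4 : ℝ) := by
    simp only [Real.sqrt_eq_rpow]
    rw [← Real.rpow_mul hx0, ← Real.rpow_add_of_nonneg hx0 (by norm_num) (by norm_num)]; norm_num
  have h3 : x ^ (3/4 : ℝ) ≤ (2 * Φ) ^ (3/8 : ℝ) * l ^ (-(3/8) : ℝ) := by
    have e : x ^ (3/4 : ℝ) = (x ^ 2) ^ (3/8 : ℝ) := by
      rw [← Real.rpow_natCast x 2, ← Real.rpow_mul hx0]; norm_num
    rw [e, Real.rpow_neg hl.le, ← div_eq_mul_inv, ← Real.div_rpow (by positivity) hl.le]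
    apply Real.rpow_le_rpow (by positivity) _ (by norm_num)
    rw [le_div_iff₀ hl]
    have : x ^ 2 ≤ a2 ^ 2 := by gcongr
    nlinarith
  have h4 : l ^ (-(1/2) : ℝ) * l ^ (-(3/8) : ℝ) = l ^ (-(7/8) : ℝ) := by
    rw [← Real.rpow_add hl]; norm_num
  have h5 : 0 < l ^ (-(1/2) : ℝ) := Real.rpow_pos_of_pos hl _
  rw [h1, h2]; unfold Wl
  calc _ ≤ l ^ (-(1/2) : ℝ) * (1 + (2 * Φ) ^ (3/8 : ℝ) * l ^ (-(3/8) : ℝ)) := by gcongr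
    _ = _ := by rw [← h4]; ring

lemma Wl_int (Φ L : ℝ) (hL : 0 ≤ L) : IntegrableOn (Wl Φ) (Ioc 0 L) := by
  rw [← intervalIntegrable_iff_integrableOn_Ioc_of_le hL]
  exact (intervalIntegral.intervalIntegrable_rpow' (by norm_num)).add ((intervalIntegral.intervalIntegrable_rpow' (by norm_num)).const_mul _)

lemma Act_sub (hQ : AssumptionA Q F e₀) {Φ A0 B : ℝ} (hΦ : ∀ a, -Φ ≤ chi Q a) (hA : A0 * (mass Q + 1) = 4 * π * (-e₀))
    (hA0 : 0 < A0) (hB : ∀ z, Q z ≤ B) : Act Q ⊆ Ioc 0 B ×ˢ Ioc 0 (2 * Φ / A0 ^ 2) := by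
  intro q hq
  obtain ⟨c0, a1, a2, hc, o, h2, h3, h4⟩ := Act_orb hQ hΦ hA hq
  obtain ⟨hs, hl, p, hp, hpq⟩ := hq
  have h5 : q.2 ≤ 2 * Φ / A0 ^ 2 := by
    rw [le_div_iff₀ (by positivity)]
    refine le_trans ?_ h4
    have := o.lt
    gcongr; linarith
  exact ⟨⟨hs, hpq.le.trans (hB _)⟩, ⟨hl, h5⟩⟩

def bn (Q : Phase → ℝ) (Φ : ℝ) (n : ℕ) : ℝ≥0∞ := ∫⁻ q in Act Q \ Wn Q n, ENNReal.ofReal (Wl Φ q.2) ∂SL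

lemma bn_top (hQ : AssumptionA Q F e₀) {Φ A0 : ℝ} (hΦ0 : 0 ≤ Φ) (hΦ : ∀ a, -Φ ≤ chi Q a) (hA : A0 * (mass Q + 1) = 4 * π * (-e₀))
    (hA0 : 0 < A0) : ∫⁻ q in Act Q, ENNReal.ofReal (Wl Φ q.2) ∂SL ≠ ⊤ := by
  obtain ⟨B, hB0, hB⟩ := A_bdd hQ
  refine ne_top_of_le_ne_top ?_ (lintegral_mono_set (Act_sub hQ hΦ hA hA0 hB))
  refine ne_top_of_le_ne_top ?_ (lintegral_mono' (Measure.restrict_mono_measure (SL_eq.trans_le Measure.restrict_le_self) _) le_rfl)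
  rw [Measure.volume_eq_prod, ← Measure.prod_restrict, lintegral_prod _ (by have := Wl_meas Φ; fun_prop)]
  simp only [lintegral_const]
  have := (Wl_int Φ (2 * Φ / A0 ^ 2) (by positivity)).lintegral_lt_top
  refine ENNReal.mul_ne_top this.ne (by simp)

lemma bn_tendsto (hQ : AssumptionA Q F e₀) {Φ A0 : ℝ} (hΦ0 : 0 ≤ Φ) (hΦ : ∀ a, -Φ ≤ chi Q a) (hA : A0 * (mass Q + 1) = 4 * π * (-e₀))
    (hA0 : 0 < A0) : Tendsto (bn Q Φ) atTop (𝓝 0) := by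
  set ν := SL.withDensity (fun q => ENNReal.ofReal (Wl Φ q.2)) with hν
  have hb : ∀ n, bn Q Φ n = ν (Act Q \ Wn Q n) := fun n => by
    rw [hν, withDensity_apply _ ((Act_meas hQ).diff (Wn_meas hQ n)), bn]
  have hI : ⋂ n, (Act Q \ Wn Q n) = ∅ := by
    rw [eq_empty_iff_forall_notMem]
    intro q hq
    rw [mem_iInter] at hq
    obtain ⟨n, hn⟩ := Act_Wn hQ hΦ hA (hq 0).1
    exact (hq n).2 hn
  have := tendsto_measure_iInter_atTop (μ := ν) (s := fun n => Act Q \ Wn Q n)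
    (fun n => ((Act_meas hQ).diff (Wn_meas hQ n)).nullMeasurableSet) (fun n m hnm => sdiff_subset_sdiff_right (Wn_mono Q hnm))
    ⟨0, by
      refine ne_top_of_le_ne_top (bn_top hQ hΦ0 hΦ hA hA0) ?_
      rw [← hb, bn]; exact lintegral_mono_set sdiff_subset⟩
  rw [hI, measure_empty] at this
  exact this.congr fun n => (hb n).symm

end M19

section M20

variable {Q f : Phase → ℝ} {F : ℝ → ℝ → ℝ} {e₀ : ℝ}

def K1 (A0 : ℝ) : ℝ := 4 * π ^ 2 * (256 * ((1 + 1 / A0) / A0))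

lemma SL_Act (hQ : AssumptionA Q F e₀) {Φ A0 B : ℝ} (hΦ : ∀ a, -Φ ≤ chi Q a) (hA : A0 * (mass Q + 1) = 4 * π * (-e₀))
    (hA0 : 0 < A0) (hB0 : 0 ≤ B) (hB : ∀ z, Q z ≤ B) : SL (Act Q) ≤ ENNReal.ofReal (B * (2 * Φ / A0 ^ 2)) := by
  refine (measure_mono (Act_sub hQ hΦ hA hA0 hB)).trans ?_
  refine ((SL_eq.trans_le Measure.restrict_le_self) _).trans ?_
  rw [Measure.volume_eq_prod, Measure.prod_prod, Real.volume_Ioc, Real.volume_Ioc, sub_zero, sub_zero, ENNReal.ofReal_mul hB0]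

lemma small_d {β A0 A2 E Y τ : ℝ} (hβ : 0 < β) (hA : 0 < A0) (hE : 0 < E) (hτ : 0 < τ) :
    ∃ dn > 0, ∀ d, 0 ≤ d → d ≤ dn → d ≤ 1 ∧ 2 * d / (β * √β) ≤ A0 / 2 ∧ d * √A2 ≤ E ∧ Y * √√d ≤ τ := by
  have h1 : ∀ᶠ d : ℝ in 𝓝 0, 2 * d / (β * √β) < A0 / 2 :=
    ((by fun_prop : Continuous fun d : ℝ => 2 * d / (β * √β)).tendsto' 0 0 (by simp)).eventually (gt_mem_nhds (by positivity))
  have h2 : ∀ᶠ d : ℝ in 𝓝 0, d * √A2 < E :=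
    ((by fun_prop : Continuous fun d : ℝ => d * √A2).tendsto' 0 0 (by simp)).eventually (gt_mem_nhds hE)
  have h3 : ∀ᶠ d : ℝ in 𝓝 0, Y * √√d < τ :=
    ((by fun_prop : Continuous fun d : ℝ => Y * √√d).tendsto' 0 0 (by simp)).eventually (gt_mem_nhds hτ)
  obtain ⟨ε, hε, h⟩ := Metric.eventually_nhds_iff.1 ((h1.and h2).and h3)
  refine ⟨min 1 (ε / 2), by positivity, fun d hd0 hd => ?_⟩
  have := hd.trans (min_le_right _ _)
  have h4 := @h d (by rw [Real.dist_eq, sub_zero, abs_of_nonneg hd0]; linarith)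
  exact ⟨hd.trans (min_le_left _ _), h4.1.1.le, h4.1.2.le, h4.2.le⟩

theorem step (hQ : AssumptionA Q F e₀) {Φ A0 : ℝ} (hΦ0 : 0 ≤ Φ) (hΦ : ∀ a, -Φ ≤ chi Q a) (hA : A0 * (mass Q + 1) = 4 * π * (-e₀))
    (hA0 : 0 < A0) (n : ℕ) {τ : ℝ} (hτ : 0 < τ) :
    ∃ dn > 0, ∀ f, Nice f → dd f Q ≤ dn → ∀ Z, MeasurableSet Z → (∀ a, 1 / ((n:ℝ) + 1) ≤ -chi1 Q a → a ∈ Z) → ∀ X, 0 ≤ X →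
      (∫⁻ a in Ioi (0:ℝ), ENNReal.ofReal (Z.indicator (fun a => Hp f Q a ^ 2 * (a * chi2 Q a / MM Q a)) a) ≤ ENNReal.ofReal X) →
      (∫ z, En f z * Q z) - (∫ z, En f z * rearr Q f z) ≤ 2 * π * X + (τ + K1 A0 * (bn Q Φ n).toReal) * dd f Q ^ 2 := by
  have hN := A_nice hQ
  obtain ⟨B, hB0, hB⟩ := A_bdd hQ
  set β : ℝ := 1 / ((n:ℝ) + 1) with hβd
  have hβ : 0 < β := by positivity
  set A2 := max A0 √(2 * Φ / β) with hA2
  obtain ⟨C, hC, hgood⟩ := good_orbit hQ hA0 (le_max_left A0 √(2 * Φ / β)) hβ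
  set V : ℝ := B * (2 * Φ / A0 ^ 2) with hV
  have hV0 : 0 ≤ V := by positivity
  obtain ⟨dn, hdn, hsm⟩ := small_d (A2 := A2) (Y := 4 * π ^ 2 * C * V) hβ hA0 (neg_pos.2 hQ.e₀neg) hτ
  refine ⟨dn, hdn, fun f hf hd Z hZ hZn X hX hXI => ?_⟩
  have hd0 : 0 ≤ dd f Q := Real.sqrt_nonneg _
  obtain ⟨s1, s2, s3, s4⟩ := hsm _ hd0 hd
  set d := dd f Q with hdd
  have hK0 : 0 ≤ K1 A0 := by unfold K1; positivity
  set h : ℝ → ℝ := Z.indicator (fun a => Hp f Q a ^ 2 / (2 * (a * MM Q a))) with hh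
  have hhm : Measurable h := by
    have := Hp_meas hf hN
    have := chi1_meas hQ
    have := chi2_meas hQ
    refine Measurable.indicator ?_ hZ
    unfold MM; fun_prop
  obtain ⟨Gm, hGm, hGeq, hGint⟩ := main_fn hQ hhm
  have hmain : ∫⁻ q, Gm q ∂SL ≤ ENNReal.ofReal (2 * π * X) := by
    rw [hGint]
    have e : ∀ a ∈ Ioi (0:ℝ), ENNReal.ofReal (h a) * ENNReal.ofReal (TT Q (1 / a)) = ENNReal.ofReal (1 / (2 * π)) *
        ENNReal.ofReal (Z.indicator (fun a => Hp f Q a ^ 2 * (a * chi2 Q a / MM Q a)) a) := by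
      intro a ha
      have ha' : 0 < a := ha
      rw [← ENNReal.ofReal_mul' (TT_nonneg hQ _), ← ENNReal.ofReal_mul (by positivity)]
      congr 1
      by_cases haZ : a ∈ Z
      · simp only [hh, indicator_of_mem haZ, chi2]
        have := Real.pi_pos
        by_cases hM : MM Q a = 0
        · simp [hM]
        · field_simp
      · simp [hh, haZ]
    rw [setLIntegral_congr_fun measurableSet_Ioi e, lintegral_const_mul' _ _ ENNReal.ofReal_ne_top]
    calc _ ≤ ENNReal.ofReal (4 * π ^ 2) * (ENNReal.ofReal (1 / (2 * π)) * ENNReal.ofReal X) := by gcongr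
      _ = _ := by
        rw [← ENNReal.ofReal_mul (by positivity), ← ENNReal.ofReal_mul (by positivity)]
        congr 1
        have := Real.pi_pos
        field_simp; ring
  set k2 : ℝ := 4 * π ^ 2 * (C * (d ^ 2 * √√d)) with hk2
  have hk20 : 0 ≤ k2 := by positivity
  set G2 : ℝ × ℝ → ℝ≥0∞ := (Act Q).indicator (fun _ => ENNReal.ofReal k2) with hG2
  set G3 : ℝ × ℝ → ℝ≥0∞ := (Act Q \ Wn Q n).indicator (fun q => ENNReal.ofReal (K1 A0 * d ^ 2) * ENNReal.ofReal (Wl Φ q.2)) with hG3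
  have hm2 : Measurable G2 := measurable_const.indicator (Act_meas hQ)
  have hWm : Measurable fun q : ℝ × ℝ => ENNReal.ofReal (Wl Φ q.2) := ((Wl_meas Φ).comp measurable_snd).ennreal_ofReal
  have hm3 : Measurable G3 := (hWm.const_mul _).indicator ((Act_meas hQ).diff (Wn_meas hQ n))
  have hbt : bn Q Φ n ≠ ⊤ := ne_top_of_le_ne_top (bn_top hQ hΦ0 hΦ hA hA0) (lintegral_mono_set sdiff_subset)
  set R : ℝ := 2 * π * X + (τ + K1 A0 * (bn Q Φ n).toReal) * d ^ 2 with hR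
  have hR0 : 0 ≤ R := by positivity
  have hGle : ∫⁻ q, (Gm q + (G2 q + G3 q)) ∂SL ≤ ENNReal.ofReal R := by
    rw [lintegral_add_left hGm, lintegral_add_left hm2, hG2, hG3, lintegral_indicator_const (Act_meas hQ),
      lintegral_indicator ((Act_meas hQ).diff (Wn_meas hQ n)), lintegral_const_mul _ hWm]
    have e1 : R = 2 * π * X + (τ * d ^ 2 + K1 A0 * d ^ 2 * (bn Q Φ n).toReal) := by rw [hR]; ring
    rw [e1, ENNReal.ofReal_add (by positivity) (by positivity), ENNReal.ofReal_add (by positivity) (by positivity)]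
    refine add_le_add hmain (add_le_add ?_ ?_)
    · refine (mul_le_mul_right (SL_Act hQ hΦ hA hA0 hB0 hB) _).trans ?_
      rw [← ENNReal.ofReal_mul hk20]
      apply ENNReal.ofReal_le_ofReal
      have := mul_le_mul_of_nonneg_right s4 (sq_nonneg d)
      calc _ = 4 * π ^ 2 * C * V * √√d * d ^ 2 := by rw [hk2]; ring
        _ ≤ _ := this
    · rw [ENNReal.ofReal_mul (p := K1 A0 * d ^ 2) (by positivity), ENNReal.ofReal_toReal hbt]
      rfl
  refine (bathtub hQ hf (fun q => Gm q + (G2 q + G3 q)) (hGm.add (hm2.add hm3)) (ne_top_of_le_ne_top ENNReal.ofReal_ne_top hGle) ?_).trans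
    (ENNReal.toReal_le_of_le_ofReal hR0 hGle)
  intro s l hs hl c0 hc hc0 hex
  obtain ⟨a1, a2, o, hy2, h1, h2⟩ := orb_exists' hQ hΦ hA hl hc0 hex
  have hact := Act_of_orb hQ hs hl hc o
  have hp1 := o.p1
  have hlt := o.lt
  by_cases hW : (s, l) ∈ Wn Q n
  · obtain ⟨w1, w2, w3⟩ := Wn_orb hQ hl hc o hW
    have ha2 : a2 ≤ A2 := by
      refine le_trans ?_ (le_max_right _ _)
      apply Real.le_sqrt_of_sq_le
      rw [le_div_iff₀ hβ]
      have := mul_le_mul_of_nonneg_right w1 (sq_nonneg a2)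
      linarith
    obtain ⟨η, hη, hle⟩ := hgood f hf s1 s2 s3 s l c0 a1 a2 hs hl hc hc0 o hy2 h1 ha2 w1 w2
    refine ⟨η, hη, (mul_le_mul_right hle _).trans ?_⟩
    rw [mul_add]
    refine add_le_add ?_ (le_trans ?_ le_self_add)
    · rw [hGeq]
      refine mul_le_mul_right ?_ _
      have : ∫⁻ a in Ioo a1 a2, ENNReal.ofReal (Hp f Q a ^ 2 / (2 * (a * MM Q a))) * mm Q s l a = ∫⁻ a in Ioo a1 a2, ENNReal.ofReal (h a) * mm Q s l a := by
        refine setLIntegral_congr_fun measurableSet_Ioo fun a ha => ?_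
        simp only [hh, indicator_of_mem (hZn a (w3 a ha))]
      rw [this]
      exact lintegral_mono_set fun a ha => hp1.trans ha.1
    · rw [hG2, indicator_of_mem hact, ← ENNReal.ofReal_mul (by positivity)]
  · obtain ⟨η, hη, hle⟩ := o.bad_cost hA0 h1 hd0 (H := Hf f Q) (fun a ha => Hf_le hf hN ha.le) (fun a b ha hb => Hf_holder hf hN ha.le hb.le)
    refine ⟨η, by linarith [hQ.e₀neg], (mul_le_mul_right hle _).trans ?_⟩
    refine le_trans ?_ (le_add_self.trans le_add_self)
    have hmem : (s, l) ∈ Act Q \ Wn Q n := ⟨hact, hW⟩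
    rw [hG3, indicator_of_mem hmem, ← ENNReal.ofReal_mul (by positivity), ← ENNReal.ofReal_mul (by positivity)]
    apply ENNReal.ofReal_le_ofReal
    have := Wl_le hΦ0 hl (by linarith : 0 ≤ a2 - a1) (by linarith : a2 - a1 ≤ a2) h2
    calc _ = K1 A0 * d ^ 2 * (1 / √l * (1 + √(a2 - a1) * √√(a2 - a1))) := by unfold K1; ring
      _ ≤ _ := by gcongr

lemma fieldSq_pos (hQ : AssumptionA Q F e₀) : 0 < fieldSq Q := by
  have hN := A_nice hQ
  obtain ⟨z0, hz0⟩ : ∃ z, Q z ≠ 0 := by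
    by_contra h; push Not at h; exact hQ.nonzero (funext h)
  have hz : 0 < Q z0 := lt_of_le_of_ne (hQ.nonneg z0) hz0.symm
  obtain ⟨z, hz, hx⟩ : ∃ z : Phase, 0 < Q z ∧ 0 < ‖z.1‖ := by
    by_cases h : z0.1 = 0
    · have hc : Continuous fun t : ℝ => Q (t • e1, z0.2) := hQ.contQ.comp (by fun_prop)
      have h0 : 0 < Q ((0:ℝ) • e1, z0.2) := by rw [zero_smul, ← h]; exact hz
      have h1 : ∀ᶠ t in 𝓝[>] (0:ℝ), 0 < Q (t • e1, z0.2) := (hc.continuousAt.eventually (lt_mem_nhds h0)).filter_mono nhdsWithin_le_nhds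
      obtain ⟨t, ht, ht0⟩ := (h1.and self_mem_nhdsWithin).exists
      have ht' : (0:ℝ) < t := ht0
      refine ⟨_, ht, ?_⟩
      have := norm_pt1 ht' 0 0
      simp only [pt] at this
      simp only [this]; exact ht'
    · exact ⟨z0, hz, norm_pos_iff.2 h⟩
  rw [fieldSq_eq hN]
  have hi := (dual_int hN hN).1
  simp only [← pow_two] at hi
  refine div_pos ?_ (by positivity)
  rw [setIntegral_pos_iff_support_of_nonneg_ae (ae_of_all _ fun a => sq_nonneg _) hi]
  refine lt_of_lt_of_le ?_ (measure_mono (show Ioo 0 (1 / ‖z.1‖) ⊆ _ from fun a ha => ⟨?_, ha.1⟩))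
  · rw [Real.volume_Ioo]; simpa using norm_pos_iff.1 hx
  · exact (pow_pos (nf_pos hQ hz hx ha.2) 2).ne'

lemma ratio_bd (hQ : AssumptionA Q F e₀) {K a : ℝ} (ha : 0 < a) (hK : π * (TT Q (1 / a) * (1 / a)) ≤ K) :
    a * chi2 Q a / MM Q a ≤ 1 ∧ 0 ≤ a * chi2 Q a / MM Q a ∧ ∀ ε > 0, ε ≤ -chi1 Q a → a * chi2 Q a / MM Q a ≤ 1 - ε / (K + ε) := by
  have h1 := chi1_nonpos hQ a
  have h2 := mul_nonneg ha.le (chi2_nonneg hQ a)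
  have e : a * chi2 Q a = π * (TT Q (1 / a) * (1 / a)) := by unfold chi2; field_simp
  have h3 : a * chi2 Q a ≤ K := e.trans_le hK
  have hM : MM Q a = a * chi2 Q a + -chi1 Q a := by unfold MM; ring
  have h4 : 0 ≤ MM Q a := by rw [hM]; positivity
  refine ⟨div_le_one_of_le₀ (by rw [hM]; linarith) h4, by positivity, fun ε hε hle => ?_⟩
  have h5 : 0 < MM Q a := by rw [hM]; linarith
  have h6 : 0 < K + ε := by linarith
  have h7 : 1 - ε / (K + ε) = K / (K + ε) := by field_simp; ring
  rw [h7, div_le_div_iff₀ h5 h6, hM]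
  nlinarith

theorem final (hQ : AssumptionA Q F e₀) : ∃ κ > 0, ∃ dm > 0, ∀ f, Nice f → dd f Q ≤ dm → π * κ * dd f Q ^ 2 ≤ Jred Q f - Jred Q Q := by
  have hN := A_nice hQ
  have hpi := Real.pi_pos
  obtain ⟨Φ, hΦ0, hΦ⟩ := chi_bdd hN
  obtain ⟨K', hK'0, hK', -⟩ := TT_bd hQ
  have hm := mass_nonneg hN
  have hE := hQ.e₀neg
  set A0 : ℝ := 4 * π * (-e₀) / (mass Q + 1) with hA0d
  have hA0 : 0 < A0 := div_pos (mul_pos (by positivity) (by linarith)) (by linarith)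
  have hA : A0 * (mass Q + 1) = 4 * π * (-e₀) := div_mul_cancel₀ _ (by linarith)
  have hK0 : 0 ≤ K1 A0 := by unfold K1; positivity
  have hbn : ∀ τ > 0, ∃ n, K1 A0 * (bn Q Φ n).toReal ≤ τ := by
    intro τ hτ
    have h1 := (ENNReal.tendsto_toReal ENNReal.zero_ne_top).comp (bn_tendsto hQ hΦ0 hΦ hA hA0)
    have h2 := (h1.const_mul (K1 A0)).eventually (gt_mem_nhds (show K1 A0 * (0:ℝ≥0∞).toReal < τ by simpa using hτ))
    obtain ⟨n, hn⟩ := h2.exists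
    exact ⟨n, hn.le⟩
  obtain ⟨n, hn⟩ := hbn (π / 2) (by positivity)
  set ε : ℝ := 1 / ((n:ℝ) + 1) with hε
  have hε0 : 0 < ε := by positivity
  set K := π * K' with hK
  have hKε : 0 < K + ε := by positivity
  set κ := ε / (K + ε) / 4 with hκ
  have hκ0 : 0 < κ := by positivity
  have hκ1 : κ ≤ 1 / 4 := by
    have : ε / (K + ε) ≤ 1 := by rw [div_le_one hKε]; linarith [mul_nonneg hpi.le hK'0]
    linarith
  obtain ⟨m, hm'⟩ := hbn (π * κ / 2) (by positivity)
  obtain ⟨d1, hd1, H1⟩ := step hQ hΦ0 hΦ hA hA0 n (τ := π / 2) (by positivity)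
  obtain ⟨d2, hd2, H2⟩ := step hQ hΦ0 hΦ hA hA0 m (τ := π * κ / 2) (by positivity)
  refine ⟨κ, hκ0, min d1 d2, lt_min hd1 hd2, fun f hf hd => ?_⟩
  rw [J_id' hQ hf, (dd_fieldDist hf hN).2]
  have eJ : (4 * π) ^ 2 * dd f Q ^ 2 / (8 * π) = 2 * π * dd f Q ^ 2 := by field_simp; ring
  rw [eJ]
  have hsq : ∫ a in Ioi (0:ℝ), Hp f Q a ^ 2 = dd f Q ^ 2 := by
    rw [dd, Real.sq_sqrt (integral_nonneg fun a => sq_nonneg _)]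
  have hHi := Hp_sq_int hf hN
  have hD := sq_nonneg (dd f Q)
  set Z : Set ℝ := {a | ε ≤ -chi1 Q a} with hZ
  have hZm : MeasurableSet Z := measurableSet_le measurable_const (chi1_meas hQ).neg
  have hZi : IntegrableOn (Z.indicator fun a => Hp f Q a ^ 2) (Ioi 0) := hHi.indicator hZm
  have hrb : ∀ a ∈ Ioi (0:ℝ), _ := fun a (ha : 0 < a) => ratio_bd hQ ha (K := K) (by
    rw [hK]; exact mul_le_mul_of_nonneg_left (hK' _ (by positivity)) hpi.le)
  by_cases hcase : ∫ a in Ioi (0:ℝ), Z.indicator (fun a => Hp f Q a ^ 2) a ≤ dd f Q ^ 2 / 4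
  · have := H1 f hf (hd.trans (min_le_left _ _)) Z hZm (fun a ha => ha) (dd f Q ^ 2 / 4) (by positivity) (by
      refine le_trans ?_ (ENNReal.ofReal_le_ofReal hcase)
      rw [ofReal_integral_eq_lintegral_ofReal hZi (ae_of_all _ fun a => indicator_nonneg (fun _ _ => sq_nonneg _) a)]
      refine setLIntegral_mono' measurableSet_Ioi fun a ha => ENNReal.ofReal_le_ofReal ?_
      by_cases haZ : a ∈ Z
      · simp only [indicator_of_mem haZ]
        exact mul_le_of_le_one_right (sq_nonneg _) (hrb a ha).1
      · simp [haZ])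
    nlinarith [mul_le_mul_of_nonneg_right hn hD, mul_le_mul_of_nonneg_right (mul_le_mul_of_nonneg_left hκ1 hpi.le) hD]
  · push Not at hcase
    have hX : ∫ a in Ioi (0:ℝ), (Hp f Q a ^ 2 - ε / (K + ε) * Z.indicator (fun a => Hp f Q a ^ 2) a) ≤ (1 - κ) * dd f Q ^ 2 := by
      rw [integral_sub hHi (hZi.const_mul _), integral_const_mul, hsq]
      have : 0 < ε / (K + ε) := by positivity
      have := mul_le_mul_of_nonneg_left hcase.le this.le
      rw [hκ]; linarith
    have := H2 f hf (hd.trans (min_le_right _ _)) univ MeasurableSet.univ (fun a _ => trivial) ((1 - κ) * dd f Q ^ 2)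
      (mul_nonneg (by linarith) hD) (by
      refine le_trans ?_ (ENNReal.ofReal_le_ofReal hX)
      have hp : ∀ a ∈ Ioi (0:ℝ), Hp f Q a ^ 2 * (a * chi2 Q a / MM Q a) ≤ Hp f Q a ^ 2 - ε / (K + ε) * Z.indicator (fun a => Hp f Q a ^ 2) a := by
        intro a ha
        obtain ⟨r1, r2, r3⟩ := hrb a ha
        by_cases haZ : a ∈ Z
        · simp only [indicator_of_mem haZ]
          have := mul_le_mul_of_nonneg_left (r3 ε hε0 haZ) (sq_nonneg (Hp f Q a))
          linarith
        · simp only [indicator_of_notMem haZ]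
          have := mul_le_of_le_one_right (sq_nonneg (Hp f Q a)) r1
          linarith
      have hi : IntegrableOn (fun a => Hp f Q a ^ 2 - ε / (K + ε) * Z.indicator (fun a => Hp f Q a ^ 2) a) (Ioi 0) := hHi.sub (hZi.const_mul _)
      rw [ofReal_integral_eq_lintegral_ofReal hi ((ae_restrict_mem measurableSet_Ioi).mono fun a ha =>
        (mul_nonneg (sq_nonneg _) (hrb a ha).2.1).trans (hp a ha))]
      refine setLIntegral_mono' measurableSet_Ioi fun a ha => ENNReal.ofReal_le_ofReal ?_
      rw [indicator_univ]
      exact hp a ha)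
    nlinarith [mul_le_mul_of_nonneg_right hm' hD]

end M20

/-- `φ_Q` is a local strict minimizer of the reduced functional `J`. -/
theorem stmt17 (Q : Phase → ℝ) (F : ℝ → ℝ → ℝ) (e₀ : ℝ) (hQ : AssumptionA Q F e₀) :
    ∃ C₀ : ℝ, 0 < C₀ ∧ ∀ R : ℝ, 0 < R →
      ∃ δ₀ : ℝ, 0 < δ₀ ∧ δ₀ ≤ Real.sqrt (fieldSq Q) / 2 ∧
        ∀ f : Phase → ℝ, memErad f →
          eNormE (fun z => f z - Q z) ≤ ENNReal.ofReal R →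
          fieldDist f Q ≤ δ₀ →
          Jred Q f - Jred Q Q ≥ C₀ * (fieldDist f Q) ^ 2 := by
  obtain ⟨κ, hκ, dm, hdm, H⟩ := final hQ
  have hN := A_nice hQ
  refine ⟨κ / 4, by positivity, fun R _ => ⟨min (√(fieldSq Q) / 2) dm, ?_, min_le_left _ _, fun f hf _ hd => ?_⟩⟩
  · have := Real.sqrt_pos.2 (fieldSq_pos hQ)
    positivity
  have hfN := memErad_nice hf
  have e := (dd_fieldDist hfN hN).1
  have h1 : dd f Q ≤ dm := by
    have h0 : 0 ≤ fieldDist f Q := Real.sqrt_nonneg _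
    have h2 := hd.trans (min_le_right _ _)
    refine abs_le_of_sq_le_sq' ?_ hdm.le |>.2
    have h3 : fieldDist f Q ^ 2 ≤ dm ^ 2 := by gcongr
    have := Real.pi_gt_three
    nlinarith [sq_nonneg (dd f Q)]
  have := H f hfN h1
  rw [e]; linarith
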